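/- Let Ω ⊂ ℝⁿ be a nonempty bounded open set and assume p satisfies (P1) and (P2) in Ω. Suppose u ∈ W^{s,p(·,·)}(ℝⁿ) is a weak solution of (−Δ)^s_{p(·,·)}u = 0 in Ω and satisfies sup_{x∈Ω} ∫_{ℝⁿ} |u(y)|^{p(x,y)−1}(1+|y|^{n+s·p(x,y)})^{−1} dy < ∞. Then u is locally Hölder continuous in Ω: for every x₀ ∈ Ω there exist r > 0 with B_r(x₀) ⊆ Ω, α ∈ (0,1), and C > 0 such that u agrees almost everywhere on B_r(x₀) with a function v satisfying |v(x)−v(y)| ≤ C|x−y|^α for all x, y ∈ B_r(x₀). -/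

import Mathlib

open MeasureTheory Metric Set Filter
open scoped ENNReal Topology
noncomputable section

/-- `ℝⁿ` with the Euclidean norm and Lebesgue measure. -/
abbrev Rn (n : ℕ) := EuclideanSpace ℝ (Fin n)

/-- `p₊(E × F) = sup_{x ∈ E, y ∈ F} p(x,y)`. -/
def pSup {n : ℕ} (p : Rn n → Rn n → ℝ) (E F : Set (Rn n)) : ℝ :=
  sSup (Set.image2 p E F)

/-- `p₋(E × F) = inf_{x ∈ E, y ∈ F} p(x,y)`. -/
def pInf {n : ℕ} (p : Rn n → Rn n → ℝ) (E F : Set (Rn n)) : ℝ :=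
  sInf (Set.image2 p E F)

/-- Standing assumptions on the variable exponent: continuity, symmetry and
`1 < inf p ≤ sup p < ∞`. -/
def ExponentOK {n : ℕ} (p : Rn n → Rn n → ℝ) : Prop :=
  Continuous (fun z : Rn n × Rn n => p z.1 z.2) ∧ (∀ x y, p x y = p y x) ∧
    ∃ pm pM : ℝ, 1 < pm ∧ ∀ x y, pm ≤ p x y ∧ p x y ≤ pM

/-- Membership in the fractional Sobolev space `W^{s,p(·,·)}(ℝⁿ)`. -/
def MemW {n : ℕ} (s : ℝ) (p : Rn n → Rn n → ℝ) (u : Rn n → ℝ) : Prop :=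
  Measurable u ∧
    (∫⁻ x, ENNReal.ofReal (|u x| ^ p x x)) < ⊤ ∧
    (∫⁻ x, ∫⁻ y, ENNReal.ofReal (|u x - u y| ^ p x y / ‖x - y‖ ^ ((n : ℝ) + s * p x y))) < ⊤

/-- Weak subsolution of `(-Δ)^s_{p(·,·)} u = 0` in `Ω`. -/
def IsWeakSubsol {n : ℕ} (s : ℝ) (p : Rn n → Rn n → ℝ) (Ω : Set (Rn n)) (u : Rn n → ℝ) : Prop :=
  ∀ φ : Rn n → ℝ, MemW s p φ → (∀ x, 0 ≤ φ x) → (∀ᵐ x, x ∉ Ω → φ x = 0) →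
    (∫ x, ∫ y, |u x - u y| ^ (p x y - 2) * (u x - u y) * (φ x - φ y)
      / ‖x - y‖ ^ ((n : ℝ) + s * p x y)) ≤ 0

/-- Weak supersolution of `(-Δ)^s_{p(·,·)} u = 0` in `Ω`. -/
def IsWeakSupersol {n : ℕ} (s : ℝ) (p : Rn n → Rn n → ℝ) (Ω : Set (Rn n)) (u : Rn n → ℝ) : Prop :=
  ∀ φ : Rn n → ℝ, MemW s p φ → (∀ x, 0 ≤ φ x) → (∀ᵐ x, x ∉ Ω → φ x = 0) →
    0 ≤ (∫ x, ∫ y, |u x - u y| ^ (p x y - 2) * (u x - u y) * (φ x - φ y)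
      / ‖x - y‖ ^ ((n : ℝ) + s * p x y))

/-- Weak solution of `(-Δ)^s_{p(·,·)} u = 0` in `Ω`. -/
def IsWeakSol {n : ℕ} (s : ℝ) (p : Rn n → Rn n → ℝ) (Ω : Set (Rn n)) (u : Rn n → ℝ) : Prop :=
  IsWeakSubsol s p Ω u ∧ IsWeakSupersol s p Ω u

/-- Condition (P1) in `Ω` with constant `L`. -/
def CondP1 {n : ℕ} (p : Rn n → Rn n → ℝ) (Ω : Set (Rn n)) (L : ℝ) : Prop :=
  ∀ (x₀ : Rn n) (R : ℝ), 0 < R → closedBall x₀ R ⊆ Ω →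
    R ^ (pInf p (ball x₀ R) (ball x₀ R) - pSup p (ball x₀ R) (ball x₀ R)) ≤ L

/-- Condition (P2) in `Ω`. -/
def CondP2 {n : ℕ} (p : Rn n → Rn n → ℝ) (Ω : Set (Rn n)) : Prop :=
  ∀ (x₀ : Rn n) (R : ℝ), 0 < R → closedBall x₀ R ⊆ Ω →
    pSup p (ball x₀ R) ((ball x₀ R)ᶜ) ≤ pSup p (ball x₀ R) (ball x₀ R) ∧
    pInf p (ball x₀ R) ((ball x₀ R)ᶜ) ≤ pInf p (ball x₀ R) (ball x₀ R)

/-- The odd power `t ↦ |t|^(q-2) t`. -/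
def signedPow (q t : ℝ) : ℝ := |t| ^ (q - 2) * t

lemma signedPow_of_nonneg {q t : ℝ} (ht : 0 ≤ t) (hq : 1 < q) : signedPow q t = t ^ (q - 1) := by
  unfold signedPow
  rcases ht.eq_or_lt with rfl | ht
  · rw [Real.zero_rpow (by linarith)]; simp
  · rw [abs_of_pos ht, show q - 1 = (q - 2) + 1 by ring, Real.rpow_add_one ht.ne']

lemma signedPow_neg (q t : ℝ) : signedPow q (-t) = -signedPow q t := by
  unfold signedPow; rw [abs_neg]; ring

lemma abs_signedPow {q : ℝ} (t : ℝ) (hq : 1 < q) : |signedPow q t| = |t| ^ (q - 1) := by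
  rcases le_total 0 t with h | h
  · rw [signedPow_of_nonneg h hq, abs_of_nonneg h, abs_of_nonneg (Real.rpow_nonneg h _)]
  · have := signedPow_of_nonneg (t := -t) (by linarith) hq
    rw [signedPow_neg] at this
    rw [← abs_neg, this, abs_of_nonpos h, abs_of_nonneg (Real.rpow_nonneg (by linarith) _)]

lemma rpow_sub_one_mul_self {a q : ℝ} (ha : 0 ≤ a) (hq : 1 < q) : a ^ (q - 1) * a = a ^ q := by
  rcases ha.eq_or_lt with rfl | ha
  · rw [Real.zero_rpow (by linarith : q ≠ 0)]; simp
  · rw [← Real.rpow_add_one ha.ne']; congr 1; ring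

lemma abs_pow_sub_pow_le_mul_max {x y : ℝ} (hx : 0 ≤ x) (hy : 0 ≤ y) (m : ℕ) :
    |x ^ m - y ^ m| ≤ m * max x y ^ (m - 1) * |x - y| := by
  have h := abs_pow_sub_pow_le x y m
  rw [abs_of_nonneg hx, abs_of_nonneg hy] at h
  linarith

/-- An absorption inequality for the cross term in the energy estimate. -/
lemma absorb_cross_term {a b q Q M : ℝ} {m : ℕ} (ha : 0 ≤ a) (hb : 0 ≤ b) (hq : 1 < q) (hqQ : q ≤ Q)
    (hQm : Q ≤ m) (hM0 : 0 ≤ M) (hM1 : M ≤ 1) :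
    a ^ (q - 1) * (m * M ^ (m - 1) * b) ≤ 1 / 2 * (a ^ q * M ^ m) + (2 * m : ℝ) ^ Q * b ^ q := by
  have hm1 : (1:ℝ) < m := by linarith
  have hm1' : 1 < m := by exact_mod_cast hm1
  have hMm : M ^ m = M ^ (m - 1) * M := by
    rw [← pow_succ]; congr 1; omega
  have hpm : 0 ≤ M ^ (m - 1) := by positivity
  have ha1 : 0 ≤ a ^ (q - 1) := Real.rpow_nonneg ha _
  have hbq : 0 ≤ b ^ q := Real.rpow_nonneg hb _
  rcases le_or_gt (m * b) (a * M / 2) with h | h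
  · have h1 : a ^ (q - 1) * (m * M ^ (m - 1) * b) ≤ a ^ (q - 1) * (M ^ (m - 1) * (a * M / 2)) := by
      apply mul_le_mul_of_nonneg_left _ ha1
      nlinarith
    have h2 : a ^ (q - 1) * (M ^ (m - 1) * (a * M / 2)) = 1 / 2 * (a ^ q * M ^ m) := by
      rw [hMm, ← rpow_sub_one_mul_self ha hq]; ring
    have : 0 ≤ (2 * m : ℝ) ^ Q * b ^ q := by positivity
    linarith
  · have hle : a * M ≤ 2 * m * b := by linarith
    have h1 : M ^ (m - 1) ≤ M ^ (q - 1) := by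
      rw [← Real.rpow_natCast]
      rcases hM0.eq_or_lt with rfl | hM
      · rw [Real.zero_rpow, Real.zero_rpow] <;> [linarith; skip]
        have : 0 < m - 1 := by omega
        exact_mod_cast this.ne'
      · apply Real.rpow_le_rpow_of_exponent_ge hM hM1
        rw [Nat.cast_sub hm1'.le]; push_cast; linarith
    calc a ^ (q - 1) * (m * M ^ (m - 1) * b) ≤ a ^ (q - 1) * (m * M ^ (q - 1) * b) := by gcongr
      _ = (a * M) ^ (q - 1) * (m * b) := by rw [Real.mul_rpow ha hM0]; ring
      _ ≤ (2 * m * b) ^ (q - 1) * (2 * m * b) := by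
          gcongr
          linarith
      _ = (2 * m : ℝ) ^ q * b ^ q := by
          rw [rpow_sub_one_mul_self (by positivity) hq, Real.mul_rpow (by positivity) hb]
      _ ≤ (2 * m : ℝ) ^ Q * b ^ q := by
          gcongr; linarith
      _ ≤ _ := by
          have : 0 ≤ a ^ q * M ^ m := mul_nonneg (Real.rpow_nonneg ha _) (by positivity)
          linarith

lemma energy_pointwise_aux {u₁ u₂ k e₁ e₂ q Q : ℝ} {m : ℕ} (hq : 1 < q) (hqQ : q ≤ Q)
    (hQm : Q ≤ m) (h₁ : 0 ≤ e₁) (h₁' : e₁ ≤ 1) (h₂ : 0 ≤ e₂) (h₂' : e₂ ≤ 1) (hu : u₂ ≤ u₁) :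
    1 / 2 * (|max (u₁ - k) 0 - max (u₂ - k) 0| ^ q * max e₁ e₂ ^ m) ≤
      signedPow q (u₁ - u₂) * (max (u₁ - k) 0 * e₁ ^ m - max (u₂ - k) 0 * e₂ ^ m) +
        (2 * m : ℝ) ^ Q * (max (max (u₁ - k) 0) (max (u₂ - k) 0) * |e₁ - e₂|) ^ q := by
  set a := max (u₁ - k) 0 with ha
  set b := max (u₂ - k) 0 with hb
  set M := max e₁ e₂ with hM
  have ha0 : 0 ≤ a := le_max_right _ _
  have hb0 : 0 ≤ b := le_max_right _ _
  have hM0 : 0 ≤ M := le_max_of_le_left h₁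
  have hM1 : M ≤ 1 := max_le h₁' h₂'
  have hab : b ≤ a := max_le_max (by linarith) le_rfl
  rw [abs_of_nonneg (by linarith), max_eq_left hab, signedPow_of_nonneg (by linarith) hq]
  have key := absorb_cross_term (b := a * |e₁ - e₂|) (sub_nonneg.2 hab) (by positivity) hq hqQ hQm
    hM0 hM1
  have hd := abs_pow_sub_pow_le_mul_max h₁ h₂ m
  rw [← hM] at hd
  have hD : (a - b) * M ^ m - a * (m * M ^ (m - 1) * |e₁ - e₂|) ≤ a * e₁ ^ m - b * e₂ ^ m := by
    rcases le_total e₁ e₂ with h | h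
    · have hMe : M = e₂ := max_eq_right h
      have := neg_abs_le (e₁ ^ m - e₂ ^ m)
      rw [hMe] at hd ⊢
      nlinarith
    · have hMe : M = e₁ := max_eq_left h
      have h3 := pow_le_pow_left₀ h₂ h m
      have h5 := le_trans (abs_nonneg _) hd
      rw [hMe] at hd h5 ⊢
      nlinarith
  have hJ : (a - b) ^ (q - 1) * (a * e₁ ^ m - b * e₂ ^ m) ≤
      (u₁ - u₂) ^ (q - 1) * (a * e₁ ^ m - b * e₂ ^ m) := by
    rcases le_or_gt u₁ k with h | h
    · have : a = 0 := max_eq_right (by linarith)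
      have hb' : b = 0 := le_antisymm (by linarith) hb0
      simp [this, hb']
    · have haa : a = u₁ - k := max_eq_left (by linarith)
      rcases le_or_gt u₂ k with h' | h'
      · have hbb : b = 0 := max_eq_right (by linarith)
        rw [hbb, haa]
        have : 0 ≤ (u₁ - k) * e₁ ^ m := mul_nonneg (by linarith) (by positivity)
        simp only [sub_zero, zero_mul]
        apply mul_le_mul_of_nonneg_right _ this
        apply Real.rpow_le_rpow (by linarith) (by linarith) (by linarith)
      · have hbb : b = u₂ - k := max_eq_left (by linarith)
        rw [hbb, haa]
        simp
  have hP : 0 ≤ (a - b) ^ (q - 1) := Real.rpow_nonneg (by linarith) _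
  have h6 := mul_le_mul_of_nonneg_left hD hP
  have h7 : (a - b) ^ (q - 1) * ((a - b) * M ^ m) = (a - b) ^ q * M ^ m := by
    rw [← mul_assoc, rpow_sub_one_mul_self (by linarith) hq]
  nlinarith

/-- The pointwise energy inequality behind the Caccioppoli estimate. -/
lemma energy_pointwise {u₁ u₂ k e₁ e₂ q Q : ℝ} {m : ℕ} (hq : 1 < q) (hqQ : q ≤ Q)
    (hQm : Q ≤ m) (h₁ : 0 ≤ e₁) (h₁' : e₁ ≤ 1) (h₂ : 0 ≤ e₂) (h₂' : e₂ ≤ 1) :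
    1 / 2 * (|max (u₁ - k) 0 - max (u₂ - k) 0| ^ q * max e₁ e₂ ^ m) ≤
      signedPow q (u₁ - u₂) * (max (u₁ - k) 0 * e₁ ^ m - max (u₂ - k) 0 * e₂ ^ m) +
        (2 * m : ℝ) ^ Q * (max (max (u₁ - k) 0) (max (u₂ - k) 0) * |e₁ - e₂|) ^ q := by
  rcases le_total u₂ u₁ with h | h
  · exact energy_pointwise_aux hq hqQ hQm h₁ h₁' h₂ h₂' h
  · have := energy_pointwise_aux (k := k) hq hqQ hQm h₂ h₂' h₁ h₁' h
    rw [abs_sub_comm, max_comm e₁ e₂, abs_sub_comm e₁ e₂, max_comm (max (u₁ - k) 0),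
      show u₁ - u₂ = -(u₂ - u₁) by ring, signedPow_neg]
    linarith

lemma crossing_pointwise {u₁ u₂ k e₁ e₂ q : ℝ} {m : ℕ} (hq : 1 < q) (h₁ : k < u₁) (h₂ : u₂ ≤ k) :
    (u₁ - u₂) ^ (q - 1) * max (u₁ - k) 0 * e₁ ^ m =
      signedPow q (u₁ - u₂) * (max (u₁ - k) 0 * e₁ ^ m - max (u₂ - k) 0 * e₂ ^ m) := by
  rw [max_eq_right (by linarith : u₂ - k ≤ 0), signedPow_of_nonneg (by linarith) hq]; ring

lemma outer_pointwise {u₁ u₂ k e q : ℝ} {m : ℕ} (hq : 1 < q) (h₁ : 0 ≤ e) (h₁' : e ≤ 1) :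
    0 ≤ signedPow q (u₁ - u₂) * (max (u₁ - k) 0 * e ^ m) +
      max (u₂ - k) 0 ^ (q - 1) * max (u₁ - k) 0 := by
  rcases le_or_gt u₁ k with h | h
  · rw [max_eq_right (by linarith : u₁ - k ≤ 0)]; simp
  · have he : e ^ m ≤ 1 := pow_le_one₀ h₁ h₁'
    have he0 : 0 ≤ e ^ m := by positivity
    rw [max_eq_left (by linarith : 0 ≤ u₁ - k)]
    have hw : 0 ≤ max (u₂ - k) 0 ^ (q - 1) := Real.rpow_nonneg (le_max_right _ _) _
    have hE : 0 ≤ (u₁ - k) * e ^ m := mul_nonneg (by linarith) he0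
    rcases le_total u₂ u₁ with h' | h'
    · rw [signedPow_of_nonneg (by linarith) hq]
      have := mul_nonneg (Real.rpow_nonneg (sub_nonneg.2 h') (q - 1)) hE
      have := mul_nonneg hw (by linarith : 0 ≤ u₁ - k)
      linarith
    · rw [show u₁ - u₂ = -(u₂ - u₁) by ring, signedPow_neg, signedPow_of_nonneg (by linarith) hq]
      have h3 : (u₂ - u₁) ^ (q - 1) ≤ max (u₂ - k) 0 ^ (q - 1) :=
        Real.rpow_le_rpow (by linarith) (le_max_of_le_left (by linarith)) (by linarith)
      have h4 : (u₂ - u₁) ^ (q - 1) * ((u₁ - k) * e ^ m) ≤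
          max (u₂ - k) 0 ^ (q - 1) * ((u₁ - k) * e ^ m) := mul_le_mul_of_nonneg_right h3 hE
      have h5 : max (u₂ - k) 0 ^ (q - 1) * ((u₁ - k) * e ^ m) ≤
          max (u₂ - k) 0 ^ (q - 1) * (u₁ - k) := by
        apply mul_le_mul_of_nonneg_left _ hw
        nlinarith
      linarith

/-- The singular kernel `|z|^(-(n + s q))`. -/
def rker {n : ℕ} (s q : ℝ) (z : Rn n) : ℝ := (‖z‖ ^ ((n : ℝ) + s * q))⁻¹

lemma rker_nonneg {n : ℕ} (s q : ℝ) (z : Rn n) : 0 ≤ rker s q z :=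
  inv_nonneg.2 (Real.rpow_nonneg (norm_nonneg _) _)

lemma rker_neg {n : ℕ} (s q : ℝ) (z : Rn n) : rker s q (-z) = rker s q z := by
  simp [rker]

lemma rker_sub_comm {n : ℕ} (s q : ℝ) (x y : Rn n) : rker s q (x - y) = rker s q (y - x) := by
  rw [← rker_neg, neg_sub]

/-- The volume of the unit ball. -/
def unitBallVol (n : ℕ) : ℝ := (volume (ball (0 : Rn n) 1)).toReal

lemma unitBallVol_pos (n : ℕ) : 0 < unitBallVol n :=
  ENNReal.toReal_pos (measure_ball_pos _ _ one_pos).ne' measure_ball_lt_top.ne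

lemma volume_ball_eq {n : ℕ} (x : Rn n) {r : ℝ} (hr : 0 < r) :
    volume (ball x r) = ENNReal.ofReal (unitBallVol n * r ^ n) := by
  rw [Measure.addHaar_ball_of_pos _ _ hr, finrank_euclideanSpace_fin,
    ENNReal.ofReal_mul (unitBallVol_pos n).le, unitBallVol,
    ENNReal.ofReal_toReal measure_ball_lt_top.ne, mul_comm]

lemma lintegral_ball_norm_rpow_lt_top {n : ℕ} (hn : 1 ≤ n) {c : ℝ} (hc : 0 < c) :
    (∫⁻ z in ball (0 : Rn n) 1, ENNReal.ofReal (‖z‖ ^ (c - n))) < ⊤ := by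
  have : Nontrivial (Rn n) := by
    have : Nonempty (Fin n) := ⟨⟨0, hn⟩⟩
    infer_instance
  have h : IntegrableOn (fun x : Rn n => ‖x‖ ^ (c - n)) (ball 0 1) volume := by
    rw [integrableOn_fun_norm_addHaar volume (f := fun t : ℝ => t ^ (c - n)), finrank_euclideanSpace_fin]
    have h1 : IntegrableOn (fun t : ℝ => t ^ (c - 1)) (Ioo 0 1) :=
      (intervalIntegral.integrableOn_Ioo_rpow_iff one_pos).2 (by linarith)
    refine h1.congr_fun (fun t ht => ?_) measurableSet_Ioo
    simp only [smul_eq_mul]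
    rw [← Real.rpow_natCast, ← Real.rpow_add ht.1, Nat.cast_sub hn]
    congr 1; push_cast; ring
  have := h.2
  rw [hasFiniteIntegral_iff_ofReal] at this
  · exact this
  · exact Eventually.of_forall fun z => Real.rpow_nonneg (norm_nonneg _) _

/-- Integrable majorant of the truncated singular kernels. -/
def kernelMajorant (n : ℕ) (s pm : ℝ) (z : Rn n) : ℝ≥0∞ :=
  (ball (0 : Rn n) 1).indicator (fun z => ENNReal.ofReal (‖z‖ ^ (pm * (1 - s) - n))) z +
    ENNReal.ofReal (2 ^ ((n : ℝ) + s)) * ENNReal.ofReal ((1 + ‖z‖) ^ (-((n : ℝ) + s)))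

lemma lintegral_kernelMajorant_lt_top {n : ℕ} (hn : 1 ≤ n) {s pm : ℝ} (hs : s ∈ Ioo (0 : ℝ) 1)
    (hpm : 0 < pm) : (∫⁻ z, kernelMajorant n s pm z) < ⊤ := by
  unfold kernelMajorant
  rw [lintegral_add_left (Measurable.indicator (by fun_prop) measurableSet_ball),
    lintegral_indicator measurableSet_ball, lintegral_const_mul' _ _ ENNReal.ofReal_ne_top]
  refine ENNReal.add_lt_top.2 ⟨lintegral_ball_norm_rpow_lt_top hn (mul_pos hpm (by linarith [hs.2])),
    ENNReal.mul_lt_top ENNReal.ofReal_lt_top (finite_integral_one_add_norm ?_)⟩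
  rw [finrank_euclideanSpace_fin]; linarith [hs.1]

lemma truncated_kernel_le {n : ℕ} {s pm pM ℓ q : ℝ} (hs : s ∈ Ioo (0 : ℝ) 1) (hpm : 1 < pm)
    (hq : pm ≤ q) (hqM : q ≤ pM) (hℓ : 1 ≤ ℓ) (z : Rn n) :
    ENNReal.ofReal (min 1 (ℓ * ‖z‖) ^ q * rker s q z) ≤
      ENNReal.ofReal (ℓ ^ pM) * kernelMajorant n s pm z := by
  obtain ⟨hs0, hs1⟩ := hs
  have hℓM : 1 ≤ ℓ ^ pM := Real.one_le_rpow hℓ (by linarith)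
  unfold kernelMajorant rker
  rcases (norm_nonneg z).eq_or_lt with h0 | h0
  · rw [← h0]
    rw [mul_zero, min_eq_right zero_le_one, Real.zero_rpow (by linarith), zero_mul]
    simp
  · rcases lt_or_ge ‖z‖ 1 with h1 | h1
    · rw [indicator_of_mem (by simpa using h1), mul_add]
      refine le_trans ?_ le_self_add
      rw [← ENNReal.ofReal_mul (by positivity)]
      apply ENNReal.ofReal_le_ofReal
      calc min 1 (ℓ * ‖z‖) ^ q * (‖z‖ ^ ((n : ℝ) + s * q))⁻¹
          ≤ (ℓ * ‖z‖) ^ q * (‖z‖ ^ ((n : ℝ) + s * q))⁻¹ := by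
            apply mul_le_mul_of_nonneg_right _ (by positivity)
            exact Real.rpow_le_rpow (le_min zero_le_one (by positivity)) (min_le_right _ _)
              (by linarith)
        _ = ℓ ^ q * ‖z‖ ^ (q * (1 - s) - n) := by
            rw [Real.mul_rpow (by linarith) h0.le, ← Real.rpow_neg h0.le, mul_assoc,
              ← Real.rpow_add h0]
            congr 2; ring
        _ ≤ ℓ ^ pM * ‖z‖ ^ (pm * (1 - s) - n) := by
            apply mul_le_mul (Real.rpow_le_rpow_of_exponent_le hℓ hqM) _ (by positivity)
              (by positivity)
            apply Real.rpow_le_rpow_of_exponent_ge h0 h1.le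
            have : pm * (1 - s) ≤ q * (1 - s) := mul_le_mul_of_nonneg_right hq (by linarith)
            linarith
    · rw [indicator_of_notMem (by simpa using h1), zero_add, ← ENNReal.ofReal_mul (by positivity),
        ← ENNReal.ofReal_mul (by positivity)]
      apply ENNReal.ofReal_le_ofReal
      have hsq : s ≤ s * q := by nlinarith
      calc min 1 (ℓ * ‖z‖) ^ q * (‖z‖ ^ ((n : ℝ) + s * q))⁻¹
          ≤ 1 * (‖z‖ ^ ((n : ℝ) + s))⁻¹ := by
            gcongr
            · apply Real.rpow_le_one _ (min_le_left _ _) (by linarith)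
              exact le_min zero_le_one (by positivity)
        _ ≤ 1 * (2 ^ ((n : ℝ) + s) * (1 + ‖z‖) ^ (-((n : ℝ) + s))) := by
            gcongr
            rw [Real.rpow_neg (by positivity), ← div_eq_mul_inv,
              ← Real.div_rpow (by norm_num) (by positivity), ← Real.inv_rpow h0.le]
            gcongr
            rw [inv_eq_one_div, div_le_div_iff₀ h0 (by positivity)]
            linarith
        _ ≤ _ := by gcongr

lemma lintegral_truncated_kernel {n : ℕ} (hn : 1 ≤ n) {s pm pM : ℝ} (hs : s ∈ Ioo (0 : ℝ) 1)
    (hpm : 1 < pm) : ∃ C : ℝ, 0 < C ∧ ∀ (q : Rn n → ℝ) (S : Set (Rn n)) (ℓ : ℝ) (x : Rn n), 1 ≤ ℓ →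
      MeasurableSet S → (∀ y ∈ S, pm ≤ q y ∧ q y ≤ pM) →
      (∫⁻ y in S, ENNReal.ofReal (min 1 (ℓ * ‖x - y‖) ^ q y * rker s (q y) (x - y))) ≤
        ENNReal.ofReal (C * ℓ ^ pM) := by
  have hfin := lintegral_kernelMajorant_lt_top hn hs (by linarith : 0 < pm)
  refine ⟨(∫⁻ z, kernelMajorant n s pm z).toReal + 1, by positivity, ?_⟩
  intro q S ℓ x hℓ hS hq
  calc (∫⁻ y in S, ENNReal.ofReal (min 1 (ℓ * ‖x - y‖) ^ q y * rker s (q y) (x - y)))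
      ≤ ∫⁻ y in S, ENNReal.ofReal (ℓ ^ pM) * kernelMajorant n s pm (x - y) :=
        setLIntegral_mono' hS fun y hy => truncated_kernel_le hs hpm (hq y hy).1 (hq y hy).2 hℓ _
    _ ≤ ∫⁻ y, ENNReal.ofReal (ℓ ^ pM) * kernelMajorant n s pm (x - y) := setLIntegral_le_lintegral _ _
    _ = ENNReal.ofReal (ℓ ^ pM) * ∫⁻ y, kernelMajorant n s pm y := by
        rw [lintegral_const_mul' _ _ ENNReal.ofReal_ne_top,
          lintegral_sub_left_eq_self (fun y => kernelMajorant n s pm y) x]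
    _ ≤ ENNReal.ofReal (ℓ ^ pM) * ENNReal.ofReal ((∫⁻ z, kernelMajorant n s pm z).toReal + 1) := by
        gcongr
        rw [ENNReal.ofReal_add ENNReal.toReal_nonneg zero_le_one, ENNReal.ofReal_toReal hfin.ne]
        exact le_self_add
    _ = _ := by rw [← ENNReal.ofReal_mul (by positivity), mul_comm]

/-- Tail of a function of slow growth against the singular kernel. -/
lemma lintegral_growth_tail {n : ℕ} {s gM A : ℝ} (hs : s ∈ Ioo (0 : ℝ) 1) (hgM : 1 ≤ gM)
    (hA : 1 ≤ A) : ∃ T : ℝ, 0 < T ∧ ∀ (q f : Rn n → ℝ) (ε : ℝ) (x : Rn n) (S : Set (Rn n)),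
      MeasurableSet S → 0 < ε → ε ≤ 1 →
      (∀ y, 1 ≤ q y ∧ q y ≤ gM) → (∀ y, 0 ≤ f y) →
      (∀ y ∈ S, f y ≤ A * (1 + ‖x - y‖) ^ (s / 2)) →
      (∀ y ∈ S, ε ≤ ‖x - y‖) →
      (∫⁻ y in S, ENNReal.ofReal (f y ^ (q y - 1) * rker s (q y) (x - y))) ≤
        ENNReal.ofReal (T * ε ^ (-((n : ℝ) + gM))) := by
  obtain ⟨hs0, hs1⟩ := hs
  have hfin : (∫⁻ z : Rn n, ENNReal.ofReal ((1 + ‖z‖) ^ (-((n : ℝ) + s / 2)))) < ⊤ := by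
    apply finite_integral_one_add_norm
    rw [finrank_euclideanSpace_fin]; linarith
  set I := (∫⁻ z : Rn n, ENNReal.ofReal ((1 + ‖z‖) ^ (-((n : ℝ) + s / 2)))).toReal with hI
  have hI0 : 0 ≤ I := ENNReal.toReal_nonneg
  have hIe : (∫⁻ z : Rn n, ENNReal.ofReal ((1 + ‖z‖) ^ (-((n : ℝ) + s / 2)))) = ENNReal.ofReal I :=
    (ENNReal.ofReal_toReal hfin.ne).symm
  refine ⟨A ^ gM * 2 ^ ((n : ℝ) + gM) * (I + 1), by positivity, ?_⟩
  intro q f ε x S hS hε hε1 hq hf hfA hSε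
  have hpt : ∀ y ∈ S, ENNReal.ofReal (f y ^ (q y - 1) * rker s (q y) (x - y)) ≤
      ENNReal.ofReal (A ^ gM * 2 ^ ((n : ℝ) + gM) * ε ^ (-((n : ℝ) + gM))) *
        ENNReal.ofReal ((1 + ‖x - y‖) ^ (-((n : ℝ) + s / 2))) := by
    intro y hy
    have hty := hSε y hy
    set t := ‖x - y‖ with ht
    have ht0 : 0 < t := by linarith
    rw [← ENNReal.ofReal_mul (by positivity)]
    apply ENNReal.ofReal_le_ofReal
    have hq1 := (hq y).1
    have hqM := (hq y).2
    have h1 : f y ^ (q y - 1) ≤ A ^ gM * (1 + t) ^ (s / 2 * (q y - 1)) := by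
      calc f y ^ (q y - 1) ≤ (A * (1 + t) ^ (s / 2)) ^ (q y - 1) :=
            Real.rpow_le_rpow (hf y) (hfA y hy) (by linarith)
        _ = A ^ (q y - 1) * (1 + t) ^ (s / 2 * (q y - 1)) := by
            rw [Real.mul_rpow (by linarith) (by positivity), ← Real.rpow_mul (by positivity)]
        _ ≤ _ := by
            gcongr
            linarith
    have h2 : rker s (q y) (x - y) ≤
        2 ^ ((n : ℝ) + gM) * ε ^ (-((n : ℝ) + gM)) * (1 + t) ^ (-((n : ℝ) + s * q y)) := by
      unfold rker
      rw [← ht]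
      have hc : (ε / 2) * (1 + t) ≤ t := by nlinarith
      have he : 0 ≤ (n : ℝ) + s * q y := by positivity
      calc (t ^ ((n : ℝ) + s * q y))⁻¹ ≤ (((ε / 2) * (1 + t)) ^ ((n : ℝ) + s * q y))⁻¹ := by
            gcongr
        _ = (2 / ε) ^ ((n : ℝ) + s * q y) * (1 + t) ^ (-((n : ℝ) + s * q y)) := by
            rw [Real.mul_rpow (by positivity) (by positivity), mul_inv, ← Real.inv_rpow (by positivity),
              inv_div, ← Real.rpow_neg (by positivity)]
        _ ≤ (2 / ε) ^ ((n : ℝ) + gM) * (1 + t) ^ (-((n : ℝ) + s * q y)) := by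
            gcongr
            · rw [le_div_iff₀ hε]; linarith
            · nlinarith
        _ = _ := by
            rw [Real.div_rpow (by norm_num) hε.le, div_eq_mul_inv, ← Real.rpow_neg hε.le]
    have h3 : (1 + t) ^ (s / 2 * (q y - 1)) * (1 + t) ^ (-((n : ℝ) + s * q y)) ≤
        (1 + t) ^ (-((n : ℝ) + s / 2)) := by
      rw [← Real.rpow_add (by positivity)]
      apply Real.rpow_le_rpow_of_exponent_le (by linarith)
      nlinarith
    calc f y ^ (q y - 1) * rker s (q y) (x - y)
        ≤ (A ^ gM * (1 + t) ^ (s / 2 * (q y - 1))) *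
          (2 ^ ((n : ℝ) + gM) * ε ^ (-((n : ℝ) + gM)) * (1 + t) ^ (-((n : ℝ) + s * q y))) :=
          mul_le_mul h1 h2 (rker_nonneg _ _ _) (by positivity)
      _ = A ^ gM * 2 ^ ((n : ℝ) + gM) * ε ^ (-((n : ℝ) + gM)) *
          ((1 + t) ^ (s / 2 * (q y - 1)) * (1 + t) ^ (-((n : ℝ) + s * q y))) := by ring
      _ ≤ _ := by gcongr
  calc _ ≤ ∫⁻ y in S, ENNReal.ofReal (A ^ gM * 2 ^ ((n : ℝ) + gM) * ε ^ (-((n : ℝ) + gM))) *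
        ENNReal.ofReal ((1 + ‖x - y‖) ^ (-((n : ℝ) + s / 2))) := setLIntegral_mono' hS hpt
    _ ≤ ∫⁻ y, ENNReal.ofReal (A ^ gM * 2 ^ ((n : ℝ) + gM) * ε ^ (-((n : ℝ) + gM))) *
        ENNReal.ofReal ((1 + ‖x - y‖) ^ (-((n : ℝ) + s / 2))) := setLIntegral_le_lintegral _ _
    _ = ENNReal.ofReal (A ^ gM * 2 ^ ((n : ℝ) + gM) * ε ^ (-((n : ℝ) + gM))) * ENNReal.ofReal I := by
        rw [lintegral_const_mul' _ _ ENNReal.ofReal_ne_top,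
          lintegral_sub_left_eq_self
            (fun y : Rn n => ENNReal.ofReal ((1 + ‖y‖) ^ (-((n : ℝ) + s / 2)))) x, hIe]
    _ ≤ _ := by
        rw [← ENNReal.ofReal_mul (by positivity)]
        apply ENNReal.ofReal_le_ofReal
        have : 0 ≤ A ^ gM * 2 ^ ((n : ℝ) + gM) * ε ^ (-((n : ℝ) + gM)) := by positivity
        nlinarith

/-- If `G ≤ F + E` with `∫ F ≤ 0`, then `∫ G ≤ ∫ E`. -/
lemma lintegral_le_of_integral_nonpos {X : Type*} [MeasurableSpace X] {μ : Measure X} {F : X → ℝ}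
    (hF : Integrable F μ) (hF0 : ∫ x, F x ∂μ ≤ 0) {G E : X → ℝ≥0∞} (hE : AEMeasurable E μ)
    (h : ∀ x, G x + ENNReal.ofReal (-F x) ≤ ENNReal.ofReal (F x) + E x) :
    ∫⁻ x, G x ∂μ ≤ ∫⁻ x, E x ∂μ := by
  have hm : AEMeasurable F μ := hF.1.aemeasurable
  have hneg : (∫⁻ x, ENNReal.ofReal (-F x) ∂μ) < ⊤ := hF.neg.lintegral_lt_top
  have hpos : (∫⁻ x, ENNReal.ofReal (F x) ∂μ) ≤ ∫⁻ x, ENNReal.ofReal (-F x) ∂μ := by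
    rw [integral_eq_lintegral_pos_part_sub_lintegral_neg_part hF, sub_nonpos] at hF0
    exact (ENNReal.toReal_le_toReal hF.lintegral_lt_top.ne hneg.ne).1 hF0
  have h1 : (∫⁻ x, G x ∂μ) + ∫⁻ x, ENNReal.ofReal (-F x) ∂μ ≤
      (∫⁻ x, E x ∂μ) + ∫⁻ x, ENNReal.ofReal (-F x) ∂μ := by
    calc (∫⁻ x, G x ∂μ) + ∫⁻ x, ENNReal.ofReal (-F x) ∂μ
        = ∫⁻ x, (G x + ENNReal.ofReal (-F x)) ∂μ :=
          (lintegral_add_right' _ hm.neg.ennreal_ofReal).symm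
      _ ≤ ∫⁻ x, (ENNReal.ofReal (F x) + E x) ∂μ := lintegral_mono h
      _ = (∫⁻ x, ENNReal.ofReal (F x) ∂μ) + ∫⁻ x, E x ∂μ := lintegral_add_right' _ hE
      _ ≤ _ := by rw [add_comm]; gcongr
  exact (ENNReal.add_le_add_iff_right hneg.ne).1 h1

/-- A subsolution on the unit ball for a general kernel `K` comparable to the singular kernel:
the weak inequality is required for truncations of `u` multiplied by a power of a cutoff. -/
structure UnitSub {n : ℕ} (s pm pM lam : ℝ) (m : ℕ) (p K : Rn n → Rn n → ℝ) (u : Rn n → ℝ) :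
    Prop where
  meas_p : Measurable (fun z : Rn n × Rn n => p z.1 z.2)
  meas_K : Measurable (fun z : Rn n × Rn n => K z.1 z.2)
  meas_u : Measurable u
  p_symm : ∀ x y, p x y = p y x
  K_symm : ∀ x y, K x y = K y x
  K_nonneg : ∀ x y, 0 ≤ K x y
  one_lt_p : ∀ x y, 1 < p x y
  p_lower : ∀ x ∈ ball (0 : Rn n) 1, ∀ y ∈ ball (0 : Rn n) 1, pm ≤ p x y
  p_diag : ∀ x ∈ ball (0 : Rn n) 1, ∀ y, p x y ≤ p x x
  p_upper : ∀ x ∈ ball (0 : Rn n) 1, p x x ≤ pM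
  K_upper : ∀ x ∈ ball (0 : Rn n) 1, ∀ y ∈ ball (0 : Rn n) 1, K x y ≤ rker s (p x y) (x - y)
  K_lower : ∀ x ∈ ball (0 : Rn n) 1, ∀ y ∈ ball (0 : Rn n) 1,
    lam * rker s (p x y) (x - y) ≤ K x y
  weak : ∀ (k : ℝ) (η : Rn n → ℝ), (∃ c, LipschitzWith c η) → (∀ x, 0 ≤ η x ∧ η x ≤ 1) →
    (∃ r < 1, ∀ x, x ∉ ball (0 : Rn n) r → η x = 0) →
    Integrable (fun z : Rn n × Rn n => signedPow (p z.1 z.2) (u z.1 - u z.2) *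
      (max (u z.1 - k) 0 * η z.1 ^ m - max (u z.2 - k) 0 * η z.2 ^ m) * K z.1 z.2) ∧
    (∫ z : Rn n × Rn n, signedPow (p z.1 z.2) (u z.1 - u z.2) *
      (max (u z.1 - k) 0 * η z.1 ^ m - max (u z.2 - k) 0 * η z.2 ^ m) * K z.1 z.2) ≤ 0

/-- Control of the positive part of `u` away from points of the unit ball. -/
def TailBound {n : ℕ} (T N : ℝ) (p K : Rn n → Rn n → ℝ) (u : Rn n → ℝ) : Prop :=
  ∀ ε : ℝ, 0 < ε → ε ≤ 1 → ∀ x ∈ ball (0 : Rn n) 1,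
    (∫⁻ y in (ball x ε)ᶜ, ENNReal.ofReal (max (u y) 0 ^ (p x y - 1) * K x y)) ≤
      ENNReal.ofReal (T * ε ^ (-N))

/-- The radial cutoff which is `1` on the ball of radius `r` and vanishes outside the ball of radius
`(r + r') / 2`. -/
def cutoff {n : ℕ} (r r' : ℝ) (x : Rn n) : ℝ := max 0 (min 1 (((r + r') / 2 - ‖x‖) * (2 / (r' - r))))

section Cutoff
variable {n : ℕ} {r r' : ℝ}

lemma cutoff_nonneg (x : Rn n) : 0 ≤ cutoff r r' x := le_max_left _ _

lemma cutoff_le_one (x : Rn n) : cutoff r r' x ≤ 1 := max_le zero_le_one (min_le_left _ _)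

lemma cutoff_eq_one (h : r < r') {x : Rn n} (hx : x ∈ ball (0 : Rn n) r) : cutoff r r' x = 1 := by
  have hx : ‖x‖ < r := by simpa using hx
  have hd : 0 < r' - r := sub_pos.2 h
  have : 1 ≤ ((r + r') / 2 - ‖x‖) * (2 / (r' - r)) := by
    rw [mul_div_assoc', le_div_iff₀ hd]; linarith
  rw [cutoff, min_eq_left this, max_eq_right zero_le_one]

lemma cutoff_eq_zero (h : r < r') {x : Rn n} (hx : x ∉ ball (0 : Rn n) ((r + r') / 2)) :
    cutoff r r' x = 0 := by
  have hx : (r + r') / 2 ≤ ‖x‖ := by simpa using hx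
  have hd : 0 < r' - r := sub_pos.2 h
  have : ((r + r') / 2 - ‖x‖) * (2 / (r' - r)) ≤ 0 :=
    mul_nonpos_of_nonpos_of_nonneg (by linarith) (by positivity)
  rw [cutoff, max_eq_left (min_le_of_right_le this)]

lemma abs_cutoff_sub_le (h : r < r') (x y : Rn n) :
    |cutoff r r' x - cutoff r r' y| ≤ 2 / (r' - r) * ‖x - y‖ := by
  have hd : 0 < 2 / (r' - r) := div_pos two_pos (sub_pos.2 h)
  unfold cutoff
  set a := ((r + r') / 2 - ‖x‖) * (2 / (r' - r))
  set b := ((r + r') / 2 - ‖y‖) * (2 / (r' - r))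
  have h1 : |max 0 (min 1 a) - max 0 (min 1 b)| ≤ |a - b| := by
    refine (abs_max_sub_max_le_max 0 (min 1 a) 0 (min 1 b)).trans ?_
    refine max_le (by simp) ((abs_min_sub_min_le_max 1 a 1 b).trans (max_le (by simp) le_rfl))
  refine h1.trans ?_
  have h2 : a - b = 2 / (r' - r) * (‖y‖ - ‖x‖) := by ring
  rw [h2, abs_mul, abs_of_pos hd, norm_sub_rev x y]
  exact mul_le_mul_of_nonneg_left (abs_norm_sub_norm_le y x) hd.le

lemma lipschitz_cutoff (h : r < r') : ∃ c, LipschitzWith c (cutoff r r' : Rn n → ℝ) := by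
  have hd : 0 < 2 / (r' - r) := div_pos two_pos (sub_pos.2 h)
  refine ⟨⟨2 / (r' - r), hd.le⟩, LipschitzWith.of_dist_le_mul fun x y => ?_⟩
  rw [Real.dist_eq, dist_eq_norm]
  exact abs_cutoff_sub_le h x y

end Cutoff

lemma ofReal_add_ofReal_neg_le {g F e : ℝ} (h : g ≤ F + e) (h0 : 0 ≤ F + e) (he : 0 ≤ e) :
    ENNReal.ofReal g + ENNReal.ofReal (-F) ≤ ENNReal.ofReal F + ENNReal.ofReal e := by
  rcases le_total 0 F with hF | hF
  · rw [ENNReal.ofReal_of_nonpos (by linarith : -F ≤ 0), add_zero, ← ENNReal.ofReal_add hF he]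
    exact ENNReal.ofReal_le_ofReal h
  · rw [ENNReal.ofReal_of_nonpos hF, zero_add]
    rcases le_total 0 g with hg | hg
    · rw [← ENNReal.ofReal_add hg (by linarith)]
      exact ENNReal.ofReal_le_ofReal (by linarith)
    · rw [ENNReal.ofReal_of_nonpos hg, zero_add]
      exact ENNReal.ofReal_le_ofReal (by linarith)

lemma rpow_le_rpow_add_one {a q Q : ℝ} (ha : 0 ≤ a) (hq : 0 ≤ q) (hQ : q ≤ Q) :
    a ^ q ≤ a ^ Q + 1 := by
  rcases le_total a 1 with h | h
  · have := Real.rpow_le_one ha h hq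
    have := Real.rpow_nonneg ha Q
    linarith
  · have := Real.rpow_le_rpow_of_exponent_le h hQ
    linarith

lemma max_rpow_le_add {a b q : ℝ} (ha : 0 ≤ a) (hb : 0 ≤ b) : max a b ^ q ≤ a ^ q + b ^ q := by
  have := Real.rpow_nonneg ha q
  have := Real.rpow_nonneg hb q
  rcases max_choice a b with h | h <;> rw [h] <;> linarith

/-- Half of the error term in the Caccioppoli inequality. -/
def caccError {n : ℕ} (c ℓ r' r'' k : ℝ) (p K : Rn n → Rn n → ℝ) (u : Rn n → ℝ) (x y : Rn n) :
    ℝ≥0∞ :=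
  (ball (0 : Rn n) r' ×ˢ ball (0 : Rn n) r').indicator (fun z : Rn n × Rn n => ENNReal.ofReal
      (c * (max (u z.1 - k) 0 ^ p z.1 z.2 * min 1 (ℓ * ‖z.1 - z.2‖) ^ p z.1 z.2) * K z.1 z.2)) (x, y) +
  (ball (0 : Rn n) r'' ×ˢ (ball (0 : Rn n) r')ᶜ).indicator (fun z : Rn n × Rn n => ENNReal.ofReal
      (max (u z.2 - k) 0 ^ (p z.1 z.2 - 1) * max (u z.1 - k) 0 * K z.1 z.2)) (x, y)

lemma measurable_caccError {n : ℕ} {c ℓ r' r'' k : ℝ} {p K : Rn n → Rn n → ℝ} {u : Rn n → ℝ}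
    (hp : Measurable (fun z : Rn n × Rn n => p z.1 z.2))
    (hK : Measurable (fun z : Rn n × Rn n => K z.1 z.2)) (hu : Measurable u) :
    Measurable (fun z : Rn n × Rn n => caccError c ℓ r' r'' k p K u z.1 z.2) := by
  unfold caccError
  refine Measurable.add (Measurable.indicator ?_ (measurableSet_ball.prod measurableSet_ball))
    (Measurable.indicator ?_ (measurableSet_ball.prod measurableSet_ball.compl))
  · fun_prop
  · fun_prop

section Caccioppoli
variable {n : ℕ} {s pm pM lam : ℝ} {m : ℕ} {p K : Rn n → Rn n → ℝ} {u : Rn n → ℝ}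

lemma UnitSub.caccioppoli_pointwise (h : UnitSub s pm pM lam m p K u) (hm : pM ≤ m) {r r' k : ℝ}
    (hr : r < r') (hr' : r' ≤ 1) {g : ℝ} (x y : Rn n)
    (hg : (x ∉ ball (0 : Rn n) r ∨ y ∉ ball (0 : Rn n) r') ∧ g = 0 ∨
      (x ∈ ball (0 : Rn n) r ∧ y ∈ ball (0 : Rn n) r' ∧
        (g ≤ |max (u x - k) 0 - max (u y - k) 0| ^ p x y ∨
        u y ≤ k ∧ k < u x ∧ g ≤ (u x - u y) ^ (p x y - 1) * max (u x - k) 0))) :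
    ENNReal.ofReal (1 / 2 * (g * K x y)) + ENNReal.ofReal (-(signedPow (p x y) (u x - u y) *
      (max (u x - k) 0 * cutoff r r' x ^ m - max (u y - k) 0 * cutoff r r' y ^ m) * K x y)) ≤
    ENNReal.ofReal (signedPow (p x y) (u x - u y) *
      (max (u x - k) 0 * cutoff r r' x ^ m - max (u y - k) 0 * cutoff r r' y ^ m) * K x y) +
      (caccError ((2 * m : ℝ) ^ pM) (2 / (r' - r)) r' ((r + r') / 2) k p K u x y +
       caccError ((2 * m : ℝ) ^ pM) (2 / (r' - r)) r' ((r + r') / 2) k p K u y x) := by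
  have hq := h.one_lt_p x y
  have hK := h.K_nonneg x y
  have hm0 : 0 < m := by
    have hx0 : (0 : Rn n) ∈ ball (0 : Rn n) 1 := by simp
    have := h.one_lt_p 0 0
    have := h.p_upper 0 hx0
    have : (0 : ℝ) < m := by linarith
    exact_mod_cast this
  set η : Rn n → ℝ := cutoff r r' with hη
  set w : Rn n → ℝ := fun x => max (u x - k) 0 with hw
  have hw0 : ∀ x, 0 ≤ w x := fun x => le_max_right _ _
  set c := (2 * m : ℝ) ^ pM with hc
  have hc0 : 0 ≤ c := by positivity
  have hη0 : ∀ x, 0 ≤ η x := cutoff_nonneg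
  have hη1 : ∀ x, η x ≤ 1 := cutoff_le_one
  have hsub : ball (0 : Rn n) ((r + r') / 2) ⊆ ball 0 r' := ball_subset_ball (by linarith)
  have hsub2 : ball (0 : Rn n) r ⊆ ball 0 r' := ball_subset_ball (by linarith)
  change ENNReal.ofReal (1 / 2 * (g * K x y)) + ENNReal.ofReal (-(signedPow (p x y) (u x - u y) *
      (w x * η x ^ m - w y * η y ^ m) * K x y)) ≤ ENNReal.ofReal (signedPow (p x y) (u x - u y) *
      (w x * η x ^ m - w y * η y ^ m) * K x y) + _
  have hℓ : 0 ≤ 2 / (r' - r) := (div_pos two_pos (sub_pos.2 hr)).le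
  by_cases hx : x ∈ ball (0 : Rn n) r'
  · have hqM : p x y ≤ pM :=
      (h.p_diag x (ball_subset_ball hr' hx) y).trans (h.p_upper x (ball_subset_ball hr' hx))
    by_cases hy : y ∈ ball (0 : Rn n) r'
    · set E := c * (max (w x) (w y) * |η x - η y|) ^ p x y * K x y with hE
      have hE0 : 0 ≤ E := by
        have := hw0 x
        positivity
      set F := signedPow (p x y) (u x - u y) * (w x * η x ^ m - w y * η y ^ m) * K x y with hF
      have hen := energy_pointwise (k := k) (u₁ := u x) (u₂ := u y) hq hqM hm (hη0 x) (hη1 x)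
        (hη0 y) (hη1 y)
      have hpow : 0 ≤ |w x - w y| ^ p x y * max (η x) (η y) ^ m :=
        mul_nonneg (Real.rpow_nonneg (abs_nonneg _) _)
          (pow_nonneg (le_max_of_le_left (hη0 x)) _)
      have hen' : 1 / 2 * (|w x - w y| ^ p x y * max (η x) (η y) ^ m) * K x y ≤ F + E := by
        have := mul_le_mul_of_nonneg_right hen hK
        rw [add_mul] at this
        exact this
      have h0 : 0 ≤ F + E := le_trans (by positivity) hen'
      have hgF : 1 / 2 * (g * K x y) ≤ F + E := by
        rcases hg with ⟨-, rfl⟩ | ⟨hxr, -, hg | ⟨h1, h2, hg⟩⟩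
        · simpa using h0
        · have e1 : max (η x) (η y) = 1 := by
            rw [hη, cutoff_eq_one hr hxr]; exact max_eq_left (cutoff_le_one y)
          rw [e1, one_pow, mul_one] at hen'
          have := mul_le_mul_of_nonneg_right hg hK
          change _ ≤ |w x - w y| ^ p x y * K x y at this
          linarith
        · have e1 : η x = 1 := cutoff_eq_one hr hxr
          have hcr := crossing_pointwise (m := m) (e₁ := η x) (e₂ := η y) hq h2 h1
          rw [e1, one_pow, mul_one] at hcr
          have hF2 : F = (u x - u y) ^ (p x y - 1) * w x * K x y := by
            rw [hF, e1, one_pow]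
            exact (congrArg (· * K x y) hcr).symm
          have hF0 : 0 ≤ F := by
            rw [hF2]
            exact mul_nonneg (mul_nonneg (Real.rpow_nonneg (by linarith) _) (hw0 x)) hK
          have := mul_le_mul_of_nonneg_right hg hK
          change _ ≤ (u x - u y) ^ (p x y - 1) * w x * K x y at this
          linarith
      refine (ofReal_add_ofReal_neg_le hgF h0 hE0).trans ?_
      gcongr
      unfold caccError
      rw [indicator_of_mem (show (x, y) ∈ ball (0 : Rn n) r' ×ˢ ball (0 : Rn n) r' from ⟨hx, hy⟩),
        indicator_of_mem (show (y, x) ∈ ball (0 : Rn n) r' ×ˢ ball (0 : Rn n) r' from ⟨hy, hx⟩)]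
      refine le_trans ?_ (add_le_add le_self_add le_self_add)
      have hd : |η x - η y| ≤ min 1 (2 / (r' - r) * ‖x - y‖) :=
        le_min (abs_sub_le_iff.2 ⟨by linarith [hη0 y, hη1 x], by linarith [hη0 x, hη1 y]⟩)
          (abs_cutoff_sub_le hr x y)
      have hmin0 : 0 ≤ min 1 (2 / (r' - r) * ‖x - y‖) := le_min zero_le_one (by positivity)
      have hD : 0 ≤ min 1 (2 / (r' - r) * ‖x - y‖) ^ p x y := Real.rpow_nonneg hmin0 _
      simp only
      rw [h.p_symm y x, h.K_symm y x, norm_sub_rev y x]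
      rw [← ENNReal.ofReal_add
        (mul_nonneg (mul_nonneg hc0 (mul_nonneg (Real.rpow_nonneg (hw0 x) _) hD)) hK)
        (mul_nonneg (mul_nonneg hc0 (mul_nonneg (Real.rpow_nonneg (hw0 y) _) hD)) hK)]
      apply ENNReal.ofReal_le_ofReal
      rw [hE, Real.mul_rpow (le_max_of_le_left (hw0 x)) (abs_nonneg _), ← add_mul, ← mul_add,
        ← add_mul]
      have h5 := max_rpow_le_add (q := p x y) (hw0 x) (hw0 y)
      have h6 := Real.rpow_le_rpow (abs_nonneg _) hd (by linarith : 0 ≤ p x y)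
      have h7 : 0 ≤ w x ^ p x y + w y ^ p x y :=
        add_nonneg (Real.rpow_nonneg (hw0 x) _) (Real.rpow_nonneg (hw0 y) _)
      apply mul_le_mul_of_nonneg_right _ hK
      apply mul_le_mul_of_nonneg_left _ hc0
      exact mul_le_mul h5 h6 (Real.rpow_nonneg (abs_nonneg _) _) h7
    · have hg0 : g = 0 := by
        rcases hg with h | h
        · exact h.2
        · exact absurd h.2.1 hy
      have hηy : η y = 0 := cutoff_eq_zero hr fun h => hy (hsub h)
      rw [hg0, hηy, zero_pow hm0.ne', mul_zero, sub_zero]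
      by_cases hx2 : x ∈ ball (0 : Rn n) ((r + r') / 2)
      · have hout := outer_pointwise (u₁ := u x) (u₂ := u y) (k := k) (m := m) hq (hη0 x) (hη1 x)
        have hout' := mul_nonneg hout hK
        rw [add_mul] at hout'
        refine (ofReal_add_ofReal_neg_le (e := w y ^ (p x y - 1) * w x * K x y)
          (by simpa using hout') hout' ?_).trans ?_
        · exact mul_nonneg (mul_nonneg (Real.rpow_nonneg (hw0 y) _) (hw0 x)) hK
        · gcongr
          refine le_trans ?_ le_self_add
          unfold caccError
          rw [indicator_of_mem (show (x, y) ∈ ball (0 : Rn n) ((r + r') / 2) ×ˢ (ball (0 : Rn n) r')ᶜ from ⟨hx2, hy⟩)]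
          exact le_add_self
      · have hηx : η x = 0 := cutoff_eq_zero hr hx2
        rw [hηx, zero_pow hm0.ne']
        simp
  · have hg0 : g = 0 := by
      rcases hg with h | h
      · exact h.2
      · exact absurd (hsub2 h.1) hx
    have hηx : η x = 0 := cutoff_eq_zero hr fun h => hx (hsub h)
    rw [hg0, hηx, zero_pow hm0.ne', mul_zero, zero_sub]
    by_cases hy2 : y ∈ ball (0 : Rn n) ((r + r') / 2)
    · have hout := outer_pointwise (u₁ := u y) (u₂ := u x) (k := k) (m := m) hq (hη0 y) (hη1 y)
      have hout' := mul_nonneg hout hK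
      rw [add_mul] at hout'
      have e1 : signedPow (p x y) (u x - u y) * -(w y * η y ^ m) * K x y =
          signedPow (p x y) (u y - u x) * (w y * η y ^ m) * K x y := by
        rw [show u x - u y = -(u y - u x) by ring, signedPow_neg]; ring
      rw [e1]
      refine (ofReal_add_ofReal_neg_le (e := w x ^ (p x y - 1) * w y * K x y)
        (by simpa using hout') hout' ?_).trans ?_
      · exact mul_nonneg (mul_nonneg (Real.rpow_nonneg (hw0 x) _) (hw0 y)) hK
      · gcongr
        refine le_trans ?_ le_add_self
        unfold caccError
        rw [indicator_of_mem (show (y, x) ∈ ball (0 : Rn n) ((r + r') / 2) ×ˢ (ball (0 : Rn n) r')ᶜ from ⟨hy2, hx⟩)]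
        refine le_trans ?_ le_add_self
        simp only
        rw [h.p_symm y x, h.K_symm y x]
    · have hηy : η y = 0 := cutoff_eq_zero hr hy2
      rw [hηy, zero_pow hm0.ne']
      simp

end Caccioppoli

/-- The density `(u - k)₊ ^ p(x,x) + 1` on the superlevel set `{u > k}`. -/
def levelDensity {n : ℕ} (p : Rn n → Rn n → ℝ) (u : Rn n → ℝ) (k : ℝ) (x : Rn n) : ℝ≥0∞ :=
  {x | k < u x}.indicator (fun x => ENNReal.ofReal (max (u x - k) 0 ^ p x x + 1)) x

lemma measurable_on_diagonal {n : ℕ} {p : Rn n → Rn n → ℝ}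
    (hp : Measurable (fun z : Rn n × Rn n => p z.1 z.2)) : Measurable (fun x => p x x) :=
  hp.comp (measurable_id.prodMk measurable_id)

section Caccioppoli
variable {n : ℕ} {s pm pM lam : ℝ} {m : ℕ} {p K : Rn n → Rn n → ℝ} {u : Rn n → ℝ}

lemma measurable_right_of_prod {f : Rn n → Rn n → ℝ} (hf : Measurable (fun z : Rn n × Rn n => f z.1 z.2))
    (x : Rn n) : Measurable (f x) :=
  hf.comp (measurable_const.prodMk measurable_id)

lemma UnitSub.lintegral_caccError_near (h : UnitSub s pm pM lam m p K u) {c C₁ ℓ r' k : ℝ}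
    (hc : 0 ≤ c) (hr' : r' ≤ 1) (hℓ : 1 ≤ ℓ)
    (hC : ∀ (q : Rn n → ℝ) (S : Set (Rn n)) (ℓ : ℝ) (x : Rn n), 1 ≤ ℓ →
      MeasurableSet S → (∀ y ∈ S, pm ≤ q y ∧ q y ≤ pM) →
      (∫⁻ y in S, ENNReal.ofReal (min 1 (ℓ * ‖x - y‖) ^ q y * rker s (q y) (x - y))) ≤
        ENNReal.ofReal (C₁ * ℓ ^ pM)) {x : Rn n} (hx : x ∈ ball (0 : Rn n) r') :
    (∫⁻ y in ball (0 : Rn n) r', ENNReal.ofReal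
      (c * (max (u x - k) 0 ^ p x y * min 1 (ℓ * ‖x - y‖) ^ p x y) * K x y)) ≤
      levelDensity p u k x * ENNReal.ofReal (c * (C₁ * ℓ ^ pM)) := by
  have hx1 := ball_subset_ball hr' hx
  by_cases hk : k < u x
  · have hW : levelDensity p u k x = ENNReal.ofReal (max (u x - k) 0 ^ p x x + 1) :=
      indicator_of_mem (s := {x | k < u x}) hk _
    have hmp := measurable_right_of_prod h.meas_p x
    calc (∫⁻ y in ball (0 : Rn n) r', ENNReal.ofReal
        (c * (max (u x - k) 0 ^ p x y * min 1 (ℓ * ‖x - y‖) ^ p x y) * K x y))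
        ≤ ∫⁻ y in ball (0 : Rn n) r', (levelDensity p u k x * ENNReal.ofReal c) *
          ENNReal.ofReal (min 1 (ℓ * ‖x - y‖) ^ p x y * rker s (p x y) (x - y)) := by
          refine setLIntegral_mono' measurableSet_ball fun y hy => ?_
          have hy1 := ball_subset_ball hr' hy
          have hw : 0 ≤ max (u x - k) 0 := le_max_right _ _
          have hmin : 0 ≤ min 1 (ℓ * ‖x - y‖) := le_min zero_le_one (by positivity)
          have hq := h.one_lt_p x y
          have h1 := rpow_le_rpow_add_one hw (by linarith) (h.p_diag x hx1 y)
          have h2 := Real.rpow_nonneg hmin (p x y)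
          have h3 := Real.rpow_nonneg hw (p x x)
          rw [hW, ← ENNReal.ofReal_mul (by positivity), ← ENNReal.ofReal_mul (by positivity)]
          apply ENNReal.ofReal_le_ofReal
          calc c * (max (u x - k) 0 ^ p x y * min 1 (ℓ * ‖x - y‖) ^ p x y) * K x y
              ≤ c * ((max (u x - k) 0 ^ p x x + 1) * min 1 (ℓ * ‖x - y‖) ^ p x y) *
                rker s (p x y) (x - y) := by
                gcongr
                · exact h.K_nonneg x y
                · exact h.K_upper x hx1 y hy1
            _ = _ := by ring
      _ ≤ _ := by
          rw [lintegral_const_mul' _ _ (ENNReal.mul_ne_top (by rw [hW]; simp) (by simp))]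
          rw [ENNReal.ofReal_mul hc, ← mul_assoc]
          gcongr
          refine hC _ _ _ _ hℓ measurableSet_ball fun y hy => ⟨?_, ?_⟩
          · exact h.p_lower x hx1 y (ball_subset_ball hr' hy)
          · exact (h.p_diag x hx1 y).trans (h.p_upper x hx1)
  · have hw : max (u x - k) 0 = 0 := max_eq_right (by linarith)
    rw [hw]
    have : ∀ y, (0 : ℝ) ^ p x y = 0 := fun y =>
      Real.zero_rpow (zero_lt_one.trans (h.one_lt_p x y)).ne'
    simp [this]

lemma UnitSub.lintegral_caccError_far (h : UnitSub s pm pM lam m p K u) {T N r r' k : ℝ}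
    (hT : TailBound T N p K u) (hr : r < r') (h0 : 0 < r) (hr' : r' ≤ 1) (hk : 0 ≤ k) {x : Rn n}
    (hx : x ∈ ball (0 : Rn n) ((r + r') / 2)) :
    (∫⁻ y in (ball (0 : Rn n) r')ᶜ, ENNReal.ofReal
      (max (u y - k) 0 ^ (p x y - 1) * max (u x - k) 0 * K x y)) ≤
      levelDensity p u k x * ENNReal.ofReal (T * (2 / (r' - r)) ^ N) := by
  have hx1 : x ∈ ball (0 : Rn n) 1 := ball_subset_ball (by linarith) hx
  have hd : 0 < (r' - r) / 2 := by linarith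
  by_cases hku : k < u x
  · have hW : levelDensity p u k x = ENNReal.ofReal (max (u x - k) 0 ^ p x x + 1) :=
      indicator_of_mem (s := {x | k < u x}) hku _
    calc (∫⁻ y in (ball (0 : Rn n) r')ᶜ, ENNReal.ofReal
        (max (u y - k) 0 ^ (p x y - 1) * max (u x - k) 0 * K x y))
        ≤ ∫⁻ y in (ball (0 : Rn n) r')ᶜ, levelDensity p u k x *
          ENNReal.ofReal (max (u y) 0 ^ (p x y - 1) * K x y) := by
          refine setLIntegral_mono' measurableSet_ball.compl fun y hy => ?_
          have hw : 0 ≤ max (u x - k) 0 := le_max_right _ _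
          have hq := h.one_lt_p x y
          have h1 := rpow_le_rpow_add_one hw zero_le_one (h.one_lt_p x x).le
          rw [Real.rpow_one] at h1
          have h3 := Real.rpow_nonneg hw (p x x)
          have hK := h.K_nonneg x y
          rw [hW, ← ENNReal.ofReal_mul (by positivity)]
          apply ENNReal.ofReal_le_ofReal
          calc max (u y - k) 0 ^ (p x y - 1) * max (u x - k) 0 * K x y
              ≤ max (u y) 0 ^ (p x y - 1) * (max (u x - k) 0 ^ p x x + 1) * K x y := by
                gcongr
                linarith
            _ = _ := by ring
      _ ≤ _ := by
          rw [lintegral_const_mul' _ _ (by rw [hW]; simp)]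
          gcongr
          have := hT ((r' - r) / 2) hd (by linarith) x hx1
          rw [Real.rpow_neg hd.le, ← Real.inv_rpow hd.le, inv_div] at this
          refine le_trans (lintegral_mono_set ?_) this
          intro y hy
          simp only [mem_compl_iff, mem_ball, dist_zero_right, not_lt] at hx hy ⊢
          rw [dist_eq_norm]
          have := norm_sub_norm_le y x
          linarith
  · have hw : max (u x - k) 0 = 0 := max_eq_right (by linarith)
    simp [hw]

lemma UnitSub.lintegral_caccError (h : UnitSub s pm pM lam m p K u) {c C₁ T N r r' k : ℝ}
    (hc : 0 ≤ c) (hC₁ : 0 ≤ C₁) (hT0 : 0 ≤ T) (hN : pM ≤ N)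
    (hT : TailBound T N p K u) (hr : r < r') (h0 : 0 < r) (hr' : r' ≤ 1) (hk : 0 ≤ k)
    (hC : ∀ (q : Rn n → ℝ) (S : Set (Rn n)) (ℓ : ℝ) (x : Rn n), 1 ≤ ℓ →
      MeasurableSet S → (∀ y ∈ S, pm ≤ q y ∧ q y ≤ pM) →
      (∫⁻ y in S, ENNReal.ofReal (min 1 (ℓ * ‖x - y‖) ^ q y * rker s (q y) (x - y))) ≤
        ENNReal.ofReal (C₁ * ℓ ^ pM)) :
    (∫⁻ x, ∫⁻ y, caccError c (2 / (r' - r)) r' ((r + r') / 2) k p K u x y) ≤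
      ENNReal.ofReal ((c * C₁ + T) * (2 / (r' - r)) ^ N) *
        ∫⁻ x in ball (0 : Rn n) r', levelDensity p u k x := by
  have hd : 0 < r' - r := sub_pos.2 hr
  set ℓ := 2 / (r' - r) with hℓ
  have hℓ1 : 1 ≤ ℓ := by rw [hℓ, le_div_iff₀ hd]; linarith
  rw [← lintegral_const_mul' _ _ ENNReal.ofReal_ne_top, ← lintegral_indicator measurableSet_ball]
  refine lintegral_mono fun x => ?_
  have hsub : ball (0 : Rn n) ((r + r') / 2) ⊆ ball 0 r' := ball_subset_ball (by linarith)
  by_cases hx : x ∈ ball (0 : Rn n) r'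
  · rw [indicator_of_mem hx]
    have e1 : ∀ y, (ball (0 : Rn n) r' ×ˢ ball (0 : Rn n) r').indicator
        (fun z : Rn n × Rn n => ENNReal.ofReal (c * (max (u z.1 - k) 0 ^ p z.1 z.2 *
          min 1 (ℓ * ‖z.1 - z.2‖) ^ p z.1 z.2) * K z.1 z.2)) (x, y) =
        (ball (0 : Rn n) r').indicator (fun y => ENNReal.ofReal (c * (max (u x - k) 0 ^ p x y *
          min 1 (ℓ * ‖x - y‖) ^ p x y) * K x y)) y := by
      intro y
      by_cases hy : y ∈ ball (0 : Rn n) r'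
      · rw [indicator_of_mem hy, indicator_of_mem (mk_mem_prod hx hy)]
      · rw [indicator_of_notMem hy, indicator_of_notMem fun h => hy h.2]
    have e2 : ∀ y, (ball (0 : Rn n) ((r + r') / 2) ×ˢ (ball (0 : Rn n) r')ᶜ).indicator
        (fun z : Rn n × Rn n => ENNReal.ofReal
        (max (u z.2 - k) 0 ^ (p z.1 z.2 - 1) * max (u z.1 - k) 0 * K z.1 z.2)) (x, y) ≤
        (ball (0 : Rn n) r')ᶜ.indicator (fun y => (ball (0 : Rn n) ((r + r') / 2)).indicator
          (fun x => ENNReal.ofReal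
          (max (u y - k) 0 ^ (p x y - 1) * max (u x - k) 0 * K x y)) x) y := by
      intro y
      by_cases h1 : x ∈ ball (0 : Rn n) ((r + r') / 2) <;> by_cases h2 : y ∈ (ball (0 : Rn n) r')ᶜ
      · rw [indicator_of_mem (mk_mem_prod h1 h2), indicator_of_mem h2, indicator_of_mem h1]
      · rw [indicator_of_notMem (fun h => h2 h.2)]; exact zero_le
      · rw [indicator_of_notMem (fun h => h1 h.1)]; exact zero_le
      · rw [indicator_of_notMem (fun h => h1 h.1)]; exact zero_le
    have hm1 : Measurable fun y => ENNReal.ofReal (c * (max (u x - k) 0 ^ p x y *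
          min 1 (ℓ * ‖x - y‖) ^ p x y) * K x y) := by
      have := measurable_right_of_prod h.meas_p x
      have := measurable_right_of_prod h.meas_K x
      fun_prop
    calc (∫⁻ y, caccError c ℓ r' ((r + r') / 2) k p K u x y)
        ≤ ∫⁻ y, ((ball (0 : Rn n) r').indicator (fun y => ENNReal.ofReal
          (c * (max (u x - k) 0 ^ p x y * min 1 (ℓ * ‖x - y‖) ^ p x y) * K x y)) y +
          (ball (0 : Rn n) r')ᶜ.indicator (fun y => (ball (0 : Rn n) ((r + r') / 2)).indicator
          (fun x => ENNReal.ofReal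
          (max (u y - k) 0 ^ (p x y - 1) * max (u x - k) 0 * K x y)) x) y) := by
          refine lintegral_mono fun y => ?_
          unfold caccError
          rw [e1]
          exact add_le_add le_rfl (e2 y)
      _ = (∫⁻ y in ball (0 : Rn n) r', ENNReal.ofReal
          (c * (max (u x - k) 0 ^ p x y * min 1 (ℓ * ‖x - y‖) ^ p x y) * K x y)) +
          ∫⁻ y in (ball (0 : Rn n) r')ᶜ, (ball (0 : Rn n) ((r + r') / 2)).indicator
          (fun x => ENNReal.ofReal
          (max (u y - k) 0 ^ (p x y - 1) * max (u x - k) 0 * K x y)) x := by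
          rw [lintegral_add_left (hm1.indicator measurableSet_ball),
            lintegral_indicator measurableSet_ball, lintegral_indicator measurableSet_ball.compl]
      _ ≤ levelDensity p u k x * ENNReal.ofReal (c * (C₁ * ℓ ^ pM)) +
          levelDensity p u k x * ENNReal.ofReal (T * ℓ ^ N) := by
          refine add_le_add (h.lintegral_caccError_near hc hr' hℓ1 hC hx) ?_
          by_cases h1 : x ∈ ball (0 : Rn n) ((r + r') / 2)
          · simp only [indicator_of_mem h1]
            exact h.lintegral_caccError_far hT hr h0 hr' hk h1
          · simp only [indicator_of_notMem h1]
            simp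
      _ ≤ _ := by
          rw [← mul_add, mul_comm, ← ENNReal.ofReal_add (by positivity) (by positivity)]
          gcongr
          have := Real.rpow_le_rpow_of_exponent_le hℓ1 hN
          have : c * (C₁ * ℓ ^ pM) ≤ c * (C₁ * ℓ ^ N) := by gcongr
          linarith
  · rw [indicator_of_notMem hx]
    refine le_of_eq ?_
    rw [lintegral_eq_zero_iff']
    · refine Eventually.of_forall fun y => ?_
      unfold caccError
      rw [indicator_of_notMem (fun h => hx h.1), indicator_of_notMem (fun h => hx (hsub h.1))]
      simp
    · exact ((measurable_caccError h.meas_p h.meas_K h.meas_u).comp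
        (measurable_const.prodMk measurable_id)).aemeasurable

/-- The Caccioppoli inequality, in a form which controls both the truncated energy and the
interaction across the level `k`. -/
theorem exists_caccioppoli (hn : 1 ≤ n) (hs : s ∈ Ioo (0 : ℝ) 1) (hpm : 1 < pm) (hm : pM ≤ m)
    {T N : ℝ} (hT0 : 0 ≤ T) (hN : pM ≤ N) : ∃ C : ℝ, 0 < C ∧
    ∀ (lam : ℝ) (p K : Rn n → Rn n → ℝ) (u : Rn n → ℝ), UnitSub s pm pM lam m p K u →
      TailBound T N p K u → ∀ (r r' k : ℝ) (g : Rn n → Rn n → ℝ), 0 < r → r < r' → r' ≤ 1 → 0 ≤ k →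
      Measurable (fun z : Rn n × Rn n => g z.1 z.2) →
      (∀ x ∈ ball (0 : Rn n) r, ∀ y ∈ ball (0 : Rn n) r',
        g x y ≤ |max (u x - k) 0 - max (u y - k) 0| ^ p x y ∨
        u y ≤ k ∧ k < u x ∧ g x y ≤ (u x - u y) ^ (p x y - 1) * max (u x - k) 0) →
      (∫⁻ x in ball (0 : Rn n) r, ∫⁻ y in ball (0 : Rn n) r', ENNReal.ofReal (g x y * K x y)) ≤
        ENNReal.ofReal (C * (r' - r) ^ (-N)) *
          ∫⁻ x in ball (0 : Rn n) r', levelDensity p u k x := by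
  obtain ⟨C₁, hC₁, hC⟩ := lintegral_truncated_kernel (pM := pM) hn hs hpm
  set c := (2 * m : ℝ) ^ pM with hc
  have hc0 : 0 ≤ c := by positivity
  refine ⟨4 * (c * C₁ + T) * 2 ^ N + 1, by positivity, ?_⟩
  intro lam p K u h hT r r' k g h0 hr hr' hk hgm hg
  have hd : 0 < r' - r := sub_pos.2 hr
  set S := ball (0 : Rn n) r ×ˢ ball (0 : Rn n) r'
  have hS : MeasurableSet S := measurableSet_ball.prod measurableSet_ball
  set g' : Rn n × Rn n → ℝ := S.indicator (fun z => g z.1 z.2) with hg'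
  have hg'm : Measurable g' := hgm.indicator hS
  obtain ⟨hFi, hF0⟩ := h.weak k (cutoff r r') (lipschitz_cutoff hr)
    (fun x => ⟨cutoff_nonneg x, cutoff_le_one x⟩)
    ⟨(r + r') / 2, by linarith, fun x hx => cutoff_eq_zero hr hx⟩
  set e : Rn n × Rn n → ℝ≥0∞ := fun z =>
    caccError c (2 / (r' - r)) r' ((r + r') / 2) k p K u z.1 z.2 with he
  have hem : Measurable e := measurable_caccError h.meas_p h.meas_K h.meas_u
  have key := lintegral_le_of_integral_nonpos hFi hF0
    (G := fun z => ENNReal.ofReal (1 / 2 * (g' z * K z.1 z.2))) (E := fun z => e z + e z.swap)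
    (hem.add (hem.comp measurable_swap)).aemeasurable (by
      rintro ⟨x, y⟩
      refine h.caccioppoli_pointwise hm hr hr' (g := g' (x, y)) x y ?_
      by_cases hxy : (x, y) ∈ S
      · right
        refine ⟨hxy.1, hxy.2, ?_⟩
        rw [hg', indicator_of_mem hxy]
        exact hg x hxy.1 y hxy.2
      · left
        refine ⟨?_, by rw [hg', indicator_of_notMem hxy]⟩
        by_contra! hh
        exact hxy ⟨hh.1, hh.2⟩)
  have hE : ∫⁻ z, (e z + e z.swap) = 2 * ∫⁻ x, ∫⁻ y, e (x, y) := by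
    rw [lintegral_add_left hem, Measure.volume_eq_prod,
      lintegral_prod_swap, ← two_mul, lintegral_prod _ hem.aemeasurable]
  have hmK := h.meas_K
  have hGm : Measurable fun z : Rn n × Rn n => ENNReal.ofReal (1 / 2 * (g' z * K z.1 z.2)) := by
    fun_prop
  rw [hE, Measure.volume_eq_prod, lintegral_prod _ hGm.aemeasurable] at key
  have hL : (∫⁻ x in ball (0 : Rn n) r, ∫⁻ y in ball (0 : Rn n) r', ENNReal.ofReal (g x y * K x y)) ≤
      2 * ∫⁻ x, ∫⁻ y, ENNReal.ofReal (1 / 2 * (g' (x, y) * K x y)) := by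
    rw [← lintegral_const_mul' _ _ (by simp), ← lintegral_indicator measurableSet_ball]
    refine lintegral_mono fun x => ?_
    by_cases hx : x ∈ ball (0 : Rn n) r
    · rw [indicator_of_mem hx, ← lintegral_indicator measurableSet_ball,
        ← lintegral_const_mul' _ _ (by simp)]
      refine lintegral_mono fun y => ?_
      by_cases hy : y ∈ ball (0 : Rn n) r'
      · rw [indicator_of_mem hy, hg', indicator_of_mem (mk_mem_prod hx hy),
          show (2 : ℝ≥0∞) = ENNReal.ofReal 2 by simp, ← ENNReal.ofReal_mul (by norm_num)]
        apply le_of_eq; congr 1; simp only; ring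
      · rw [indicator_of_notMem hy]; exact zero_le
    · rw [indicator_of_notMem hx]; exact zero_le
  have hcE := h.lintegral_caccError hc0 hC₁.le hT0 hN hT hr h0 hr' hk hC
  calc _ ≤ 2 * (2 * (ENNReal.ofReal ((c * C₁ + T) * (2 / (r' - r)) ^ N) *
        ∫⁻ x in ball (0 : Rn n) r', levelDensity p u k x)) :=
        hL.trans (mul_le_mul_right (key.trans (mul_le_mul_right hcE _)) _)
    _ = ENNReal.ofReal (4 * ((c * C₁ + T) * (2 / (r' - r)) ^ N)) *
        ∫⁻ x in ball (0 : Rn n) r', levelDensity p u k x := by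
        rw [ENNReal.ofReal_mul (p := 4) (by norm_num), ← mul_assoc, ← mul_assoc]
        norm_num
    _ ≤ _ := by
        refine mul_le_mul_left (ENNReal.ofReal_le_ofReal ?_) _
        rw [Real.div_rpow two_pos.le hd.le, Real.rpow_neg hd.le]
        have : 0 ≤ ((r' - r) ^ N)⁻¹ := by positivity
        rw [div_eq_mul_inv]
        linarith

end Caccioppoli

/-- The modular energy of the truncation `(u - k)₊` on the ball of radius `r`. -/
def levelEnergy {n : ℕ} (p : Rn n → Rn n → ℝ) (u : Rn n → ℝ) (k r : ℝ) : ℝ≥0∞ :=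
  ∫⁻ x in ball (0 : Rn n) r, ENNReal.ofReal (max (u x - k) 0 ^ p x x)

/-- A pointwise nonlocal Poincaré inequality: a function which is small outside a set of small
measure is controlled by its nonlocal increments. -/
lemma rpow_le_nonlocal_increment {n : ℕ} (hn : 1 ≤ n) {s pm pM : ℝ} (hs : s ∈ Ioo (0 : ℝ) 1)
    (hpm : 1 < pm) (hβ : pM ≤ pm * (1 + s * pm / n)) {r r' P M : ℝ} (hr : r < r') (hr0 : 0 < r)
    (hr' : r' ≤ 1) (hP : P ≤ pM) {q v : Rn n → ℝ} (hv : Measurable v)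
    (hq : ∀ y ∈ ball (0 : Rn n) r', pm ≤ q y ∧ q y ≤ P)
    {x : Rn n} (hx : x ∈ ball (0 : Rn n) r) (hvx : 0 < v x) (hM : 0 < M)
    (hA : volume {y ∈ ball (0 : Rn n) r' | v x / 2 < v y} ≤
      ENNReal.ofReal (M * max 1 (v x) ^ (-pm))) :
    ENNReal.ofReal (v x ^ P) ≤
      ENNReal.ofReal (2 ^ pM * (2 / unitBallVol n) * (2 / unitBallVol n * M) ^ (s * pm / n)) *
        (∫⁻ y in ball (0 : Rn n) r', ENNReal.ofReal (|v x - v y| ^ q y * rker s (q y) (x - y))) +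
      ENNReal.ofReal (((r' - r) ^ (-(n : ℝ)) * (2 / unitBallVol n * M)) ^ (s * pm / n) * v x ^ P) := by
  obtain ⟨hs0, hs1⟩ := hs
  set β := s * pm / n with hβd
  set ω := unitBallVol n
  have hω : 0 < ω := unitBallVol_pos n
  set V := max 1 (v x) with hV
  have hV1 : 1 ≤ V := le_max_left _ _
  have hV0 : 0 < V := by linarith
  have hn0 : (0 : ℝ) < n := by exact_mod_cast hn
  have hβ0 : 0 < β := by positivity
  set d := r' - r with hd
  have hd0 : 0 < d := sub_pos.2 hr
  have hd1 : d ≤ 1 := by linarith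
  set μ := M * V ^ (-pm) with hμ
  have hμ0 : 0 < μ := by positivity
  set a := 2 / ω * μ with ha
  have ha0 : 0 < a := by positivity
  have haM : a = 2 / ω * M * V ^ (-pm) := by rw [ha, hμ]; ring
  set ρ := a ^ (1 / (n : ℝ)) with hρ
  have hρ0 : 0 < ρ := by positivity
  have hρn : ρ ^ n = a := by
    rw [hρ, ← Real.rpow_natCast, ← Real.rpow_mul ha0.le, one_div_mul_cancel hn0.ne', Real.rpow_one]
  rcases le_or_gt ρ d with hρd | hρd
  · refine le_trans ?_ le_self_add
    set A := {y ∈ ball (0 : Rn n) r' | v x / 2 < v y}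
    have hAm : MeasurableSet A := measurableSet_ball.inter (measurableSet_lt measurable_const hv)
    have hsub : ball x ρ ⊆ ball (0 : Rn n) r' := by
      refine ball_subset_ball' ?_
      rw [mem_ball] at hx
      linarith
    have hvol : ENNReal.ofReal μ ≤ volume (ball x ρ \ A) := by
      have h1 : volume (ball x ρ) = ENNReal.ofReal (2 * μ) := by
        rw [volume_ball_eq x hρ0, hρn, ha]; congr 1
        change ω * (2 / ω * μ) = _
        field_simp
      have h2 := le_measure_sdiff (μ := volume) (s₁ := ball x ρ) (s₂ := A)
      refine le_trans ?_ h2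
      rw [h1]
      refine le_trans ?_ (tsub_le_tsub_left hA _)
      rw [← ENNReal.ofReal_sub _ hμ0.le]
      exact ENNReal.ofReal_le_ofReal (by linarith)
    set lb := (2 ^ pM)⁻¹ * v x ^ P * V ^ (-(pm * β)) * (a⁻¹ * a ^ (-β)) with hlb
    have hlow : ENNReal.ofReal lb * ENNReal.ofReal μ ≤
        ∫⁻ y in ball (0 : Rn n) r', ENNReal.ofReal (|v x - v y| ^ q y * rker s (q y) (x - y)) := by
      calc ENNReal.ofReal lb * ENNReal.ofReal μ ≤ ENNReal.ofReal lb * volume (ball x ρ \ A) := by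
            gcongr
        _ = ∫⁻ y in ball x ρ \ A, ENNReal.ofReal lb := by rw [setLIntegral_const]
        _ ≤ ∫⁻ y in ball x ρ \ A, ENNReal.ofReal (|v x - v y| ^ q y * rker s (q y) (x - y)) := by
            refine setLIntegral_mono' (measurableSet_ball.diff hAm) fun y hy => ?_
            apply ENNReal.ofReal_le_ofReal
            have hyr := hsub hy.1
            obtain ⟨hq1, hq2⟩ := hq y hyr
            have hvy : v y ≤ v x / 2 := by
              by_contra! h
              exact hy.2 ⟨hyr, h⟩
            have hxy : 0 < ‖x - y‖ := by
              rw [norm_sub_pos_iff]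
              rintro rfl
              linarith
            have hxyρ : ‖x - y‖ ≤ ρ := by
              have := hy.1
              rw [mem_ball, dist_comm, dist_eq_norm] at this
              exact this.le
            have h1 : v x / 2 ≤ |v x - v y| := le_trans (by linarith) (le_abs_self _)
            have hq0 : 0 < q y := by linarith
            have h2 : (2 ^ pM)⁻¹ * (v x ^ P * V ^ (-(pm * β))) ≤ |v x - v y| ^ q y := by
              refine le_trans ?_ (Real.rpow_le_rpow (by positivity) h1 hq0.le)
              rw [Real.div_rpow hvx.le two_pos.le, div_eq_inv_mul]
              have e1 : ((2 : ℝ) ^ pM)⁻¹ ≤ (2 ^ q y)⁻¹ := by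
                gcongr
                · norm_num
                · linarith
              have e2 : v x ^ P * V ^ (-(pm * β)) ≤ v x ^ q y := by
                rcases le_total 1 (v x) with h | h
                · rw [hV, max_eq_right h, ← Real.rpow_add hvx]
                  apply Real.rpow_le_rpow_of_exponent_le h
                  nlinarith
                · rw [hV, max_eq_left h, Real.one_rpow, mul_one]
                  exact Real.rpow_le_rpow_of_exponent_ge hvx h hq2
              gcongr
            have h3 : a⁻¹ * a ^ (-β) ≤ rker s (q y) (x - y) := by
              unfold rker
              have e1 : a ^ (-β) = (ρ ^ (s * pm))⁻¹ := by
                rw [hρ, ← Real.rpow_mul ha0.le, Real.rpow_neg ha0.le, hβd]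
                congr 2
                field_simp
              rw [e1, ← hρn, ← mul_inv, ← Real.rpow_natCast, ← Real.rpow_add hρ0]
              gcongr
              refine (Real.rpow_le_rpow hxy.le hxyρ (by positivity)).trans ?_
              refine Real.rpow_le_rpow_of_exponent_ge hρ0 (hρd.trans hd1) ?_
              gcongr
            rw [hlb]
            calc _ = (2 ^ pM)⁻¹ * (v x ^ P * V ^ (-(pm * β))) * (a⁻¹ * a ^ (-β)) := by ring
              _ ≤ _ := by gcongr
        _ ≤ _ := lintegral_mono_set (sdiff_subset.trans hsub)
    refine le_trans (le_of_eq ?_) (mul_le_mul_right hlow _)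
    rw [← ENNReal.ofReal_mul (by positivity), ← ENNReal.ofReal_mul (by positivity)]
    congr 1
    have e1 : a ^ (-β) = (2 / ω * M) ^ (-β) * V ^ (pm * β) := by
      rw [haM, Real.mul_rpow (by positivity) (by positivity), ← Real.rpow_mul hV0.le]
      congr 2; ring
    rw [hlb, e1, Real.rpow_neg (show 0 ≤ 2 / ω * M by positivity), Real.rpow_neg hV0.le, ha]
    have := (Real.rpow_pos_of_pos hV0 (pm * β)).ne'
    have : (2 / ω * M) ^ β ≠ 0 := by positivity
    have : (2 : ℝ) ^ pM ≠ 0 := by positivity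
    field_simp
  · refine le_trans ?_ le_add_self
    apply ENNReal.ofReal_le_ofReal
    have h1 : d ^ n < a := by
      rw [← hρn]; exact pow_lt_pow_left₀ hρd hd0.le (by omega)
    have h2 : 1 ≤ d ^ (-(n : ℝ)) * (2 / ω * M) := by
      rw [Real.rpow_neg hd0.le, Real.rpow_natCast, inv_mul_eq_div, one_le_div (by positivity)]
      refine h1.le.trans ?_
      rw [haM]
      have : V ^ (-pm) ≤ 1 := Real.rpow_le_one_of_one_le_of_nonpos hV1 (by linarith)
      exact mul_le_of_le_one_right (by positivity) this
    exact le_mul_of_one_le_left (by positivity) (Real.one_le_rpow h2 hβ0.le)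

section Levels
variable {n : ℕ} {pm pM : ℝ} {p : Rn n → Rn n → ℝ} {u : Rn n → ℝ}

lemma lintegral_levelDensity_le {k κ r y : ℝ} (hκ : 0 < κ) (hκ1 : κ ≤ 1)
    (hp : ∀ x ∈ ball (0 : Rn n) r, 0 < p x x ∧ p x x ≤ pM)
    (hy : levelEnergy p u k r ≤ ENNReal.ofReal y) :
    (∫⁻ x in ball (0 : Rn n) r, levelDensity p u (k + κ) x) ≤
      ENNReal.ofReal (2 * κ ^ (-pM) * y) := by
  have h0 : 0 ≤ 2 * κ ^ (-pM) := by positivity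
  calc (∫⁻ x in ball (0 : Rn n) r, levelDensity p u (k + κ) x)
      ≤ ∫⁻ x in ball (0 : Rn n) r, ENNReal.ofReal (2 * κ ^ (-pM)) *
        ENNReal.ofReal (max (u x - k) 0 ^ p x x) := by
        refine setLIntegral_mono' measurableSet_ball fun x hx => ?_
        obtain ⟨hp0, hpM⟩ := hp x hx
        unfold levelDensity
        by_cases hk : k + κ < u x
        · rw [indicator_of_mem (s := {x | k + κ < u x}) hk, ← ENNReal.ofReal_mul h0]
          apply ENNReal.ofReal_le_ofReal
          rw [max_eq_left (by linarith), max_eq_left (by linarith)]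
          have h1 : (u x - (k + κ)) ^ p x x ≤ (u x - k) ^ p x x :=
            Real.rpow_le_rpow (by linarith) (by linarith) hp0.le
          have h2 : κ ^ pM ≤ (u x - k) ^ p x x :=
            (Real.rpow_le_rpow_of_exponent_ge hκ hκ1 hpM).trans
              (Real.rpow_le_rpow hκ.le (by linarith) hp0.le)
          have h3 : 1 ≤ κ ^ (-pM) * (u x - k) ^ p x x := by
            rw [Real.rpow_neg hκ.le, inv_mul_eq_div, one_le_div (by positivity)]
            exact h2
          have h4 : 1 ≤ κ ^ (-pM) := Real.one_le_rpow_of_pos_of_le_one_of_nonpos hκ hκ1 (by linarith)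
          have h5 : (u x - k) ^ p x x ≤ κ ^ (-pM) * (u x - k) ^ p x x :=
            le_mul_of_one_le_left (Real.rpow_nonneg (by linarith) _) h4
          linarith
        · rw [indicator_of_notMem (s := {x | k + κ < u x}) hk]; exact zero_le
    _ ≤ _ := by
        rw [lintegral_const_mul' _ _ ENNReal.ofReal_ne_top, ENNReal.ofReal_mul h0]
        exact mul_le_mul_right hy _

lemma volume_superlevel_le {k κ r y t : ℝ} (hpm : 1 < pm)
    (hu : Measurable u) (hκ : 0 < κ) (hκ1 : κ ≤ 1) (hp : ∀ x ∈ ball (0 : Rn n) r, pm ≤ p x x ∧ p x x ≤ pM)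
    (ht : 0 < t) (hy : levelEnergy p u k r ≤ ENNReal.ofReal y) :
    volume {x ∈ ball (0 : Rn n) r | t / 2 < max (u x - (k + κ)) 0} ≤
      ENNReal.ofReal (y * (2 / κ) ^ pM * max 1 t ^ (-pm)) := by
  set A := {x ∈ ball (0 : Rn n) r | t / 2 < max (u x - (k + κ)) 0} with hA
  have hAm : MeasurableSet A := measurableSet_ball.inter (measurableSet_lt measurable_const
    (show Measurable fun x => max (u x - (k + κ)) 0 by fun_prop))
  set V := max 1 t
  have hV : 0 < V := lt_of_lt_of_le one_pos (le_max_left _ _)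
  set b := (2 / κ) ^ pM * V ^ (-pm) with hb
  have hb0 : 0 < b := by positivity
  calc volume A = ∫⁻ x in A, 1 := by simp
    _ ≤ ∫⁻ x in A, ENNReal.ofReal b * ENNReal.ofReal (max (u x - k) 0 ^ p x x) := by
        refine setLIntegral_mono' hAm fun x hx => ?_
        obtain ⟨hp1, hpM⟩ := hp x hx.1
        have hx2 : t / 2 < max (u x - (k + κ)) 0 := hx.2
        have hx3 : t / 2 < u x - (k + κ) := by
          rcases lt_max_iff.1 hx2 with h | h
          · exact h
          · linarith
        rw [← ENNReal.ofReal_mul hb0.le, ENNReal.one_le_ofReal, max_eq_left (by linarith)]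
        have h1 : κ / 2 * V ≤ u x - k := by
          rcases max_choice 1 t with h | h
          · change κ / 2 * max 1 t ≤ _; rw [h]; linarith
          · change κ / 2 * max 1 t ≤ _; rw [h]; nlinarith
        have h2 : (κ / 2) ^ pM * V ^ pm ≤ (u x - k) ^ p x x := by
          refine le_trans ?_ (Real.rpow_le_rpow (by positivity) h1 (by linarith))
          rw [Real.mul_rpow (by positivity) hV.le]
          exact mul_le_mul (Real.rpow_le_rpow_of_exponent_ge (by positivity) (by linarith) hpM)
            (Real.rpow_le_rpow_of_exponent_le (le_max_left _ _) hp1) (by positivity) (by positivity)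
        have h3 : b = ((κ / 2) ^ pM * V ^ pm)⁻¹ := by
          rw [hb, mul_inv, ← Real.inv_rpow (by positivity), inv_div, Real.rpow_neg hV.le]
        rw [h3, inv_mul_eq_div, one_le_div (by positivity)]
        exact h2
    _ ≤ ∫⁻ x in ball (0 : Rn n) r, ENNReal.ofReal b * ENNReal.ofReal (max (u x - k) 0 ^ p x x) :=
        lintegral_mono_set fun x hx => hx.1
    _ ≤ _ := by
        rw [lintegral_const_mul' _ _ ENNReal.ofReal_ne_top]
        refine (mul_le_mul_right hy _).trans (le_of_eq ?_)
        rw [← ENNReal.ofReal_mul hb0.le]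
        congr 1; rw [hb]; ring

end Levels

lemma recursion_constant_le {ω β N pM C lam d κ y n : ℝ} (hω : 0 < ω) (hβ0 : 0 < β) (hn0 : 0 < n)
    (hN : 0 < N) (hpM : 0 < pM) (hC0 : 0 < C) (hlam : 0 < lam) (hlam1 : lam ≤ 1) (hd0 : 0 < d)
    (hd1 : d ≤ 1) (hκ : 0 < κ) (hκ1 : κ ≤ 1) (hy : 0 < y) :
    (2 ^ pM * (2 / ω) * (2 / ω * (y * (2 / κ) ^ pM)) ^ β) * lam⁻¹ *
      (C * d ^ (-N) * (2 * κ ^ (-pM) * y)) + (d ^ (-n) * (2 / ω * (y * (2 / κ) ^ pM))) ^ β * y ≤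
    (2 ^ pM * (2 / ω) * (2 / ω * 2 ^ pM) ^ β * (C * 2) + (2 / ω * 2 ^ pM) ^ β) * lam⁻¹ *
      (d * κ) ^ (-(N + pM * (1 + β) + n * β)) * y ^ (1 + β) := by
  set M := y * (2 / κ) ^ pM with hM
  have hM0 : 0 < M := by positivity
  set c₁ := 2 ^ pM * (2 / ω) * (2 / ω * 2 ^ pM) ^ β with hc₁
  set c₂ := (2 / ω * 2 ^ pM) ^ β with hc₂
  have hc₁0 : 0 < c₁ := by positivity
  have hc₂0 : 0 < c₂ := by positivity
  set a₁ := 2 ^ pM * (2 / ω) * (2 / ω * M) ^ β with ha₁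
  set a₂ := (d ^ (-n) * (2 / ω * M)) ^ β with ha₂
  have hMβ : (2 / ω * M) ^ β = c₂ * κ ^ (-(pM * β)) * y ^ β := by
    rw [hM, Real.div_rpow two_pos.le hκ.le, hc₂,
      show 2 / ω * (y * (2 ^ pM / κ ^ pM)) = 2 / ω * 2 ^ pM * κ ^ (-pM) * y by
        rw [Real.rpow_neg hκ.le]; ring,
      Real.mul_rpow (by positivity) hy.le, Real.mul_rpow (by positivity) (by positivity),
      ← Real.rpow_mul hκ.le, neg_mul]
  have e1 : a₁ = c₁ * κ ^ (-(pM * β)) * y ^ β := by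
    rw [ha₁, hMβ, hc₁]; ring
  have e2 : a₂ = d ^ (-(n * β)) * (c₂ * κ ^ (-(pM * β)) * y ^ β) := by
    rw [ha₂, Real.mul_rpow (by positivity) (by positivity), hMβ, ← Real.rpow_mul hd0.le,
      neg_mul]
  have hmono : ∀ {t e e' : ℝ}, 0 < t → t ≤ 1 → e ≤ e' → t ^ (-e) ≤ t ^ (-e') :=
    fun ht ht1 he => Real.rpow_le_rpow_of_exponent_ge ht ht1 (by linarith)
  have hlami : 1 ≤ lam⁻¹ := (one_le_inv₀ hlam).2 hlam1
  set N₂ := N + pM * (1 + β) + n * β with hN₂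
  have hbound : ∀ {e e' : ℝ}, e ≤ N₂ → e' ≤ N₂ → d ^ (-e) * κ ^ (-e') ≤ (d * κ) ^ (-N₂) := by
    intro e e' he he'
    rw [Real.mul_rpow hd0.le hκ.le]
    exact mul_le_mul (hmono hd0 hd1 he) (hmono hκ hκ1 he') (by positivity) (by positivity)
  have hnβ : 0 < n * β := by positivity
  have hpβ : 0 < pM * β := by positivity
  have b1 := hbound (e := N) (e' := pM * β + pM) (by rw [hN₂]; nlinarith)
    (by rw [hN₂]; nlinarith)
  have b2 := hbound (e := n * β) (e' := pM * β) (by rw [hN₂]; nlinarith)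
    (by rw [hN₂]; nlinarith)
  rw [e1, e2, add_comm 1 β, Real.rpow_add_one hy.ne']
  set D := (d * κ) ^ (-N₂) with hD
  have hsplit : κ ^ (-(pM * β)) * κ ^ (-pM) = κ ^ (-(pM * β + pM)) := by
    rw [← Real.rpow_add hκ]; congr 1; ring
  set Z := y ^ β * y with hZ
  have hZ0 : 0 < Z := by positivity
  calc _ = c₁ * (C * 2) * lam⁻¹ * (d ^ (-N) * (κ ^ (-(pM * β)) * κ ^ (-pM))) * Z +
        c₂ * 1 * (d ^ (-(n * β)) * κ ^ (-(pM * β))) * Z := by rw [hZ]; ring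
    _ ≤ c₁ * (C * 2) * lam⁻¹ * D * Z + c₂ * lam⁻¹ * D * Z := by
        rw [hsplit]; gcongr
    _ = _ := by ring

/-- The recursion between energies on consecutive levels and balls. -/
theorem exists_levelEnergy_recursion {n : ℕ} (hn : 1 ≤ n) {s pm pM T N : ℝ} {m : ℕ}
    (hs : s ∈ Ioo (0 : ℝ) 1) (hpm : 1 < pm) (hm : pM ≤ m) (hT0 : 0 ≤ T) (hN : pM ≤ N)
    (hpmM : pm ≤ pM) (hβ : pM ≤ pm * (1 + s * pm / n)) :
    ∃ C : ℝ, 0 < C ∧ ∃ N₂ : ℝ, 0 < N₂ ∧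
    ∀ (lam : ℝ) (p K : Rn n → Rn n → ℝ) (u : Rn n → ℝ), 0 < lam → lam ≤ 1 →
      UnitSub s pm pM lam m p K u → TailBound T N p K u →
      ∀ r r' k κ y : ℝ, 0 < r → r < r' → r' ≤ 1 → 0 ≤ k → 0 < κ → κ ≤ 1 → 0 < y →
      levelEnergy p u k r' ≤ ENNReal.ofReal y →
      levelEnergy p u (k + κ) r ≤
        ENNReal.ofReal (C * lam⁻¹ * ((r' - r) * κ) ^ (-N₂) * y ^ (1 + s * pm / n)) := by
  obtain ⟨C, hC0, hC⟩ := exists_caccioppoli hn hs hpm hm hT0 hN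
  have hs0 := hs.1
  set β := s * pm / n with hβd
  set ω := unitBallVol n
  have hω : 0 < ω := unitBallVol_pos n
  have hn0 : (0 : ℝ) < n := by exact_mod_cast hn
  have hβ0 : 0 < β := by positivity
  have hpM : 1 < pM := by linarith
  set c₁ := 2 ^ pM * (2 / ω) * (2 / ω * 2 ^ pM) ^ β with hc₁
  set c₂ := (2 / ω * 2 ^ pM) ^ β with hc₂
  have hc₁0 : 0 < c₁ := by positivity
  have hc₂0 : 0 < c₂ := by positivity
  have hN0 : 0 < N := by linarith
  refine ⟨c₁ * (C * 2) + c₂, by positivity, N + pM * (1 + β) + n * β, by positivity, ?_⟩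
  intro lam p K u hlam hlam1 h hT r r' k κ y hr0 hr hr' hk hκ hκ1 hy hY
  set d := r' - r with hd
  have hd0 : 0 < d := sub_pos.2 hr
  have hd1 : d ≤ 1 := by linarith
  set v : Rn n → ℝ := fun x => max (u x - (k + κ)) 0 with hv
  have hum := h.meas_u
  have hpm' := h.meas_p
  have hKm := h.meas_K
  have hvm : Measurable v := by fun_prop
  set M := y * (2 / κ) ^ pM with hM
  have hM0 : 0 < M := by positivity
  have hB : ∀ x ∈ ball (0 : Rn n) r', x ∈ ball (0 : Rn n) 1 := fun x hx => ball_subset_ball hr' hx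
  have hB' : ∀ x ∈ ball (0 : Rn n) r, x ∈ ball (0 : Rn n) r' := fun x hx =>
    ball_subset_ball hr.le hx
  have hpb : ∀ x ∈ ball (0 : Rn n) r', pm ≤ p x x ∧ p x x ≤ pM := fun x hx =>
    ⟨h.p_lower x (hB x hx) x (hB x hx), h.p_upper x (hB x hx)⟩
  have hcac := hC lam p K u h hT r r' (k + κ) (fun x y => |v x - v y| ^ p x y) hr0 hr hr'
    (by linarith) (by fun_prop) (fun x _ y _ => Or.inl le_rfl)
  have hlev := lintegral_levelDensity_le (u := u) hκ hκ1
    (fun x hx => ⟨by linarith [(hpb x hx).1], (hpb x hx).2⟩) hY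
  set a₁ := 2 ^ pM * (2 / ω) * (2 / ω * M) ^ β with ha₁
  set a₂ := (d ^ (-(n : ℝ)) * (2 / ω * M)) ^ β with ha₂
  have ha₁0 : 0 < a₁ := by positivity
  have ha₂0 : 0 < a₂ := by positivity
  have hkey : levelEnergy p u (k + κ) r ≤
      ∫⁻ x in ball (0 : Rn n) r, (ENNReal.ofReal (a₁ * lam⁻¹) * (∫⁻ y in ball (0 : Rn n) r',
        ENNReal.ofReal (|v x - v y| ^ p x y * K x y)) +
        ENNReal.ofReal a₂ * ENNReal.ofReal (max (u x - k) 0 ^ p x x)) := by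
    refine setLIntegral_mono' measurableSet_ball fun x hx => ?_
    have hxr' := hB' x hx
    have hx1 := hB x hxr'
    change ENNReal.ofReal (v x ^ p x x) ≤ _
    have hv0 : 0 ≤ v x := le_max_right _ _
    rcases hv0.eq_or_lt with h0 | h0
    · rw [← h0, Real.zero_rpow (by linarith [h.one_lt_p x x])]
      simp
    have := rpow_le_nonlocal_increment hn hs hpm hβ hr hr0 hr' (h.p_upper x hx1) hvm
      (q := p x) (fun y hy => ⟨h.p_lower x hx1 y (hB y hy), h.p_diag x hx1 y⟩) hx h0 hM0
      (volume_superlevel_le hpm hum hκ hκ1 hpb h0 hY)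
    refine this.trans (add_le_add ?_ ?_)
    · rw [ENNReal.ofReal_mul ha₁0.le, mul_assoc (ENNReal.ofReal _)]
      refine mul_le_mul_right ?_ _
      rw [← lintegral_const_mul' _ _ ENNReal.ofReal_ne_top]
      refine setLIntegral_mono' measurableSet_ball fun y hy => ?_
      rw [← ENNReal.ofReal_mul (by positivity)]
      apply ENNReal.ofReal_le_ofReal
      have h1 := h.K_lower x hx1 y (hB y hy)
      have h2 : rker s (p x y) (x - y) ≤ lam⁻¹ * K x y := by
        rw [inv_mul_eq_div, le_div_iff₀' hlam]; exact h1
      calc _ ≤ |v x - v y| ^ p x y * (lam⁻¹ * K x y) := by gcongr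
        _ = _ := by ring
    · rw [← ENNReal.ofReal_mul ha₂0.le]
      apply ENNReal.ofReal_le_ofReal
      gcongr
      · linarith [h.one_lt_p x x]
      · exact max_le_max (by linarith) le_rfl
  have hd2 : 0 < d * κ := by positivity
  refine hkey.trans ?_
  rw [lintegral_add_right _ (by fun_prop), lintegral_const_mul' _ _ ENNReal.ofReal_ne_top,
    lintegral_const_mul' _ _ ENNReal.ofReal_ne_top]
  have hY' : (∫⁻ x in ball (0 : Rn n) r, ENNReal.ofReal (max (u x - k) 0 ^ p x x)) ≤
      ENNReal.ofReal y := (lintegral_mono_set (ball_subset_ball hr.le)).trans hY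
  calc _ ≤ ENNReal.ofReal (a₁ * lam⁻¹) * (ENNReal.ofReal (C * d ^ (-N)) *
        ENNReal.ofReal (2 * κ ^ (-pM) * y)) + ENNReal.ofReal a₂ * ENNReal.ofReal y := by
        gcongr
        exact hcac.trans (mul_le_mul_right hlev _)
    _ = ENNReal.ofReal (a₁ * lam⁻¹ * (C * d ^ (-N) * (2 * κ ^ (-pM) * y)) + a₂ * y) := by
        rw [← ENNReal.ofReal_mul (by positivity), ← ENNReal.ofReal_mul (by positivity),
          ← ENNReal.ofReal_mul (by positivity), ← ENNReal.ofReal_add (by positivity) (by positivity)]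
    _ ≤ _ := by
        exact ENNReal.ofReal_le_ofReal (recursion_constant_le hω hβ0 hn0 (by linarith) (by linarith)
          hC0 hlam hlam1 hd0 hd1 hκ hκ1 hy)

section DeGiorgi
variable {n : ℕ} {s pm pM T N : ℝ} {m : ℕ}

lemma geometric_recursion_step {C lam N₂ β : ℝ} (hC : 0 < C) (hlam : 0 < lam) (hβ : 0 < β) (j : ℕ) :
    C * lam⁻¹ * ((1 / 2 : ℝ) ^ j / 8 * ((1 / 2 : ℝ) ^ j / 8)) ^ (-N₂) *
      (((C * 64 ^ N₂ * 4 ^ (N₂ / β))⁻¹ ^ (1 / β) * lam ^ (1 / β)) *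
        ((4 : ℝ) ^ (N₂ / β))⁻¹ ^ j) ^ (1 + β) =
    ((C * 64 ^ N₂ * 4 ^ (N₂ / β))⁻¹ ^ (1 / β) * lam ^ (1 / β)) *
        ((4 : ℝ) ^ (N₂ / β))⁻¹ ^ (j + 1) := by
  set b : ℝ := 4 ^ (N₂ / β) with hb
  have hb0 : 0 < b := by positivity
  have hbβ : b ^ β = 4 ^ N₂ := by
    rw [hb, ← Real.rpow_mul (by norm_num), div_mul_cancel₀ _ hβ.ne']
  set y := (C * 64 ^ N₂ * b)⁻¹ ^ (1 / β) * lam ^ (1 / β) with hy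
  have hy0 : 0 < y := by positivity
  have hyβ : y ^ β = (C * 64 ^ N₂ * b)⁻¹ * lam := by
    rw [hy, Real.mul_rpow (by positivity) (by positivity), ← Real.rpow_mul (by positivity),
      ← Real.rpow_mul (by positivity), one_div_mul_cancel hβ.ne', Real.rpow_one, Real.rpow_one]
  have e1 : ((1 / 2 : ℝ) ^ j / 8 * ((1 / 2 : ℝ) ^ j / 8)) ^ (-N₂) = 64 ^ N₂ * (4 ^ N₂) ^ j := by
    rw [show (1 / 2 : ℝ) ^ j / 8 * ((1 / 2 : ℝ) ^ j / 8) = (64 * 4 ^ j)⁻¹ by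
      rw [show (4 : ℝ) = 2 * 2 by norm_num, mul_pow, one_div, inv_pow]; field_simp; norm_num]
    rw [Real.inv_rpow (by positivity), Real.rpow_neg (by positivity), inv_inv,
      Real.mul_rpow (by norm_num) (by positivity), ← Real.rpow_natCast, ← Real.rpow_natCast,
      ← Real.rpow_mul (by norm_num), ← Real.rpow_mul (by norm_num), mul_comm N₂]
  have e2 : (y * b⁻¹ ^ j) ^ β = (C * 64 ^ N₂ * b)⁻¹ * lam * ((4 ^ N₂) ^ j)⁻¹ := by
    rw [Real.mul_rpow hy0.le (by positivity), hyβ, ← hbβ, ← Real.rpow_natCast, ← Real.rpow_mul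
      (by positivity), mul_comm (j : ℝ) β, Real.rpow_mul (by positivity), Real.rpow_natCast,
      Real.inv_rpow hb0.le, inv_pow]
  rw [add_comm 1 β, Real.rpow_add_one (by positivity), e1, e2, pow_succ]
  have : (64 : ℝ) ^ N₂ ≠ 0 := by positivity
  have : ((4 : ℝ) ^ N₂) ≠ 0 := by positivity
  field_simp

lemma ae_le_of_levelEnergy_eq_zero {p : Rn n → Rn n → ℝ} {u : Rn n → ℝ} {k r : ℝ}
    (hp : Measurable fun x : Rn n => p x x) (hu : Measurable u) (h : levelEnergy p u k r = 0) :
    ∀ᵐ x, x ∈ ball (0 : Rn n) r → u x ≤ k := by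
  unfold levelEnergy at h
  have hm : Measurable fun x => ENNReal.ofReal (max (u x - k) 0 ^ p x x) :=
    (((hu.sub_const k).max measurable_const).pow hp).ennreal_ofReal
  rw [lintegral_eq_zero_iff hm, EventuallyEq, ae_restrict_iff' measurableSet_ball] at h
  filter_upwards [h] with x hx hxb
  have := hx hxb
  by_contra! hk
  simp only [Pi.zero_apply, ENNReal.ofReal_eq_zero] at this
  rw [max_eq_left (by linarith)] at this
  exact absurd this (not_le.2 (Real.rpow_pos_of_pos (by linarith) _))

lemma levelEnergy_mono {p : Rn n → Rn n → ℝ} {u : Rn n → ℝ} {k k' r r' : ℝ} (hk : k ≤ k')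
    (hr : r' ≤ r) (hp : ∀ x, 0 ≤ p x x) : levelEnergy p u k' r' ≤ levelEnergy p u k r := by
  refine (lintegral_mono fun x => ENNReal.ofReal_le_ofReal ?_).trans
    (lintegral_mono_set (ball_subset_ball hr))
  exact Real.rpow_le_rpow (le_max_right _ _) (max_le_max (by linarith) le_rfl) (hp x)

/-- De Giorgi's lemma: small energy above level `1/2` forces `u ≤ 3/4` on a smaller ball. -/
theorem exists_deGiorgi (hn : 1 ≤ n) (hs : s ∈ Ioo (0 : ℝ) 1) (hpm : 1 < pm) (hm : pM ≤ m)
    (hT0 : 0 ≤ T) (hN : pM ≤ N) (hpmM : pm ≤ pM) (hβ : pM ≤ pm * (1 + s * pm / n)) :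
    ∃ c : ℝ, 0 < c ∧ ∀ (lam : ℝ) (p K : Rn n → Rn n → ℝ) (u : Rn n → ℝ), 0 < lam → lam ≤ 1 →
      UnitSub s pm pM lam m p K u → TailBound T N p K u →
      levelEnergy p u (1 / 2) (1 / 2) ≤ ENNReal.ofReal (c * lam ^ (1 / (s * pm / n))) →
      ∀ᵐ x, x ∈ ball (0 : Rn n) (1 / 4) → u x ≤ 3 / 4 := by
  obtain ⟨C, hC0, N₂, hN₂, hC⟩ := exists_levelEnergy_recursion hn hs hpm hm hT0 hN hpmM hβ
  have hs0 := hs.1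
  have hn0 : (0 : ℝ) < n := by exact_mod_cast hn
  set β := s * pm / n with hβd
  have hβ0 : 0 < β := by positivity
  refine ⟨(C * 64 ^ N₂ * 4 ^ (N₂ / β))⁻¹ ^ (1 / β), by positivity, ?_⟩
  intro lam p K u hlam hlam1 h hT h0
  set b : ℝ := 4 ^ (N₂ / β) with hb
  have hb1 : 1 < b := Real.one_lt_rpow (by norm_num) (by positivity)
  set y := (C * 64 ^ N₂ * b)⁻¹ ^ (1 / β) * lam ^ (1 / β) with hy
  have hy0 : 0 < y := by positivity
  have hstep : ∀ j : ℕ, levelEnergy p u (3 / 4 - (1 / 2) ^ j / 4) (1 / 4 + (1 / 2) ^ j / 4) ≤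
      ENNReal.ofReal (y * b⁻¹ ^ j) := by
    intro j
    induction j with
    | zero => norm_num at h0 ⊢; exact h0
    | succ j ih =>
      have hj : (0 : ℝ) < (1 / 2) ^ j := by positivity
      have hj1 : (1 / 2 : ℝ) ^ j ≤ 1 := pow_le_one₀ (by norm_num) (by norm_num)
      have := hC lam p K u hlam hlam1 h hT (1 / 4 + (1 / 2) ^ (j + 1) / 4) (1 / 4 + (1 / 2) ^ j / 4)
        (3 / 4 - (1 / 2) ^ j / 4) ((1 / 2) ^ j / 8) (y * b⁻¹ ^ j) (by positivity)
        (by rw [pow_succ]; linarith) (by linarith) (by linarith) (by positivity) (by linarith)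
        (by positivity) ih
      rw [show 3 / 4 - (1 / 2 : ℝ) ^ j / 4 + (1 / 2) ^ j / 8 = 3 / 4 - (1 / 2) ^ (j + 1) / 4 by
        rw [pow_succ]; ring, show 1 / 4 + (1 / 2 : ℝ) ^ j / 4 - (1 / 4 + (1 / 2) ^ (j + 1) / 4) =
          (1 / 2) ^ j / 8 by rw [pow_succ]; ring] at this
      rwa [geometric_recursion_step hC0 hlam hβ0 j] at this
  refine ae_le_of_levelEnergy_eq_zero (p := p) (measurable_on_diagonal h.meas_p) h.meas_u ?_
  have hlim : Tendsto (fun j : ℕ => ENNReal.ofReal (y * b⁻¹ ^ j)) atTop (𝓝 0) := by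
    have h1 := (tendsto_pow_atTop_nhds_zero_of_lt_one (inv_nonneg.2 (by linarith : 0 ≤ b))
      (inv_lt_one_of_one_lt₀ hb1)).const_mul y
    rw [mul_zero] at h1
    simpa using ENNReal.tendsto_ofReal h1
  refine le_antisymm (ge_of_tendsto' hlim fun j => ?_) zero_le
  have hj : (0 : ℝ) < (1 / 2) ^ j := by positivity
  exact (levelEnergy_mono (by linarith) (by linarith) fun x => by linarith [h.one_lt_p x x]).trans
    (hstep j)

/-- Growth lemma: if `u ≤ 1` and `u` is very negative on half of a ball, then `u ≤ 3/4` on a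
smaller ball. -/
theorem exists_growth (hn : 1 ≤ n) (hs : s ∈ Ioo (0 : ℝ) 1) (hpm : 1 < pm) (hm : pM ≤ m)
    (hT0 : 0 ≤ T) (hN : pM ≤ N) (hpmM : pm ≤ pM) (hβ : pM ≤ pm * (1 + s * pm / n))
    {lam : ℝ} (hlam : 0 < lam) (hlam1 : lam ≤ 1) :
    ∃ H : ℝ, 1 ≤ H ∧ ∀ (p K : Rn n → Rn n → ℝ) (u : Rn n → ℝ),
      UnitSub s pm pM lam m p K u → TailBound T N p K u →
      (∀ᵐ x, x ∈ ball (0 : Rn n) 1 → u x ≤ 1) →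
      volume (ball (0 : Rn n) (1 / 2)) ≤ 2 * volume (ball (0 : Rn n) (1 / 2) ∩ {x | u x ≤ -H}) →
      ∀ᵐ x, x ∈ ball (0 : Rn n) (1 / 4) → u x ≤ 3 / 4 := by
  obtain ⟨c, hc0, hc⟩ := exists_deGiorgi hn hs hpm hm hT0 hN hpmM hβ
  obtain ⟨C, hC0, hC⟩ := exists_caccioppoli hn hs hpm hm hT0 hN
  set c' := c * lam ^ (1 / (s * pm / n)) with hc'
  have hc'0 : 0 < c' := by positivity
  set ω := unitBallVol n with hωd
  have hω : 0 < ω := unitBallVol_pos n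
  set B := (C * (1 / 2) ^ (-N) * (2 * ω)) * 4 * ((ω * (1 / 2) ^ n) * lam * c')⁻¹ with hB
  have hB0 : 0 < B := by positivity
  have hpm1 : 0 < pm - 1 := by linarith
  refine ⟨max 1 (B ^ (1 / (pm - 1))), le_max_left _ _, ?_⟩
  intro p K u h hT hu1 hvol
  set H := max 1 (B ^ (1 / (pm - 1)))
  have hH1 : 1 ≤ H := le_max_left _ _
  have hHB : B ≤ H ^ (pm - 1) := by
    have : (B ^ (1 / (pm - 1))) ^ (pm - 1) = B := by
      rw [← Real.rpow_mul hB0.le, one_div_mul_cancel hpm1.ne', Real.rpow_one]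
    rw [← this]
    exact Real.rpow_le_rpow (by positivity) (le_max_right _ _) hpm1.le
  apply hc lam p K u hlam hlam1 h hT
  have hum := h.meas_u
  set S₁ := ball (0 : Rn n) (1 / 2) ∩ {x | 1 / 2 < u x} with hS₁
  set S₂ := ball (0 : Rn n) (1 / 2) ∩ {x | u x ≤ -H} with hS₂
  have hm₁ : MeasurableSet S₁ := measurableSet_ball.inter (measurableSet_lt measurable_const hum)
  have hm₂ : MeasurableSet S₂ := measurableSet_ball.inter (measurableSet_le hum measurable_const)
  have hhalf : ball (0 : Rn n) (1 / 2) ⊆ ball 0 1 := ball_subset_ball (by norm_num)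
  have hE1 : levelEnergy p u (1 / 2) (1 / 2) ≤ volume S₁ := by
    unfold levelEnergy
    rw [← lintegral_indicator_one hm₁, ← lintegral_indicator measurableSet_ball]
    refine lintegral_mono_ae ?_
    filter_upwards [hu1] with x hx
    by_cases hxb : x ∈ ball (0 : Rn n) (1 / 2)
    · rw [indicator_of_mem hxb]
      have hp1 := h.one_lt_p x x
      by_cases hxu : 1 / 2 < u x
      · rw [indicator_of_mem (show x ∈ S₁ from ⟨hxb, hxu⟩), Pi.one_apply, ENNReal.ofReal_le_one]
        have := hx (hhalf hxb)
        exact Real.rpow_le_one (le_max_right _ _) (max_le (by linarith) zero_le_one) (by linarith)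
      · rw [max_eq_right (by linarith), Real.zero_rpow (by linarith)]
        simp
    · rw [indicator_of_notMem hxb]; exact zero_le
  refine hE1.trans ?_
  have hcac := hC lam p K u h hT (1 / 2) 1 0
    (fun x y => ({z : Rn n × Rn n | 1 / 2 < u z.1 ∧ u z.2 ≤ -H}).indicator
      (fun _ => H ^ (pm - 1) * (1 / 2)) (x, y)) (by norm_num) (by norm_num) le_rfl le_rfl
    (Measurable.indicator (s := {z : Rn n × Rn n | 1 / 2 < u z.1 ∧ u z.2 ≤ -H}) measurable_const
      ((measurableSet_lt measurable_const (hum.comp measurable_fst)).inter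
      (measurableSet_le (hum.comp measurable_snd) measurable_const))) (by
      intro x hx y hy
      by_cases hxy : (x, y) ∈ {z : Rn n × Rn n | 1 / 2 < u z.1 ∧ u z.2 ≤ -H}
      · right
        obtain ⟨h1, h2⟩ := hxy
        simp only at h1 h2
        refine ⟨by linarith, by linarith, ?_⟩
        rw [indicator_of_mem (show (x, y) ∈ {z : Rn n × Rn n | 1 / 2 < u z.1 ∧ u z.2 ≤ -H}
          from ⟨h1, h2⟩)]
        have h3 := h.p_lower x (hhalf hx) y hy
        have h4 : H ^ (pm - 1) ≤ (u x - u y) ^ (p x y - 1) :=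
          (Real.rpow_le_rpow_of_exponent_le hH1 (by linarith)).trans
            (Real.rpow_le_rpow (by linarith) (by linarith) (by linarith))
        have h5 : 1 / 2 ≤ max (u x - 0) 0 := le_max_of_le_left (by linarith)
        exact mul_le_mul h4 h5 (by norm_num) (Real.rpow_nonneg (by linarith) _)
      · left
        rw [indicator_of_notMem hxy]
        positivity)
  have hR : (∫⁻ x in ball (0 : Rn n) 1, levelDensity p u 0 x) ≤ ENNReal.ofReal (2 * ω) := by
    calc (∫⁻ x in ball (0 : Rn n) 1, levelDensity p u 0 x) ≤ ∫⁻ x in ball (0 : Rn n) 1, 2 := by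
          refine setLIntegral_mono_ae' measurableSet_ball ?_
          filter_upwards [hu1] with x hx hxb
          unfold levelDensity
          by_cases hxu : 0 < u x
          · rw [indicator_of_mem (s := {x | 0 < u x}) hxu, show (2 : ℝ≥0∞) = ENNReal.ofReal 2 by simp]
            apply ENNReal.ofReal_le_ofReal
            have hp1 := h.one_lt_p x x
            have := hx hxb
            have := Real.rpow_le_one (le_max_right (u x - 0) 0)
              (max_le (by linarith) zero_le_one) (by linarith : 0 ≤ p x x)
            linarith
          · rw [indicator_of_notMem (s := {x | 0 < u x}) hxu]; exact zero_le
      _ = ENNReal.ofReal (2 * ω) := by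
          rw [setLIntegral_const, volume_ball_eq 0 one_pos, one_pow, mul_one,
            ENNReal.ofReal_mul two_pos.le]
          simp [hωd]
  have hL : ENNReal.ofReal (H ^ (pm - 1) * (1 / 2) * lam) * volume S₂ * volume S₁ ≤
      ∫⁻ x in ball (0 : Rn n) (1 / 2), ∫⁻ y in ball (0 : Rn n) 1,
        ENNReal.ofReal (({z : Rn n × Rn n | 1 / 2 < u z.1 ∧ u z.2 ≤ -H}).indicator
          (fun _ => H ^ (pm - 1) * (1 / 2)) (x, y) * K x y) := by
    rw [← setLIntegral_const S₁]
    refine le_trans ?_ (lintegral_mono_set (inter_subset_left (t := {x | 1 / 2 < u x})))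
    refine setLIntegral_mono' hm₁ fun x hx => ?_
    rw [← setLIntegral_const S₂]
    refine le_trans ?_ (lintegral_mono_set (inter_subset_left.trans hhalf : S₂ ⊆ _))
    refine setLIntegral_mono' hm₂ fun y hy => ?_
    apply ENNReal.ofReal_le_ofReal
    rw [indicator_of_mem (show (x, y) ∈ {z : Rn n × Rn n | 1 / 2 < u z.1 ∧ u z.2 ≤ -H}
          from ⟨hx.2, hy.2⟩)]
    refine mul_le_mul_of_nonneg_left ?_ (by positivity)
    refine le_trans ?_ (h.K_lower x (hhalf hx.1) y (hhalf hy.1))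
    refine le_mul_of_one_le_right hlam.le ?_
    unfold rker
    have hxb := hx.1
    have hyb := hy.1
    rw [mem_ball, dist_zero_right] at hxb hyb
    have h1 : ‖x - y‖ ≤ 1 := (norm_sub_le x y).trans (by linarith)
    have h2 : 0 < ‖x - y‖ := by
      rw [norm_sub_pos_iff]
      rintro rfl
      have h3 : 1 / 2 < u x := hx.2
      have h4 : u x ≤ -H := hy.2
      linarith
    have hp1 := h.one_lt_p x y
    have hs0 := hs.1
    exact (one_le_inv₀ (by positivity)).2 (Real.rpow_le_one h2.le h1 (by positivity))
  have hmain : ENNReal.ofReal (H ^ (pm - 1) * (1 / 2) * lam) * volume S₂ * volume S₁ ≤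
      ENNReal.ofReal (C * (1 / 2) ^ (-N) * (2 * ω)) := by
    refine hL.trans (hcac.trans ?_)
    rw [show (1 : ℝ) - 1 / 2 = 1 / 2 by norm_num, ENNReal.ofReal_mul (p := C * _) (by positivity)]
    exact mul_le_mul_right hR _
  have hS₂lt : volume S₂ ≠ ⊤ :=
    ((measure_mono inter_subset_left).trans_lt measure_ball_lt_top).ne
  have hS₁lt : volume S₁ ≠ ⊤ :=
    ((measure_mono inter_subset_left).trans_lt measure_ball_lt_top).ne
  rw [volume_ball_eq 0 (by norm_num : (0 : ℝ) < 1 / 2)] at hvol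
  have r1 : ω * (1 / 2) ^ n ≤ 2 * (volume S₂).toReal := by
    have := ENNReal.toReal_mono (ENNReal.mul_ne_top (by simp) hS₂lt) hvol
    rwa [ENNReal.toReal_ofReal (by positivity), ENNReal.toReal_mul, ENNReal.toReal_ofNat] at this
  have r2 : H ^ (pm - 1) * (1 / 2) * lam * (volume S₂).toReal * (volume S₁).toReal ≤
      C * (1 / 2) ^ (-N) * (2 * ω) := by
    have := ENNReal.toReal_mono (by simp) hmain
    rwa [ENNReal.toReal_ofReal (by positivity), ENNReal.toReal_mul, ENNReal.toReal_mul,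
      ENNReal.toReal_ofReal (by positivity)] at this
  rw [← ENNReal.ofReal_toReal hS₁lt]
  apply ENNReal.ofReal_le_ofReal
  set a := (volume S₁).toReal
  have ha : 0 ≤ a := ENNReal.toReal_nonneg
  have hHp : 0 < H ^ (pm - 1) := by positivity
  set ω' := ω * (1 / 2) ^ n with hω'
  have hω'0 : 0 < ω' := by positivity
  have r3 : H ^ (pm - 1) * lam * ω' * a ≤ C * (1 / 2) ^ (-N) * (2 * ω) * 4 := by
    have : H ^ (pm - 1) * lam * a * ω' ≤ H ^ (pm - 1) * lam * a * (2 * (volume S₂).toReal) := by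
      gcongr
    linarith
  have r4 : B * lam * ω' * a ≤ C * (1 / 2) ^ (-N) * (2 * ω) * 4 :=
    le_trans (by gcongr) r3
  have r5 : B * lam * ω' = C * (1 / 2) ^ (-N) * (2 * ω) * 4 / c' := by
    rw [hB]; field_simp
  have hX : 0 < C * (1 / 2) ^ (-N) * (2 * ω) * 4 := by positivity
  rw [r5, div_mul_eq_mul_div, div_le_iff₀ hc'0] at r4
  exact le_of_mul_le_mul_left r4 hX

end DeGiorgi

lemma add_rpow_le_two_rpow_mul {a b q Q : ℝ} (ha : 0 ≤ a) (hb : 0 ≤ b) (hq : 0 ≤ q) (hQ : q ≤ Q) :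
    (a + b) ^ q ≤ 2 ^ Q * (a ^ q + b ^ q) := by
  have h1 : a + b ≤ 2 * max a b := by
    linarith [le_max_left a b, le_max_right a b]
  calc (a + b) ^ q ≤ (2 * max a b) ^ q := Real.rpow_le_rpow (by positivity) h1 hq
    _ = 2 ^ q * max a b ^ q := Real.mul_rpow two_pos.le (le_max_of_le_left ha)
    _ ≤ _ := by
      have := max_rpow_le_add (q := q) ha hb
      have := Real.rpow_le_rpow_of_exponent_le (one_le_two : (1 : ℝ) ≤ 2) hQ
      have := Real.rpow_nonneg ha q
      have := Real.rpow_nonneg hb q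
      gcongr

lemma rpow_sub_one_mul_le_add {a b q : ℝ} (ha : 0 ≤ a) (hb : 0 ≤ b) (hq : 1 < q) :
    a ^ (q - 1) * b ≤ a ^ q + b ^ q := by
  rcases le_total a b with h | h
  · have h1 : a ^ (q - 1) * b ≤ b ^ (q - 1) * b := by gcongr
    rw [rpow_sub_one_mul_self hb (by linarith)] at h1
    linarith [Real.rpow_nonneg ha q]
  · have h1 : a ^ (q - 1) * b ≤ a ^ (q - 1) * a := by gcongr
    rw [rpow_sub_one_mul_self ha (by linarith)] at h1
    linarith [Real.rpow_nonneg hb q]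

lemma lintegral_add_symmetrization_lt_top {n : ℕ} {g e : Rn n × Rn n → ℝ≥0∞} {c : ℝ}
    (hg : Measurable g) (he : Measurable e) (hgI : (∫⁻ x, ∫⁻ y, g (x, y)) < ⊤)
    (heI : (∫⁻ x, ∫⁻ y, e (x, y)) < ⊤) :
    (∫⁻ x, ∫⁻ y, ENNReal.ofReal c * (g (x, y) + (e (x, y) + e (y, x)))) < ⊤ := by
  have heI' : (∫⁻ x, ∫⁻ y, e (y, x)) < ⊤ := by
    have h : AEMeasurable (Function.uncurry fun x y => e (y, x))
        ((volume : Measure (Rn n)).prod (volume : Measure (Rn n))) :=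
      (he.comp measurable_swap).aemeasurable
    rw [lintegral_lintegral_swap h]
    exact heI
  have hA : ∀ x, Measurable fun y => g (x, y) := fun x =>
    hg.comp (measurable_const.prodMk measurable_id)
  have hB : ∀ x, Measurable fun y => e (x, y) := fun x =>
    he.comp (measurable_const.prodMk measurable_id)
  have e1 : ∀ x, (∫⁻ y, ENNReal.ofReal c * (g (x, y) + (e (x, y) + e (y, x)))) =
      ENNReal.ofReal c * ((∫⁻ y, g (x, y)) + ((∫⁻ y, e (x, y)) + ∫⁻ y, e (y, x))) := fun x => by
    rw [lintegral_const_mul' _ _ ENNReal.ofReal_ne_top, lintegral_add_left (hA x),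
      lintegral_add_left (hB x)]
  simp only [e1]
  rw [lintegral_const_mul' _ _ ENNReal.ofReal_ne_top, lintegral_add_left hg.lintegral_prod_right',
    lintegral_add_left he.lintegral_prod_right']
  exact ENNReal.mul_lt_top ENNReal.ofReal_lt_top (ENNReal.add_lt_top.2 ⟨hgI,
    ENNReal.add_lt_top.2 ⟨heI, heI'⟩⟩)

lemma ofReal_kernel_le_of_abs_le {n : ℕ} {s d U a b q Q pM : ℝ} {z : Rn n} (ha : 0 ≤ a) (hb : 0 ≤ b)
    (hq : 0 ≤ q) (hqQ : q ≤ Q) (hqM : q ≤ pM) (h : |d| ≤ |U| + a * b) :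
    ENNReal.ofReal (|d| ^ q / ‖z‖ ^ ((n : ℝ) + s * q)) ≤
      ENNReal.ofReal (2 ^ pM) * (ENNReal.ofReal (|U| ^ q / ‖z‖ ^ ((n : ℝ) + s * q)) +
        ENNReal.ofReal (a ^ Q + 1) * ENNReal.ofReal (b ^ q * rker s q z)) := by
  have h0 := Real.rpow_nonneg ha Q
  have h0' := Real.rpow_nonneg hb q
  have hK := rker_nonneg s q z
  have h0'' := Real.rpow_nonneg (abs_nonneg U) q
  rw [← ENNReal.ofReal_mul (by positivity), ← ENNReal.ofReal_add (by positivity)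
    (by positivity), ← ENNReal.ofReal_mul (by positivity)]
  apply ENNReal.ofReal_le_ofReal
  have h1 := Real.rpow_le_rpow (abs_nonneg _) h hq
  have h2 := h1.trans (add_rpow_le_two_rpow_mul (abs_nonneg _) (mul_nonneg ha hb) hq hqM)
  rw [Real.mul_rpow ha hb] at h2
  have h3 := rpow_le_rpow_add_one ha hq hqQ
  rw [div_eq_mul_inv, div_eq_mul_inv]
  change _ * rker s q z ≤ 2 ^ pM * (_ * rker s q z + _)
  calc _ ≤ 2 ^ pM * (|U| ^ q + a ^ q * b ^ q) * rker s q z := by gcongr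
    _ ≤ 2 ^ pM * (|U| ^ q + (a ^ Q + 1) * b ^ q) * rker s q z := by gcongr
    _ = _ := by ring

lemma measurable_rker {n : ℕ} {s : ℝ} {p : Rn n → Rn n → ℝ}
    (hp : Measurable (fun z : Rn n × Rn n => p z.1 z.2)) :
    Measurable (fun z : Rn n × Rn n => rker s (p z.1 z.2) (z.1 - z.2)) := by
  unfold rker
  fun_prop

section Exponent
variable {n : ℕ} {s : ℝ} {p : Rn n → Rn n → ℝ} {Ω : Set (Rn n)} {u : Rn n → ℝ}

lemma exponent_le_diagonal (hp : ExponentOK p) (hΩ : IsOpen Ω) (hP2 : CondP2 p Ω) {x : Rn n}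
    (hx : x ∈ Ω) (y : Rn n) : p x y ≤ p x x := by
  obtain ⟨hc, -, pm, pM, -, hb⟩ := hp
  rcases eq_or_ne y x with rfl | hxy
  · exact le_rfl
  refine le_of_forall_pos_le_add fun ε hε => ?_
  obtain ⟨δ₁, hδ₁, hΩδ⟩ := Metric.isOpen_iff.1 hΩ x hx
  obtain ⟨δ₂, hδ₂, hcont⟩ := Metric.continuous_iff.1 hc (x, x) ε hε
  have hd : 0 < dist y x := dist_pos.2 hxy
  set R := min (min (δ₁ / 2) (δ₂ / 2)) (dist y x) with hR
  have hR0 : 0 < R := lt_min (lt_min (by linarith) (by linarith)) hd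
  have hR1 : R ≤ δ₁ / 2 := (min_le_left _ _).trans (min_le_left _ _)
  have hR2 : R ≤ δ₂ / 2 := (min_le_left _ _).trans (min_le_right _ _)
  have hR3 : R ≤ dist y x := min_le_right _ _
  have h1 := (hP2 x R hR0 ((closedBall_subset_ball (by linarith)).trans hΩδ)).1
  have h2 : p x y ≤ pSup p (ball x R) ((ball x R)ᶜ) :=
    le_csSup ⟨pM, by rintro _ ⟨a, -, b, -, rfl⟩; exact (hb a b).2⟩
      ⟨x, mem_ball_self hR0, y, by simpa using hR3, rfl⟩
  have h3 : pSup p (ball x R) (ball x R) ≤ p x x + ε := by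
    refine csSup_le ⟨_, x, mem_ball_self hR0, x, mem_ball_self hR0, rfl⟩ ?_
    rintro _ ⟨a, ha, b, hb', rfl⟩
    have := hcont (a, b) (by
      rw [Prod.dist_eq, max_lt_iff]
      exact ⟨(mem_ball.1 ha).trans_le (by linarith), (mem_ball.1 hb').trans_le (by linarith)⟩)
    rw [Real.dist_eq] at this
    linarith [(abs_lt.1 this).2]
  linarith

lemma lintegral_truncation_lt_top {pM k : ℝ} {D : Set (Rn n)} (hpd : ∀ x, 0 ≤ p x x ∧ p x x ≤ pM)
    (hu : (∫⁻ x, ENNReal.ofReal (|u x| ^ p x x)) < ⊤) (hDv : volume D < ⊤) :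
    (∫⁻ x in D, ENNReal.ofReal (max (u x - k) 0 ^ p x x + 1)) < ⊤ := by
  have hk : ∀ x, |k| ^ p x x ≤ |k| ^ pM + 1 := fun x =>
    rpow_le_rpow_add_one (abs_nonneg k) (hpd x).1 (hpd x).2
  calc (∫⁻ x in D, ENNReal.ofReal (max (u x - k) 0 ^ p x x + 1))
      ≤ ∫⁻ x in D, (ENNReal.ofReal (2 ^ pM) * ENNReal.ofReal (|u x| ^ p x x) +
        ENNReal.ofReal (2 ^ pM * (|k| ^ pM + 1) + 1)) := by
        refine lintegral_mono fun x => ?_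
        have h0 : 0 ≤ |u x| ^ p x x := Real.rpow_nonneg (abs_nonneg _) _
        have h0' : 0 ≤ |k| ^ pM := Real.rpow_nonneg (abs_nonneg _) _
        rw [← ENNReal.ofReal_mul (by positivity), ← ENNReal.ofReal_add (by positivity) (by positivity)]
        apply ENNReal.ofReal_le_ofReal
        have h1 : max (u x - k) 0 ≤ |u x| + |k| :=
          max_le ((le_abs_self _).trans (abs_sub _ _)) (by positivity)
        have h2 := Real.rpow_le_rpow (le_max_right _ _) h1 (hpd x).1
        have h3 := add_rpow_le_two_rpow_mul (abs_nonneg (u x)) (abs_nonneg k) (hpd x).1 (hpd x).2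
        have h4 : (2 : ℝ) ^ pM * |k| ^ p x x ≤ 2 ^ pM * (|k| ^ pM + 1) := by
          gcongr; exact hk x
        linarith
    _ < ⊤ := by
        rw [lintegral_add_right _ measurable_const, lintegral_const_mul' _ _ ENNReal.ofReal_ne_top,
          setLIntegral_const]
        exact ENNReal.add_lt_top.2 ⟨ENNReal.mul_lt_top ENNReal.ofReal_lt_top
          ((setLIntegral_le_lintegral _ _).trans_lt hu),
          ENNReal.mul_lt_top ENNReal.ofReal_lt_top hDv⟩

/-- Truncations of a `W` function multiplied by Lipschitz cutoffs supported in `Ω` are in `W`. -/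
lemma memW_truncation_mul_cutoff (hn : 1 ≤ n) (hs : s ∈ Ioo (0 : ℝ) 1) (hp : ExponentOK p)
    (hdiag : ∀ x ∈ Ω, ∀ y, p x y ≤ p x x) (hu : MemW s p u) {D : Set (Rn n)}
    (hD : MeasurableSet D) (hDΩ : D ⊆ Ω) (hDv : volume D < ⊤) {θ : Rn n → ℝ} {ℓ : ℝ} (hℓ1 : 1 ≤ ℓ)
    (hθm : Measurable θ) (hθ : ∀ x y, |θ x - θ y| ≤ ℓ * ‖x - y‖) (hθ01 : ∀ x, 0 ≤ θ x ∧ θ x ≤ 1)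
    (hθD : ∀ x, x ∉ D → θ x = 0) (k : ℝ) :
    MemW s p (fun x => max (u x - k) 0 * θ x) := by
  obtain ⟨hum, hu1, hu2⟩ := hu
  obtain ⟨hc, hsymm, pm, pM, hpm, hb⟩ := hp
  have hpM0 : 0 < pM := by linarith [(hb 0 0).1, (hb 0 0).2]
  have hpme : Measurable (fun z : Rn n × Rn n => p z.1 z.2) := hc.measurable
  have hpd := measurable_on_diagonal hpme
  set w : Rn n → ℝ := fun x => max (u x - k) 0 with hw
  have hw0 : ∀ x, 0 ≤ w x := fun x => le_max_right _ _
  have hwm : Measurable w := by fun_prop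
  have hfin := lintegral_truncation_lt_top (k := k) (fun x => ⟨by linarith [(hb x x).1], (hb x x).2⟩)
    hu1 hDv
  refine ⟨hwm.mul hθm, ?_, ?_⟩
  · refine lt_of_le_of_lt ?_ hfin
    rw [← lintegral_indicator hD]
    refine lintegral_mono fun x => ?_
    have hp0 : 0 < p x x := by linarith [(hb x x).1]
    by_cases hx : x ∈ D
    · rw [indicator_of_mem hx]
      apply ENNReal.ofReal_le_ofReal
      rw [abs_of_nonneg (mul_nonneg (hw0 x) (hθ01 x).1)]
      have : (w x * θ x) ^ p x x ≤ w x ^ p x x :=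
        Real.rpow_le_rpow (mul_nonneg (hw0 x) (hθ01 x).1)
          (mul_le_of_le_one_right (hw0 x) (hθ01 x).2) hp0.le
      change _ ≤ w x ^ p x x + 1
      linarith
    · change ENNReal.ofReal (|w x * θ x| ^ p x x) ≤ _
      rw [hθD x hx, mul_zero, abs_zero, Real.zero_rpow hp0.ne']
      simp
  · obtain ⟨C, hC0, hC⟩ := lintegral_truncated_kernel (pM := pM) hn hs hpm
    set e : Rn n × Rn n → ℝ≥0∞ := fun z => D.indicator (fun x => ENNReal.ofReal (w x ^ p x x + 1)) z.1 *
      ENNReal.ofReal (min 1 (ℓ * ‖z.1 - z.2‖) ^ p z.1 z.2 * rker s (p z.1 z.2) (z.1 - z.2)) with he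
    have hrm := measurable_rker (s := s) hpme
    have hem : Measurable e := by
      refine Measurable.mul ?_ ?_
      · exact (Measurable.indicator (by fun_prop) hD).comp measurable_fst
      · fun_prop
    have heI : (∫⁻ x, ∫⁻ y, e (x, y)) < ⊤ := by
      calc (∫⁻ x, ∫⁻ y, e (x, y)) ≤ ∫⁻ x, D.indicator (fun x => ENNReal.ofReal (w x ^ p x x + 1)) x *
            ENNReal.ofReal (C * ℓ ^ pM) := by
            refine lintegral_mono fun x => ?_
            simp only [he]
            rw [lintegral_const_mul]
            · refine mul_le_mul_right ?_ _
              simpa using hC (p x) univ ℓ x hℓ1 MeasurableSet.univ (fun y _ => hb x y)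
            · have := measurable_right_of_prod hpme x
              have := measurable_right_of_prod (f := fun x y => rker s (p x y) (x - y)) hrm x
              fun_prop
        _ < ⊤ := by
            rw [lintegral_mul_const' _ _ ENNReal.ofReal_ne_top, lintegral_indicator hD]
            exact ENNReal.mul_lt_top hfin ENNReal.ofReal_lt_top
    have hum' : Measurable fun z : Rn n × Rn n => ENNReal.ofReal
        (|u z.1 - u z.2| ^ p z.1 z.2 / ‖z.1 - z.2‖ ^ ((n : ℝ) + s * p z.1 z.2)) := by fun_prop
    calc (∫⁻ x, ∫⁻ y, ENNReal.ofReal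
          (|w x * θ x - w y * θ y| ^ p x y / ‖x - y‖ ^ ((n : ℝ) + s * p x y)))
        ≤ ∫⁻ x, ∫⁻ y, ENNReal.ofReal (2 ^ pM) * (ENNReal.ofReal
          (|u x - u y| ^ p x y / ‖x - y‖ ^ ((n : ℝ) + s * p x y)) + (e (x, y) + e (y, x))) := by
          refine lintegral_mono fun x => lintegral_mono fun y => ?_
          have hp0 : 0 < p x y := by linarith [(hb x y).1]
          have hpM : p x y ≤ pM := (hb x y).2
          have hK := rker_nonneg s (p x y) (x - y)
          have hΔw : |w x - w y| ≤ |u x - u y| := by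
            have := abs_max_sub_max_le_abs (u x - k) (u y - k) 0
            rwa [sub_sub_sub_cancel_right] at this
          have hmin0 : 0 ≤ min 1 (ℓ * ‖x - y‖) := le_min zero_le_one (by positivity)
          have hΔθ : |θ x - θ y| ≤ min 1 (ℓ * ‖x - y‖) :=
            le_min (abs_sub_le_iff.2 ⟨by linarith [(hθ01 y).1, (hθ01 x).2],
              by linarith [(hθ01 x).1, (hθ01 y).2]⟩) (hθ x y)
          have hgen : ∀ a, a ∈ D → p x y ≤ p a a → |w x * θ x - w y * θ y| ≤
              |u x - u y| + w a * min 1 (ℓ * ‖x - y‖) →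
              ENNReal.ofReal (|w x * θ x - w y * θ y| ^ p x y / ‖x - y‖ ^ ((n : ℝ) + s * p x y)) ≤
              ENNReal.ofReal (2 ^ pM) * (ENNReal.ofReal
              (|u x - u y| ^ p x y / ‖x - y‖ ^ ((n : ℝ) + s * p x y)) +
              ENNReal.ofReal (w a ^ p a a + 1) *
              ENNReal.ofReal (min 1 (ℓ * ‖x - y‖) ^ p x y * rker s (p x y) (x - y))) := by
            intro a _ hpa h
            exact ofReal_kernel_le_of_abs_le (hw0 a) hmin0 hp0.le hpa hpM h
          by_cases hx : x ∈ D
          · refine (hgen x hx (hdiag x (hDΩ hx) y) ?_).trans ?_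
            · calc |w x * θ x - w y * θ y| = |(w x - w y) * θ y + w x * (θ x - θ y)| := by
                    congr 1; ring
                _ ≤ |w x - w y| * θ y + w x * |θ x - θ y| := by
                    refine (abs_add_le _ _).trans (le_of_eq ?_)
                    rw [abs_mul, abs_mul, abs_of_nonneg (hθ01 y).1, abs_of_nonneg (hw0 x)]
                _ ≤ |u x - u y| * 1 + w x * min 1 (ℓ * ‖x - y‖) := by
                    have := (hθ01 y).2
                    have := (hθ01 y).1
                    have := hw0 x
                    gcongr
                _ = _ := by ring
            · refine mul_le_mul_right (add_le_add le_rfl ?_) _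
              refine le_trans (le_of_eq ?_) le_self_add
              simp only [he, indicator_of_mem hx]
          · by_cases hy : y ∈ D
            · refine (hgen y hy (by rw [hsymm]; exact hdiag y (hDΩ hy) x) ?_).trans ?_
              · rw [hθD x hx, mul_zero, zero_sub, abs_neg, abs_of_nonneg
                  (mul_nonneg (hw0 y) (hθ01 y).1)]
                have h1 : θ y ≤ min 1 (ℓ * ‖x - y‖) := by
                  rw [hθD x hx, zero_sub, abs_neg, abs_of_nonneg (hθ01 y).1] at hΔθ
                  exact hΔθ
                have := mul_le_mul_of_nonneg_left h1 (hw0 y)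
                linarith [abs_nonneg (u x - u y)]
              · refine mul_le_mul_right (add_le_add le_rfl ?_) _
                refine le_trans (le_of_eq ?_) le_add_self
                simp only [he, indicator_of_mem hy]
                rw [hsymm y x, norm_sub_rev y x, rker_sub_comm s _ y x]
            · rw [hθD x hx, hθD y hy, mul_zero, mul_zero, sub_zero, abs_zero, Real.zero_rpow hp0.ne']
              simp
      _ < ⊤ := by
          exact lintegral_add_symmetrization_lt_top hum' hem hu2 heI

/-- The weak formulation holds on the product space, with an integrable integrand. -/
lemma IsWeakSubsol.integral_prod_nonpos (hsub : IsWeakSubsol s p Ω u) (hp : ExponentOK p)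
    (hu : MemW s p u) {φ : Rn n → ℝ} (hφ : MemW s p φ) (hφ0 : ∀ x, 0 ≤ φ x)
    (hφΩ : ∀ x, x ∉ Ω → φ x = 0) :
    Integrable (fun z : Rn n × Rn n => signedPow (p z.1 z.2) (u z.1 - u z.2) * (φ z.1 - φ z.2) *
      rker s (p z.1 z.2) (z.1 - z.2)) ∧
    (∫ z : Rn n × Rn n, signedPow (p z.1 z.2) (u z.1 - u z.2) * (φ z.1 - φ z.2) *
      rker s (p z.1 z.2) (z.1 - z.2)) ≤ 0 := by
  have hweak := hsub φ hφ hφ0 (Eventually.of_forall hφΩ)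
  obtain ⟨hc, hsymm, pm, pM, hpm, hb⟩ := hp
  have hpme : Measurable (fun z : Rn n × Rn n => p z.1 z.2) := hc.measurable
  have hrm := measurable_rker (s := s) hpme
  obtain ⟨hum, -, hu2⟩ := hu
  obtain ⟨hφm, -, hφ2⟩ := hφ
  have hFint : Integrable (fun z : Rn n × Rn n => signedPow (p z.1 z.2) (u z.1 - u z.2) *
      (φ z.1 - φ z.2) * rker s (p z.1 z.2) (z.1 - z.2)) := by
    have hm : Measurable (fun z : Rn n × Rn n => signedPow (p z.1 z.2) (u z.1 - u z.2) *
      (φ z.1 - φ z.2) * rker s (p z.1 z.2) (z.1 - z.2)) := by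
      unfold signedPow
      fun_prop
    refine ⟨hm.aestronglyMeasurable, ?_⟩
    have hg : ∀ {f : Rn n → ℝ}, Measurable f → Measurable fun z : Rn n × Rn n => ENNReal.ofReal
        (|f z.1 - f z.2| ^ p z.1 z.2 / ‖z.1 - z.2‖ ^ ((n : ℝ) + s * p z.1 z.2)) := by
      intro f hf
      fun_prop
    rw [hasFiniteIntegral_iff_norm]
    calc _ ≤ ∫⁻ z : Rn n × Rn n, (ENNReal.ofReal
          (|u z.1 - u z.2| ^ p z.1 z.2 / ‖z.1 - z.2‖ ^ ((n : ℝ) + s * p z.1 z.2)) + ENNReal.ofReal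
          (|φ z.1 - φ z.2| ^ p z.1 z.2 / ‖z.1 - z.2‖ ^ ((n : ℝ) + s * p z.1 z.2))) := by
          refine lintegral_mono fun z => ?_
          have h1 : 1 < p z.1 z.2 := by linarith [(hb z.1 z.2).1]
          have hK := rker_nonneg s (p z.1 z.2) (z.1 - z.2)
          have h2 := Real.rpow_nonneg (abs_nonneg (u z.1 - u z.2)) (p z.1 z.2)
          have h3 := Real.rpow_nonneg (abs_nonneg (φ z.1 - φ z.2)) (p z.1 z.2)
          rw [← ENNReal.ofReal_add (by positivity) (by positivity)]
          apply ENNReal.ofReal_le_ofReal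
          rw [Real.norm_eq_abs, abs_mul, abs_mul, abs_of_nonneg hK, abs_signedPow _ h1, ← add_div,
            div_eq_mul_inv]
          exact mul_le_mul_of_nonneg_right
            (rpow_sub_one_mul_le_add (abs_nonneg _) (abs_nonneg _) h1) hK
      _ < ⊤ := by
          rw [lintegral_add_left (hg hum), Measure.volume_eq_prod,
            lintegral_prod _ (hg hum).aemeasurable, lintegral_prod _ (hg hφm).aemeasurable]
          exact ENNReal.add_lt_top.2 ⟨hu2, hφ2⟩
  refine ⟨hFint, ?_⟩
  rw [Measure.volume_eq_prod, integral_prod _ hFint]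
  exact hweak

end Exponent

section Rescaling
variable {n : ℕ} {s pm pM lam : ℝ} {m : ℕ} {p : Rn n → Rn n → ℝ} {Ω : Set (Rn n)} {u : Rn n → ℝ}

/-- The function `u`, normalised in height and zoomed in to the ball of radius `R` about `z`. -/
def rescaledFun (z : Rn n) (R k h : ℝ) (u : Rn n → ℝ) (x : Rn n) : ℝ := (u (z + R • x) - k) / h

/-- The exponent `p` zoomed in to the ball of radius `R` about `z`. -/
def rescaledExp (z : Rn n) (R : ℝ) (p : Rn n → Rn n → ℝ) (x y : Rn n) : ℝ := p (z + R • x) (z + R • y)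

/-- The kernel of the equation satisfied by a rescaled solution. -/
def rescaledKer (s a Q : ℝ) (z : Rn n) (R : ℝ) (p : Rn n → Rn n → ℝ) (x y : Rn n) : ℝ :=
  a ^ (rescaledExp z R p x y - Q) * rker s (rescaledExp z R p x y) (x - y)

lemma signedPow_mul {q c t : ℝ} (hc : 0 < c) : signedPow q (c * t) = c ^ (q - 1) * signedPow q t := by
  unfold signedPow
  rw [abs_mul, abs_of_pos hc, Real.mul_rpow hc.le (abs_nonneg t),
    show q - 1 = (q - 2) + 1 by ring, Real.rpow_add_one hc.ne']
  ring

lemma rker_smul {q R : ℝ} (hR : 0 < R) (x : Rn n) :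
    rker s q (R • x) = R ^ (-((n : ℝ) + s * q)) * rker s q x := by
  unfold rker
  rw [norm_smul, Real.norm_of_nonneg hR.le, Real.mul_rpow hR.le (norm_nonneg _), mul_inv,
    Real.rpow_neg hR.le]

lemma add_smul_mem_ball_iff {z x : Rn n} {R r : ℝ} (hR : 0 < R) :
    z + R • x ∈ ball z (R * r) ↔ x ∈ ball (0 : Rn n) r := by
  rw [mem_ball_iff_norm, add_sub_cancel_left, norm_smul, Real.norm_of_nonneg hR.le,
    mem_ball_zero_iff, mul_lt_mul_iff_right₀ hR]

lemma rescaled_integrand_eq {z x y : Rn n} {R k₀ k h Q q e₁ e₂ : ℝ} (hR : 0 < R) (hh : 0 < h) :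
    signedPow q (u (z + R • x) - u (z + R • y)) *
      (max (u (z + R • x) - (k₀ + h * k)) 0 * e₁ - max (u (z + R • y) - (k₀ + h * k)) 0 * e₂) *
      rker s q ((z + R • x) - (z + R • y)) =
    R ^ (-(n : ℝ)) * (h / R ^ s) ^ Q * (signedPow q (rescaledFun z R k₀ h u x - rescaledFun z R k₀ h u y) *
      (max (rescaledFun z R k₀ h u x - k) 0 * e₁ - max (rescaledFun z R k₀ h u y - k) 0 * e₂) *
      ((h / R ^ s) ^ (q - Q) * rker s q (x - y))) := by
  have hmax : ∀ w, max (u (z + R • w) - (k₀ + h * k)) 0 = h * max (rescaledFun z R k₀ h u w - k) 0 := by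
    intro w
    rw [mul_max_of_nonneg _ _ hh.le, mul_zero]
    congr 1
    unfold rescaledFun
    field_simp
    ring
  have hdiff : u (z + R • x) - u (z + R • y) =
      h * (rescaledFun z R k₀ h u x - rescaledFun z R k₀ h u y) := by
    unfold rescaledFun
    field_simp
    ring
  have hRs : 0 < R ^ s := Real.rpow_pos_of_pos hR s
  have ha : 0 < h / R ^ s := div_pos hh hRs
  rw [hmax, hmax, hdiff, signedPow_mul hh, add_sub_add_left_eq_sub, ← smul_sub, rker_smul hR,
    Real.rpow_sub ha, neg_add, Real.rpow_add hR]
  have e3 : h ^ (q - 1) * h * R ^ (-(s * q)) = (h / R ^ s) ^ q := by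
    rw [← Real.rpow_add_one hh.ne', sub_add_cancel, Real.div_rpow hh.le hRs.le, Real.rpow_neg hR.le,
      Real.rpow_mul hR.le, div_eq_mul_inv]
  have hQ : (h / R ^ s) ^ Q ≠ 0 := (Real.rpow_pos_of_pos ha Q).ne'
  rw [← e3]
  field_simp

/-- A subsolution zoomed in to a small ball solves an equation of the same type at unit scale. -/
theorem IsWeakSubsol.unitSub (hn : 1 ≤ n) (hs : s ∈ Ioo (0 : ℝ) 1) (hp : ExponentOK p)
    (hsub : IsWeakSubsol s p Ω u) (hu : MemW s p u) (hdiag : ∀ x ∈ Ω, ∀ y, p x y ≤ p x x)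
    (hm : pM ≤ m) {z : Rn n} {R k₀ h q Q : ℝ} (hR : 0 < R) (hz : closedBall z R ⊆ Ω) (hh : 0 < h)
    (hq : ∀ x ∈ ball z R, ∀ y ∈ ball z R, q ≤ p x y ∧ p x y ≤ Q) (hpmq : pm ≤ q) (hQ : Q ≤ pM)
    (ha : 1 ≤ h / R ^ s) (hlam : lam ≤ (h / R ^ s) ^ (q - Q)) :
    UnitSub s pm pM lam m (rescaledExp z R p) (rescaledKer s (h / R ^ s) Q z R p)
      (rescaledFun z R k₀ h u) := by
  have hp' := hp
  obtain ⟨hc, hsymm, pm', pM', hpm', hb⟩ := hp'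
  have hmem : ∀ x ∈ ball (0 : Rn n) 1, z + R • x ∈ ball z R := fun x hx => by
    simpa using (add_smul_mem_ball_iff (z := z) hR).2 hx
  have hpme : Measurable (fun w : Rn n × Rn n => p w.1 w.2) := hc.measurable
  have hT : Measurable (fun w : Rn n × Rn n => (z + R • w.1, z + R • w.2)) := by fun_prop
  have hpme' : Measurable (fun w : Rn n × Rn n => rescaledExp z R p w.1 w.2) := hpme.comp hT
  have hum := hu.1
  have ha0 : 0 < h / R ^ s := zero_lt_one.trans_le ha
  have hrn : ∀ x y : Rn n, 0 ≤ rker s (rescaledExp z R p x y) (x - y) := fun x y => rker_nonneg _ _ _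
  have hm1 : 1 < m := by
    have := hq z (mem_ball_self hR) z (mem_ball_self hR)
    have h2 := hb z z
    have : (1 : ℝ) < m := by linarith
    exact_mod_cast this
  refine ⟨hpme', ?_, ?_, fun x y => hsymm _ _, fun x y => ?_, fun x y => ?_, fun x y => ?_,
    fun x hx y hy => ?_, fun x hx y => ?_, fun x hx => ?_, fun x hx y hy => ?_, fun x hx y hy => ?_, ?_⟩
  · have := measurable_rker (s := s) hpme'
    unfold rescaledKer
    fun_prop
  · unfold rescaledFun
    fun_prop
  · unfold rescaledKer
    rw [show rescaledExp z R p x y = rescaledExp z R p y x from hsymm _ _, rker_sub_comm]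
  · exact mul_nonneg (Real.rpow_nonneg ha0.le _) (hrn x y)
  · exact hpm'.trans_le (hb _ _).1
  · exact hpmq.trans (hq _ (hmem x hx) _ (hmem y hy)).1
  · exact hdiag _ (hz (ball_subset_closedBall (hmem x hx))) _
  · exact (hq _ (hmem x hx) _ (hmem x hx)).2.trans hQ
  · refine mul_le_of_le_one_left (hrn x y) (Real.rpow_le_one_of_one_le_of_nonpos ha ?_)
    exact sub_nonpos.2 (hq _ (hmem x hx) _ (hmem y hy)).2
  · refine mul_le_mul_of_nonneg_right (hlam.trans ?_) (hrn x y)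
    exact Real.rpow_le_rpow_of_exponent_le ha
      (sub_le_sub_right (hq _ (hmem x hx) _ (hmem y hy)).1 Q)
  · rintro k η ⟨c, hη⟩ hη01 ⟨r, hr, hηr⟩
    set θ : Rn n → ℝ := fun x => η (R⁻¹ • (x - z)) ^ m with hθ
    have hθc : Continuous θ := by
      have := hη.continuous
      fun_prop
    have hθT : ∀ x, θ (z + R • x) = η x ^ m := fun x => by
      simp only [hθ, add_sub_cancel_left, smul_smul, inv_mul_cancel₀ hR.ne', one_smul]
    have hθ0 : ∀ x, x ∉ ball z R → θ x = 0 := by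
      intro x hx
      have : R⁻¹ • (x - z) ∉ ball (0 : Rn n) r := by
        intro h'
        apply hx
        have h2 := (add_smul_mem_ball_iff (z := z) (r := 1) hR).2 (ball_subset_ball hr.le h')
        rwa [smul_smul, mul_inv_cancel₀ hR.ne', one_smul, add_sub_cancel, mul_one] at h2
      simp only [hθ, hηr _ this]
      exact zero_pow (by omega)
    have hφ := memW_truncation_mul_cutoff hn hs hp hdiag hu (D := ball z R) measurableSet_ball
      (ball_subset_closedBall.trans hz) measure_ball_lt_top (θ := θ) (ℓ := max 1 (m * (c * R⁻¹)))
      (le_max_left _ _) hθc.measurable (fun x y => by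
        calc |θ x - θ y| ≤ m * max (η (R⁻¹ • (x - z))) (η (R⁻¹ • (y - z))) ^ (m - 1) *
              |η (R⁻¹ • (x - z)) - η (R⁻¹ • (y - z))| :=
              abs_pow_sub_pow_le_mul_max (hη01 _).1 (hη01 _).1 m
          _ ≤ m * 1 * (c * (R⁻¹ * ‖x - y‖)) := by
              have h1 := hη.dist_le_mul (R⁻¹ • (x - z)) (R⁻¹ • (y - z))
              rw [Real.dist_eq, dist_eq_norm, ← smul_sub, sub_sub_sub_cancel_right, norm_smul,
                Real.norm_of_nonneg (inv_nonneg.2 hR.le)] at h1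
              have h2 : max (η (R⁻¹ • (x - z))) (η (R⁻¹ • (y - z))) ^ (m - 1) ≤ 1 :=
                pow_le_one₀ (le_max_of_le_left (hη01 _).1) (max_le (hη01 _).2 (hη01 _).2)
              gcongr
          _ = m * (c * R⁻¹) * ‖x - y‖ := by ring
          _ ≤ _ := by gcongr; exact le_max_right _ _)
      (fun x => ⟨pow_nonneg (hη01 _).1 m, pow_le_one₀ (hη01 _).1 (hη01 _).2⟩) hθ0 (k₀ + h * k)
    obtain ⟨hFint, hle⟩ := hsub.integral_prod_nonpos hp hu hφ
      (fun x => mul_nonneg (le_max_right _ _) (pow_nonneg (hη01 _).1 m))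
      (fun x hx => by
        rw [hθ0 x fun h' => hx (hz (ball_subset_closedBall h')), mul_zero])
    set F : Rn n × Rn n → ℝ := fun w => signedPow (p w.1 w.2) (u w.1 - u w.2) *
      (max (u w.1 - (k₀ + h * k)) 0 * θ w.1 - max (u w.2 - (k₀ + h * k)) 0 * θ w.2) *
      rker s (p w.1 w.2) (w.1 - w.2) with hF
    set c₁ : ℝ := R ^ (-(n : ℝ)) * (h / R ^ s) ^ Q with hc₁
    have hc₁0 : 0 < c₁ := mul_pos (Real.rpow_pos_of_pos hR _) (Real.rpow_pos_of_pos ha0 _)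
    have hFT : ∀ w : Rn n × Rn n, signedPow (rescaledExp z R p w.1 w.2)
        (rescaledFun z R k₀ h u w.1 - rescaledFun z R k₀ h u w.2) *
        (max (rescaledFun z R k₀ h u w.1 - k) 0 * η w.1 ^ m -
          max (rescaledFun z R k₀ h u w.2 - k) 0 * η w.2 ^ m) *
        rescaledKer s (h / R ^ s) Q z R p w.1 w.2 = c₁⁻¹ * F ((z, z) + R • w) := by
      intro w
      rw [eq_inv_mul_iff_mul_eq₀ hc₁0.ne']
      simp only [hF, Prod.fst_add, Prod.snd_add, Prod.smul_fst, Prod.smul_snd, hθT]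
      exact (rescaled_integrand_eq hR hh).symm
    have : (volume : Measure (Rn n × Rn n)).IsAddHaarMeasure :=
      inferInstanceAs (((volume : Measure (Rn n)).prod (volume : Measure (Rn n))).IsAddHaarMeasure)
    simp only [hFT]
    refine ⟨((hFint.comp_add_left (z, z)).comp_smul hR.ne').const_mul _, ?_⟩
    rw [integral_const_mul, Measure.integral_comp_smul volume (fun w => F ((z, z) + w)) R,
      integral_add_left_eq_self F (z, z)]
    exact mul_nonpos_of_nonneg_of_nonpos (inv_nonneg.2 hc₁0.le)
      (mul_nonpos_of_nonneg_of_nonpos (abs_nonneg _) hle)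

end Rescaling

section Tail
variable {n : ℕ} {s pm gM : ℝ} {p : Rn n → Rn n → ℝ} {Ω : Set (Rn n)} {u : Rn n → ℝ}

lemma lintegral_comp_dilation {g : Rn n → ℝ≥0∞} (hg : Measurable g) (z : Rn n) {R : ℝ} (hR : 0 < R) :
    (∫⁻ x, g (z + R • x)) = ENNReal.ofReal (R ^ (-(n : ℝ))) * ∫⁻ x, g x := by
  have h1 : (∫⁻ x, g (z + R • x)) = ∫⁻ y, g (z + y) ∂(Measure.map (fun x : Rn n => R • x) volume) :=
    (lintegral_map (hg.comp (measurable_const_add z)) (measurable_const_smul R)).symm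
  rw [h1, Measure.map_addHaar_smul _ hR.ne', lintegral_smul_measure,
    lintegral_add_left_eq_self g z, smul_eq_mul, finrank_euclideanSpace_fin, Real.rpow_neg hR.le,
    Real.rpow_natCast, abs_of_pos (by positivity)]

lemma rker_le_of_le_norm {q D ρ N : ℝ} {x y : Rn n} (hD : 0 ≤ D) (hx : ‖x‖ ≤ D) (hρ : 0 < ρ)
    (hρ1 : ρ ≤ 1) (hxy : ρ ≤ ‖x - y‖) (he : 0 ≤ (n : ℝ) + s * q) (heN : (n : ℝ) + s * q ≤ N) :
    rker s q (x - y) ≤ 2 * (D + 1) ^ N * ρ ^ (-N) * (1 + ‖y‖ ^ ((n : ℝ) + s * q))⁻¹ := by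
  have ht : 0 < ‖x - y‖ := hρ.trans_le hxy
  set e := (n : ℝ) + s * q with he'
  set t := ‖x - y‖ with ht'
  set A := (D + 1) / ρ with hA
  have hA1 : 1 ≤ A := by rw [hA, le_div_iff₀ hρ]; linarith
  have h1 : 1 ≤ A * t := by
    rw [hA, div_mul_eq_mul_div, le_div_iff₀ hρ]
    nlinarith
  have h2 : ‖y‖ ≤ A * t := by
    have h3 : ‖y‖ ≤ D + t := by
      have := norm_sub_norm_le y x
      rw [norm_sub_rev] at this
      linarith
    rw [hA, div_mul_eq_mul_div, le_div_iff₀ hρ]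
    nlinarith
  have h3 : 1 + ‖y‖ ^ e ≤ 2 * (A * t) ^ e := by
    have := Real.rpow_le_rpow (norm_nonneg y) h2 he
    have := Real.one_le_rpow h1 he
    linarith
  have h4 : A ^ e ≤ (D + 1) ^ N * ρ ^ (-N) := by
    refine (Real.rpow_le_rpow_of_exponent_le hA1 heN).trans (le_of_eq ?_)
    rw [hA, Real.div_rpow (by positivity) hρ.le, Real.rpow_neg hρ.le, div_eq_mul_inv]
  have hy : 0 ≤ ‖y‖ ^ e := Real.rpow_nonneg (norm_nonneg y) _
  have hte : 0 < t ^ e := Real.rpow_pos_of_pos ht _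
  change (t ^ e)⁻¹ ≤ _
  rw [← div_eq_mul_inv, inv_eq_one_div, div_le_div_iff₀ hte (by positivity), one_mul]
  rw [Real.mul_rpow (by positivity) ht.le] at h3
  calc 1 + ‖y‖ ^ e ≤ 2 * (A ^ e * t ^ e) := h3
    _ ≤ 2 * ((D + 1) ^ N * ρ ^ (-N) * t ^ e) := by gcongr
    _ = _ := by ring

/-- Quantitative control of the tail of `u` away from points of the bounded set `Ω`. -/
lemma exists_far_tail (hn : 1 ≤ n) (hs : s ∈ Ioo (0 : ℝ) 1) (hpm : 1 < pm)
    (hb : ∀ x y, pm ≤ p x y ∧ p x y ≤ gM) (hpme : Measurable fun z : Rn n × Rn n => p z.1 z.2)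
    (hΩ : Bornology.IsBounded Ω)
    (htail : ∃ M : ℝ, ∀ x ∈ Ω,
      (∫⁻ y, ENNReal.ofReal (|u y| ^ (p x y - 1) / (1 + ‖y‖ ^ ((n : ℝ) + s * p x y))))
        ≤ ENNReal.ofReal M) {κ : ℝ} (hκ : 0 ≤ κ) :
    ∃ C₀ > 0, ∀ x ∈ Ω, ∀ ρ, 0 < ρ → ρ ≤ 1 →
      (∫⁻ y in (ball x ρ)ᶜ, ENNReal.ofReal ((|u y| + κ) ^ (p x y - 1) * rker s (p x y) (x - y))) ≤
        ENNReal.ofReal (C₀ * ρ ^ (-((n : ℝ) + gM))) := by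
  obtain ⟨M, hM⟩ := htail
  obtain ⟨D, hD0, hD⟩ := hΩ.exists_pos_norm_le
  obtain ⟨C, hC0, hC⟩ := lintegral_truncated_kernel (pM := gM) hn hs hpm
  have hs0 := hs.1
  have hgM : 1 < gM := by linarith [(hb 0 0).1, (hb 0 0).2]
  set N := (n : ℝ) + gM with hN
  set c₁ := 2 ^ gM * (2 * (D + 1) ^ N) with hc₁
  set c₂ := 2 ^ gM * (κ ^ gM + 1) with hc₂
  have hc₁0 : 0 < c₁ := by positivity
  have hc₂0 : 0 < c₂ := by positivity
  refine ⟨c₁ * |M| + c₂ * C, by positivity, fun x hx ρ hρ hρ1 => ?_⟩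
  have hρN : 0 < ρ ^ (-N) := Real.rpow_pos_of_pos hρ _
  have hmr := measurable_right_of_prod hpme x
  have hmk := measurable_right_of_prod (f := fun x y => rker s (p x y) (x - y))
    (measurable_rker (s := s) hpme) x
  have hℓ : 1 ≤ ρ⁻¹ := (one_le_inv₀ hρ).2 hρ1
  calc (∫⁻ y in (ball x ρ)ᶜ, ENNReal.ofReal ((|u y| + κ) ^ (p x y - 1) * rker s (p x y) (x - y)))
      ≤ ∫⁻ y in (ball x ρ)ᶜ, (ENNReal.ofReal (c₁ * ρ ^ (-N)) *
        ENNReal.ofReal (|u y| ^ (p x y - 1) / (1 + ‖y‖ ^ ((n : ℝ) + s * p x y))) +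
        ENNReal.ofReal c₂ *
          ENNReal.ofReal (min 1 (ρ⁻¹ * ‖x - y‖) ^ p x y * rker s (p x y) (x - y))) := by
        refine setLIntegral_mono' measurableSet_ball.compl fun y hy => ?_
        have hxy : ρ ≤ ‖x - y‖ := by
          rw [mem_compl_iff, mem_ball, not_lt, dist_comm, dist_eq_norm] at hy
          exact hy
        have hq1 : 0 ≤ p x y - 1 := by linarith [(hb x y).1]
        have hqM : p x y - 1 ≤ gM := by linarith [(hb x y).2]
        have hmin : min 1 (ρ⁻¹ * ‖x - y‖) = 1 := by
          refine min_eq_left ?_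
          rw [inv_mul_eq_div, le_div_iff₀ hρ]
          linarith
        have hu0 : 0 ≤ |u y| ^ (p x y - 1) := Real.rpow_nonneg (abs_nonneg _) _
        have hy0 : 0 ≤ ‖y‖ ^ ((n : ℝ) + s * p x y) := Real.rpow_nonneg (norm_nonneg y) _
        have hK := rker_nonneg s (p x y) (x - y)
        rw [hmin, Real.one_rpow, one_mul, ← ENNReal.ofReal_mul (by positivity),
          ← ENNReal.ofReal_mul (by positivity), ← ENNReal.ofReal_add (by positivity) (by positivity)]
        apply ENNReal.ofReal_le_ofReal
        have h1 := add_rpow_le_two_rpow_mul (abs_nonneg (u y)) hκ hq1 hqM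
        have h2 := rpow_le_rpow_add_one hκ hq1 hqM
        have h3 : rker s (p x y) (x - y) ≤ 2 * (D + 1) ^ N * ρ ^ (-N) *
            (1 + ‖y‖ ^ ((n : ℝ) + s * p x y))⁻¹ := by
          have hq0 : 0 ≤ p x y := by linarith
          refine rker_le_of_le_norm hD0.le (hD x hx) hρ hρ1 hxy (by positivity) ?_
          have : s * p x y ≤ 1 * gM := mul_le_mul hs.2.le (hb x y).2 hq0 zero_le_one
          linarith
        calc (|u y| + κ) ^ (p x y - 1) * rker s (p x y) (x - y)
            ≤ 2 ^ gM * (|u y| ^ (p x y - 1) + (κ ^ gM + 1)) * rker s (p x y) (x - y) := by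
              refine mul_le_mul_of_nonneg_right (h1.trans ?_) hK
              gcongr
          _ = 2 ^ gM * |u y| ^ (p x y - 1) * rker s (p x y) (x - y) + c₂ * rker s (p x y) (x - y) := by
              ring
          _ ≤ 2 ^ gM * |u y| ^ (p x y - 1) * (2 * (D + 1) ^ N * ρ ^ (-N) *
              (1 + ‖y‖ ^ ((n : ℝ) + s * p x y))⁻¹) + c₂ * rker s (p x y) (x - y) := by gcongr
          _ = _ := by rw [hc₁]; ring
    _ ≤ ENNReal.ofReal (c₁ * ρ ^ (-N)) * ENNReal.ofReal |M| +
        ENNReal.ofReal c₂ * ENNReal.ofReal (C * ρ⁻¹ ^ gM) := by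
        rw [lintegral_add_right _ (by fun_prop), lintegral_const_mul' _ _ ENNReal.ofReal_ne_top,
          lintegral_const_mul' _ _ ENNReal.ofReal_ne_top]
        refine add_le_add (mul_le_mul_right ?_ _) (mul_le_mul_right ?_ _)
        · exact (setLIntegral_le_lintegral _ _).trans
            ((hM x hx).trans (ENNReal.ofReal_le_ofReal (le_abs_self M)))
        · exact hC (p x) _ ρ⁻¹ x hℓ measurableSet_ball.compl fun y _ => hb x y
    _ ≤ _ := by
        rw [← ENNReal.ofReal_mul (by positivity), ← ENNReal.ofReal_mul (by positivity),
          ← ENNReal.ofReal_add (by positivity) (by positivity)]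
        apply ENNReal.ofReal_le_ofReal
        have : ρ⁻¹ ^ gM ≤ ρ ^ (-N) := by
          rw [Real.inv_rpow hρ.le, ← Real.rpow_neg hρ.le]
          apply Real.rpow_le_rpow_of_exponent_ge hρ hρ1
          rw [hN]
          linarith [(Nat.cast_nonneg n : (0 : ℝ) ≤ n)]
        calc c₁ * ρ ^ (-N) * |M| + c₂ * (C * ρ⁻¹ ^ gM)
            ≤ c₁ * ρ ^ (-N) * |M| + c₂ * (C * ρ ^ (-N)) := by gcongr
          _ = _ := by ring

/-- Tails of rescaled functions in terms of tails of the original function. -/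
lemma rescaled_tail_le {N C₀ κ : ℝ} (hpm : 1 < pm)
    (hb : ∀ x y, pm ≤ p x y) (hpme : Measurable fun z : Rn n × Rn n => p z.1 z.2)
    (hum : Measurable u)
    (hfar : ∀ x ∈ Ω, ∀ ρ, 0 < ρ → ρ ≤ 1 →
      (∫⁻ y in (ball x ρ)ᶜ, ENNReal.ofReal ((|u y| + κ) ^ (p x y - 1) * rker s (p x y) (x - y))) ≤
        ENNReal.ofReal (C₀ * ρ ^ (-N)))
    {z : Rn n} {R k₀ h Q : ℝ} (hR : 0 < R) (hz : closedBall z R ⊆ Ω) (hh : 0 < h) (hk₀ : |k₀| ≤ κ)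
    (hQ : 1 ≤ Q) (ha : 1 ≤ h / R ^ s) {x : Rn n} (hx : x ∈ ball (0 : Rn n) 1) {r : ℝ} (hr : 0 < r)
    (hRr : R * r ≤ 1) :
    (∫⁻ y in (ball x r)ᶜ, ENNReal.ofReal (max (rescaledFun z R k₀ h u y) 0 ^ (rescaledExp z R p x y - 1) *
      rescaledKer s (h / R ^ s) Q z R p x y)) ≤ ENNReal.ofReal (R ^ s * (C₀ * (R * r) ^ (-N))) := by
  set X := z + R • x with hX
  have hXΩ : X ∈ Ω := hz (ball_subset_closedBall (by
    simpa only [mul_one] using (add_smul_mem_ball_iff (z := z) hR).2 hx))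
  set a := h / R ^ s with ha'
  have ha0 : 0 < a := zero_lt_one.trans_le ha
  have hRs : 0 < R ^ s := Real.rpow_pos_of_pos hR s
  have hh' : h = a * R ^ s := by rw [ha']; field_simp
  set G : Rn n → ℝ≥0∞ := fun y => (ball X (R * r))ᶜ.indicator (fun y => ENNReal.ofReal
    ((|u y| + κ) ^ (p X y - 1) * rker s (p X y) (X - y))) y with hG
  have hmr := measurable_right_of_prod hpme X
  have hmk := measurable_right_of_prod (f := fun x y => rker s (p x y) (x - y))
    (measurable_rker (s := s) hpme) X
  have hGm : Measurable G := Measurable.indicator (by fun_prop) measurableSet_ball.compl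
  rw [← lintegral_indicator measurableSet_ball.compl]
  calc _ ≤ ∫⁻ y, ENNReal.ofReal (R ^ (n : ℝ) * R ^ s) * G (z + R • y) := by
        refine lintegral_mono fun y => ?_
        by_cases hy : y ∈ (ball x r)ᶜ
        swap
        · rw [indicator_of_notMem hy]; exact zero_le
        have hY : z + R • y ∈ (ball X (R * r))ᶜ := by
          rw [mem_compl_iff, mem_ball, not_lt, dist_comm, dist_eq_norm] at hy ⊢
          rw [hX, add_sub_add_left_eq_sub, ← smul_sub, norm_smul, Real.norm_of_nonneg hR.le]
          gcongr
        rw [indicator_of_mem hy, hG]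
        simp only [indicator_of_mem hY]
        rw [← ENNReal.ofReal_mul (by positivity)]
        apply ENNReal.ofReal_le_ofReal
        unfold rescaledKer rescaledExp
        rw [← hX]
        set Y := z + R • y with hY'
        set q := p X Y with hq
        have hq1 : 0 ≤ q - 1 := by linarith [hb X Y]
        have h1 : max (rescaledFun z R k₀ h u y) 0 ≤ (|u Y| + κ) / h := by
          refine max_le ?_ (div_nonneg (by linarith [abs_nonneg (u Y), abs_nonneg k₀]) hh.le)
          unfold rescaledFun
          gcongr
          linarith [le_abs_self (u Y), neg_abs_le k₀]
        have hκ : 0 ≤ |u Y| + κ := by linarith [abs_nonneg (u Y), abs_nonneg k₀]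
        have h2 := Real.rpow_le_rpow (le_max_right _ _) h1 hq1
        have h3 : rker s q (X - Y) = R ^ (-((n : ℝ) + s * q)) * rker s q (x - y) := by
          rw [hX, hY', add_sub_add_left_eq_sub, ← smul_sub, rker_smul hR]
        have hK := rker_nonneg s q (x - y)
        have hU := Real.rpow_nonneg hκ (q - 1)
        have h4 : R ^ (n : ℝ) * R ^ s * R ^ (-((n : ℝ) + s * q)) = (R ^ s) ^ (1 - q) := by
          rw [← Real.rpow_mul hR.le, ← Real.rpow_add hR, ← Real.rpow_add hR]
          congr 1; ring
        have h5 : (h ^ (q - 1))⁻¹ * a ^ (q - Q) ≤ (R ^ s) ^ (1 - q) := by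
          rw [hh', Real.mul_rpow ha0.le hRs.le, mul_inv, ← Real.rpow_neg ha0.le,
            ← Real.rpow_neg hRs.le, mul_right_comm, ← Real.rpow_add ha0, neg_sub]
          exact mul_le_of_le_one_left (Real.rpow_nonneg hRs.le _)
            (Real.rpow_le_one_of_one_le_of_nonpos ha (by linarith))
        calc max (rescaledFun z R k₀ h u y) 0 ^ (q - 1) * (a ^ (q - Q) * rker s q (x - y))
            ≤ ((|u Y| + κ) / h) ^ (q - 1) * (a ^ (q - Q) * rker s q (x - y)) := by gcongr
          _ = (|u Y| + κ) ^ (q - 1) * ((h ^ (q - 1))⁻¹ * a ^ (q - Q)) * rker s q (x - y) := by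
              rw [Real.div_rpow hκ hh.le]; ring
          _ ≤ (|u Y| + κ) ^ (q - 1) * (R ^ s) ^ (1 - q) * rker s q (x - y) := by gcongr
          _ = _ := by rw [h3, ← h4]; ring
    _ = ENNReal.ofReal (R ^ s) * ∫⁻ y in (ball X (R * r))ᶜ, ENNReal.ofReal
          ((|u y| + κ) ^ (p X y - 1) * rker s (p X y) (X - y)) := by
        rw [lintegral_const_mul' _ _ ENNReal.ofReal_ne_top, lintegral_comp_dilation hGm z hR,
          ← mul_assoc, ← ENNReal.ofReal_mul (by positivity),
          lintegral_indicator measurableSet_ball.compl]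
        congr 2
        rw [Real.rpow_neg hR.le]
        field_simp
    _ ≤ ENNReal.ofReal (R ^ s) * ENNReal.ofReal (C₀ * (R * r) ^ (-N)) :=
        mul_le_mul_right (hfar X hXΩ _ (by positivity) hRr) _
    _ = _ := by rw [← ENNReal.ofReal_mul hRs.le]

/-- The tail condition at unit scale from polynomial growth near the ball. -/
lemma rescaled_tailBound {C₀ κ T₁ : ℝ} (hs : s ∈ Ioo (0 : ℝ) 1) (hpm : 1 < pm)
    (hb : ∀ x y, pm ≤ p x y ∧ p x y ≤ gM) (hpme : Measurable fun z : Rn n × Rn n => p z.1 z.2)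
    (hum : Measurable u) (hdiag : ∀ x ∈ Ω, ∀ y, p x y ≤ p x x)
    (hfar : ∀ x ∈ Ω, ∀ ρ, 0 < ρ → ρ ≤ 1 →
      (∫⁻ y in (ball x ρ)ᶜ, ENNReal.ofReal ((|u y| + κ) ^ (p x y - 1) * rker s (p x y) (x - y))) ≤
        ENNReal.ofReal (C₀ * ρ ^ (-((n : ℝ) + gM)))) (hT₁0 : 0 < T₁)
    (hT₁ : ∀ (q f : Rn n → ℝ) (ε : ℝ) (x : Rn n) (S : Set (Rn n)), MeasurableSet S → 0 < ε → ε ≤ 1 →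
      (∀ y, 1 ≤ q y ∧ q y ≤ gM) → (∀ y, 0 ≤ f y) → (∀ y ∈ S, f y ≤ 8 * (1 + ‖x - y‖) ^ (s / 2)) →
      (∀ y ∈ S, ε ≤ ‖x - y‖) → (∫⁻ y in S, ENNReal.ofReal (f y ^ (q y - 1) * rker s (q y) (x - y))) ≤
        ENNReal.ofReal (T₁ * ε ^ (-((n : ℝ) + gM))))
    {z : Rn n} {R k₀ h Q ϱ : ℝ} (hR : 0 < R) (hz : closedBall z R ⊆ Ω) (hh : 0 < h) (hk₀ : |k₀| ≤ κ)
    (hQ : ∀ x ∈ ball z R, p x x ≤ Q) (ha : 1 ≤ h / R ^ s) (hRϱ : R ≤ ϱ) (hϱ : ϱ ≤ 1)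
    (hsmall : R ^ s * (C₀ * ϱ ^ (-((n : ℝ) + gM))) ≤ 1)
    (hgrow : ∀ᵐ y : Rn n, ‖y‖ < 2 * ϱ / R → rescaledFun z R k₀ h u y ≤ 4 * (1 + ‖y‖) ^ (s / 2)) :
    TailBound (T₁ + 1) ((n : ℝ) + gM) (rescaledExp z R p) (rescaledKer s (h / R ^ s) Q z R p)
      (rescaledFun z R k₀ h u) := by
  intro ε hε hε1 x hx
  have hs0 := hs.1
  have hQ1 : 1 ≤ Q := by
    have := hQ z (mem_ball_self hR)
    linarith [(hb z z).1]
  have hXR : z + R • x ∈ ball z R := by simpa using (add_smul_mem_ball_iff (z := z) hR).2 hx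
  set N := (n : ℝ) + gM with hN
  have hgM : 1 < gM := by linarith [(hb 0 0).1, (hb 0 0).2]
  have hεN : 1 ≤ ε ^ (-N) := Real.one_le_rpow_of_pos_of_le_one_of_nonpos hε hε1 (by
    rw [hN]; linarith [(Nat.cast_nonneg n : (0 : ℝ) ≤ n)])
  set r := ϱ / R with hr
  have hr1 : 1 ≤ r := by rw [hr, le_div_iff₀ hR]; linarith
  have hRr : R * r = ϱ := by rw [hr]; field_simp
  set U := rescaledFun z R k₀ h u with hU
  set g : Rn n → ℝ≥0∞ := fun y => ENNReal.ofReal (max (U y) 0 ^ (rescaledExp z R p x y - 1) *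
    rescaledKer s (h / R ^ s) Q z R p x y) with hg
  set S : Set (Rn n) := (ball x ε)ᶜ ∩ ball x r with hS
  have hSm : MeasurableSet S := measurableSet_ball.compl.inter measurableSet_ball
  have hfarb := rescaled_tail_le hpm (fun x y => (hb x y).1) hpme hum hfar hR hz hh hk₀ hQ1
    ha hx (by positivity) (hRr.trans_le hϱ)
  rw [hRr] at hfarb
  have hnear : (∫⁻ y in S, g y) ≤ ENNReal.ofReal (T₁ * ε ^ (-N)) := by
    refine le_trans ?_ (hT₁ (rescaledExp z R p x)
      (fun y => min (max (U y) 0) (8 * (1 + ‖x - y‖) ^ (s / 2))) ε x S hSm hε hε1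
      (fun y => ⟨hpm.le.trans (hb _ _).1, (hb _ _).2⟩)
      (fun y => le_min (le_max_right _ _) (by positivity)) (fun y _ => min_le_right _ _)
      (fun y hy => by
        have := hy.1
        rw [mem_compl_iff, mem_ball, not_lt, dist_comm, dist_eq_norm] at this
        exact this))
    refine lintegral_mono_ae ?_
    filter_upwards [ae_restrict_of_ae hgrow, ae_restrict_mem hSm] with y hy hyS
    apply ENNReal.ofReal_le_ofReal
    have hxy : ‖x - y‖ < r := by
      have := hyS.2
      rwa [mem_ball, dist_comm, dist_eq_norm] at this
    have hx1 : ‖x‖ < 1 := mem_ball_zero_iff.1 hx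
    have hy1 : ‖y‖ ≤ ‖x‖ + ‖x - y‖ := by
      have := norm_sub_norm_le y x
      rw [norm_sub_rev] at this
      linarith
    have hy2 := hy (by rw [mul_div_assoc, ← hr]; linarith)
    have hmin : max (U y) 0 ≤ 8 * (1 + ‖x - y‖) ^ (s / 2) := by
      refine max_le (hy2.trans ?_) (by positivity)
      calc 4 * (1 + ‖y‖) ^ (s / 2) ≤ 4 * (2 * (1 + ‖x - y‖)) ^ (s / 2) := by
            gcongr
            linarith [norm_nonneg (x - y)]
        _ = 4 * (2 ^ (s / 2) * (1 + ‖x - y‖) ^ (s / 2)) := by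
            rw [Real.mul_rpow two_pos.le (by positivity)]
        _ ≤ 4 * (2 ^ (1 : ℝ) * (1 + ‖x - y‖) ^ (s / 2)) := by
            gcongr
            · norm_num
            · linarith [hs.2]
        _ = _ := by rw [Real.rpow_one]; ring
    rw [min_eq_left hmin]
    refine mul_le_mul_of_nonneg_left ?_ (Real.rpow_nonneg (le_max_right _ _) _)
    refine mul_le_of_le_one_left (rker_nonneg _ _ _) (Real.rpow_le_one_of_one_le_of_nonpos ha ?_)
    exact sub_nonpos.2 ((hdiag _ (hz (ball_subset_closedBall hXR)) _).trans (hQ _ hXR))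
  calc (∫⁻ y in (ball x ε)ᶜ, g y) ≤ ∫⁻ y in S ∪ (ball x r)ᶜ, g y := by
        refine lintegral_mono_set fun y hy => ?_
        by_cases h' : y ∈ ball x r
        · exact Or.inl ⟨hy, h'⟩
        · exact Or.inr h'
    _ ≤ (∫⁻ y in S, g y) + ∫⁻ y in (ball x r)ᶜ, g y := lintegral_union_le _ _ _
    _ ≤ ENNReal.ofReal (T₁ * ε ^ (-N)) + ENNReal.ofReal 1 :=
        add_le_add hnear (hfarb.trans (ENNReal.ofReal_le_ofReal hsmall))
    _ ≤ _ := by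
        rw [← ENNReal.ofReal_add (by positivity) zero_le_one]
        apply ENNReal.ofReal_le_ofReal
        linarith

end Tail

section LocalBoundedness
variable {n : ℕ} {s pm gM : ℝ} {p : Rn n → Rn n → ℝ} {Ω : Set (Rn n)} {u : Rn n → ℝ}

lemma volume_preimage_dilation (z : Rn n) {R : ℝ} (hR : 0 < R) (S : Set (Rn n)) :
    volume ((fun x : Rn n => z + R • x) ⁻¹' S) = ENNReal.ofReal (R ^ (-(n : ℝ))) * volume S := by
  have h1 : (fun x : Rn n => z + R • x) ⁻¹' S = (fun x => R • x) ⁻¹' ((fun y => z + y) ⁻¹' S) := rfl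
  rw [h1, Measure.addHaar_preimage_smul _ hR.ne', measure_preimage_add, finrank_euclideanSpace_fin,
    Real.rpow_neg hR.le, Real.rpow_natCast, abs_of_pos (by positivity)]

lemma ae_dilation_iff {P : Rn n → Prop} (z : Rn n) {R : ℝ} (hR : 0 < R) :
    (∀ᵐ x : Rn n, P (z + R • x)) ↔ ∀ᵐ y, P y := by
  rw [ae_iff, ae_iff]
  have h := volume_preimage_dilation z hR {y | ¬P y}
  have hR' : ENNReal.ofReal (R ^ (-(n : ℝ))) ≠ 0 := by
    rw [Ne, ENNReal.ofReal_eq_zero, not_le]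
    exact Real.rpow_pos_of_pos hR _
  change volume ((fun x : Rn n => z + R • x) ⁻¹' {y | ¬P y}) = 0 ↔ _
  rw [h, mul_eq_zero, or_iff_right hR']

/-- Bounds for a rescaled function translate back to the original function. -/
lemma ae_le_of_rescaledFun_ae_le {z : Rn n} {R k₀ h r c : ℝ} (hR : 0 < R) (hh : 0 < h)
    (H : ∀ᵐ x, x ∈ ball (0 : Rn n) r → rescaledFun z R k₀ h u x ≤ c) :
    ∀ᵐ y, y ∈ ball z (R * r) → u y ≤ k₀ + h * c := by
  rw [← ae_dilation_iff z hR]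
  filter_upwards [H] with x hx hx'
  have := hx ((add_smul_mem_ball_iff hR).1 hx')
  unfold rescaledFun at this
  rw [div_le_iff₀ hh] at this
  linarith

lemma levelEnergy_rescaled_le {z : Rn n} {R h : ℝ} (hR : 0 < R) (hh : 1 ≤ h)
    (hpd : Measurable fun x : Rn n => p x x) (hum : Measurable u) (hpm : 0 < pm)
    (hp : ∀ x ∈ ball z R, pm ≤ p x x) :
    levelEnergy (rescaledExp z R p) (rescaledFun z R 0 h u) (1 / 2) (1 / 2) ≤
      ENNReal.ofReal (h ^ (-pm) * R ^ (-(n : ℝ))) * ∫⁻ x, ENNReal.ofReal (|u x| ^ p x x) := by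
  have hh0 : 0 < h := by linarith
  have hG : Measurable fun x => ENNReal.ofReal (|u x| ^ p x x) :=
    ((continuous_abs.measurable.comp hum).pow hpd).ennreal_ofReal
  rw [ENNReal.ofReal_mul (by positivity), mul_assoc, ← lintegral_comp_dilation hG z hR,
    ← lintegral_const_mul' _ _ ENNReal.ofReal_ne_top]
  refine le_trans (setLIntegral_mono' measurableSet_ball fun x hx => ?_)
    (setLIntegral_le_lintegral _ _)
  rw [← ENNReal.ofReal_mul (by positivity)]
  apply ENNReal.ofReal_le_ofReal
  have hx' : z + R • x ∈ ball z R := by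
    simpa only [mul_one] using
      (add_smul_mem_ball_iff (z := z) hR).2 (ball_subset_ball (by norm_num : (1 / 2 : ℝ) ≤ 1) hx)
  have hq := hp _ hx'
  unfold rescaledExp rescaledFun
  set X := z + R • x
  have h1 : max ((u X - 0) / h - 1 / 2) 0 ≤ |u X| / h := by
    refine max_le ?_ (by positivity)
    have : (u X - 0) / h ≤ |u X| / h := by
      gcongr
      linarith [le_abs_self (u X)]
    linarith
  calc max ((u X - 0) / h - 1 / 2) 0 ^ p X X ≤ (|u X| / h) ^ p X X :=
        Real.rpow_le_rpow (le_max_right _ _) h1 (hpm.le.trans hq)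
    _ = h ^ (-p X X) * |u X| ^ p X X := by
        rw [Real.div_rpow (abs_nonneg _) hh0.le, Real.rpow_neg hh0.le, div_eq_inv_mul]
    _ ≤ h ^ (-pm) * |u X| ^ p X X := by
        gcongr

/-- Subsolutions are locally bounded from above. -/
theorem IsWeakSubsol.exists_ae_le (hn : 1 ≤ n) (hs : s ∈ Ioo (0 : ℝ) 1) (hp : ExponentOK p)
    (hsub : IsWeakSubsol s p Ω u) (hu : MemW s p u) (hdiag : ∀ x ∈ Ω, ∀ y, p x y ≤ p x x)
    (hΩ : Bornology.IsBounded Ω)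
    (htail : ∃ M : ℝ, ∀ x ∈ Ω,
      (∫⁻ y, ENNReal.ofReal (|u y| ^ (p x y - 1) / (1 + ‖y‖ ^ ((n : ℝ) + s * p x y))))
        ≤ ENNReal.ofReal M)
    {z : Rn n} {R q Q : ℝ} (hR : 0 < R) (hR1 : R ≤ 1) (hz : closedBall z R ⊆ Ω) (hq1 : 1 < q)
    (hq : ∀ x ∈ ball z R, ∀ y ∈ ball z R, q ≤ p x y ∧ p x y ≤ Q)
    (hβ : Q < q * (1 + s * q / n)) :
    ∃ M, ∀ᵐ x, x ∈ ball z (R * (1 / 4)) → u x ≤ M := by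
  obtain ⟨hc, hsymm, pm, gM, hpm, hb⟩ := id hp
  have hs0 := hs.1
  have hn0 : (0 : ℝ) < n := by exact_mod_cast hn
  have hpme : Measurable (fun w : Rn n × Rn n => p w.1 w.2) := hc.measurable
  have hzz := hq z (mem_ball_self hR) z (mem_ball_self hR)
  have hqQ : q ≤ Q := hzz.1.trans hzz.2
  obtain ⟨C₀, hC₀, hfar⟩ := exists_far_tail hn hs hpm hb hpme hΩ htail le_rfl
  have hgM : 1 < gM := by linarith [(hb 0 0).1, (hb 0 0).2]
  set N := (n : ℝ) + max gM Q with hN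
  have hfar' : ∀ x ∈ Ω, ∀ ρ, 0 < ρ → ρ ≤ 1 → (∫⁻ y in (ball x ρ)ᶜ,
      ENNReal.ofReal ((|u y| + 0) ^ (p x y - 1) * rker s (p x y) (x - y))) ≤
        ENNReal.ofReal (C₀ * ρ ^ (-N)) := fun x hx ρ hρ hρ1 => by
    refine (hfar x hx ρ hρ hρ1).trans (ENNReal.ofReal_le_ofReal ?_)
    refine mul_le_mul_of_nonneg_left (Real.rpow_le_rpow_of_exponent_ge hρ hρ1 ?_) hC₀.le
    linarith [le_max_left gM Q]
  obtain ⟨m, hm⟩ := exists_nat_ge Q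
  set T := R ^ s * (C₀ * R ^ (-N)) with hT
  have hT0 : 0 ≤ T := by positivity
  obtain ⟨c, hc0, hDG⟩ := exists_deGiorgi (T := T) (N := N) hn hs hq1 hm hT0
    (by linarith [le_max_right gM Q]) hqQ hβ.le
  set β := s * q / n with hβd
  have hβ0 : 0 < β := by positivity
  have hδ : 0 < q - (Q - q) / β := by
    rw [sub_pos, div_lt_iff₀ hβ0]
    linarith
  set I := (∫⁻ x, ENNReal.ofReal (|u x| ^ p x x)).toReal with hI
  have hIe : (∫⁻ x, ENNReal.ofReal (|u x| ^ p x x)) = ENNReal.ofReal I :=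
    (ENNReal.ofReal_toReal hu.2.1.ne).symm
  have hI0 : 0 ≤ I := ENNReal.toReal_nonneg
  have hRs : 0 < R ^ s := Real.rpow_pos_of_pos hR s
  have hRs1 : R ^ s ≤ 1 := Real.rpow_le_one hR.le hR1 hs0.le
  set B := R ^ (-(n : ℝ)) * I / (c * (R ^ s) ^ ((Q - q) / β)) with hB
  obtain ⟨h, hhB, hh1⟩ := (((tendsto_rpow_atTop hδ).eventually_ge_atTop B).and
    (eventually_ge_atTop 1)).exists
  have hh0 : 0 < h := by linarith
  have ha : 1 ≤ h / R ^ s := by rw [le_div_iff₀ hRs]; linarith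
  have ha0 : 0 < h / R ^ s := by linarith
  have hU := hsub.unitSub hn hs hp hu hdiag hm (k₀ := 0) hR hz hh0 hq le_rfl le_rfl ha le_rfl
  have hTB : TailBound T N (rescaledExp z R p) (rescaledKer s (h / R ^ s) Q z R p)
      (rescaledFun z R 0 h u) := by
    intro ε hε hε1 x hx
    refine (rescaled_tail_le hpm (fun x y => (hb x y).1) hpme hu.1 hfar' hR hz hh0 (by simp)
      (hq1.le.trans hqQ) ha hx hε (by nlinarith)).trans (le_of_eq ?_)
    rw [hT, Real.mul_rpow hR.le hε.le]
    congr 1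
    ring
  refine ⟨0 + h * (3 / 4), ae_le_of_rescaledFun_ae_le hR hh0 (hDG _ _ _ _ (by positivity)
    (Real.rpow_le_one_of_one_le_of_nonpos ha (by linarith)) hU hTB ?_)⟩
  refine (levelEnergy_rescaled_le hR hh1 (measurable_on_diagonal hpme) hu.1 (by linarith)
    fun x hx => (hq x hx x hx).1).trans ?_
  rw [hIe, ← ENNReal.ofReal_mul (by positivity)]
  apply ENNReal.ofReal_le_ofReal
  rw [hB, div_le_iff₀ (by positivity)] at hhB
  have e1 : ((h / R ^ s) ^ (q - Q)) ^ (1 / β) = (R ^ s) ^ ((Q - q) / β) * h ^ (-((Q - q) / β)) := by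
    rw [← Real.rpow_mul ha0.le, show (q - Q) * (1 / β) = -((Q - q) / β) by ring,
      Real.div_rpow hh0.le hRs.le, Real.rpow_neg hRs.le, div_inv_eq_mul, mul_comm]
  rw [e1]
  calc h ^ (-q) * R ^ (-(n : ℝ)) * I = h ^ (-q) * (R ^ (-(n : ℝ)) * I) := by ring
    _ ≤ h ^ (-q) * (h ^ (q - (Q - q) / β) * (c * (R ^ s) ^ ((Q - q) / β))) := by gcongr
    _ = (h ^ (-q) * h ^ (q - (Q - q) / β)) * (c * (R ^ s) ^ ((Q - q) / β)) := by ring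
    _ = _ := by
        rw [← Real.rpow_add hh0, show -q + (q - (Q - q) / β) = -((Q - q) / β) by ring]
        ring

lemma MemW.neg (hu : MemW s p u) : MemW s p (fun x => -u x) := by
  obtain ⟨h1, h2, h3⟩ := hu
  refine ⟨h1.neg, by simpa only [abs_neg] using h2, ?_⟩
  simpa only [neg_sub_neg, abs_sub_comm] using h3

lemma IsWeakSupersol.neg (hu : IsWeakSupersol s p Ω u) : IsWeakSubsol s p Ω (fun x => -u x) := by
  intro φ hφ hφ0 hφΩ
  have h := hu φ hφ hφ0 hφΩ
  rw [← neg_nonpos, ← integral_neg] at h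
  refine le_trans (le_of_eq ?_) h
  refine integral_congr_ae (Eventually.of_forall fun x => ?_)
  change (∫ y, _) = -∫ y, _
  rw [← integral_neg]
  refine integral_congr_ae (Eventually.of_forall fun y => ?_)
  change |-u x - -u y| ^ (p x y - 2) * (-u x - -u y) * (φ x - φ y) / _ = -(_ / _)
  rw [neg_sub_neg, abs_sub_comm]
  ring

end LocalBoundedness

section Oscillation
variable {n : ℕ} {s : ℝ} {p : Rn n → Rn n → ℝ} {Ω : Set (Rn n)} {u : Rn n → ℝ}

lemma exists_dyadic_growth (hs : s ∈ Ioo (0 : ℝ) 1) {t : ℝ} (ht : 0 ≤ t) (j : ℕ) :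
    ∃ i ≤ j, (t < 4 ^ i ∨ i = j) ∧ ((4 : ℝ) ^ (s / 2)) ^ i ≤ 4 * (1 + t) ^ (s / 2) := by
  have hs0 := hs.1
  have h1 : 1 ≤ (1 + t) ^ (s / 2) := Real.one_le_rpow (by linarith) (by linarith)
  induction j with
  | zero => exact ⟨0, le_rfl, Or.inr rfl, by rw [pow_zero]; linarith⟩
  | succ j ih =>
    obtain ⟨i, hij, h, hi⟩ := ih
    rcases lt_or_ge t (4 ^ i) with hlt | hge
    · exact ⟨i, by omega, Or.inl hlt, hi⟩
    · obtain rfl : i = j := h.resolve_left (not_lt.2 hge)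
      refine ⟨i + 1, le_rfl, Or.inr rfl, ?_⟩
      have h2 : ((4 : ℝ) ^ (s / 2)) ^ i ≤ (1 + t) ^ (s / 2) := by
        rw [← Real.rpow_mul_natCast (by norm_num), mul_comm, Real.rpow_mul (by norm_num),
          Real.rpow_natCast]
        exact Real.rpow_le_rpow (by positivity) (by linarith) (by linarith)
      have h3 : (4 : ℝ) ^ (s / 2) ≤ 4 ^ (1 : ℝ) :=
        Real.rpow_le_rpow_of_exponent_le (by norm_num) (by linarith [hs.2])
      rw [Real.rpow_one] at h3
      rw [pow_succ, mul_comm]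
      gcongr

lemma pow_sub_one_le_mul_pow_sub_one {g τ b : ℝ} (hτ : 0 < τ) (hτ1 : τ ≤ 1) (hb : 1 ≤ b)
    (hg1 : 1 ≤ g) (hg : g ≤ 1 + τ * (b - 1)) (i : ℕ) : g ^ i - 1 ≤ τ * (b ^ i - 1) := by
  induction i with
  | zero => simp
  | succ i ih =>
    have hgb : g ≤ b := by nlinarith
    have hbi : 1 ≤ b ^ i := one_le_pow₀ hb
    calc g ^ (i + 1) - 1 = g * (g ^ i - 1) + (g - 1) := by ring
      _ ≤ g * (τ * (b ^ i - 1)) + (g - 1) := by gcongr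
      _ ≤ b * (τ * (b ^ i - 1)) + τ * (b - 1) := by
          have : 0 ≤ τ * (b ^ i - 1) := mul_nonneg hτ.le (by linarith)
          have := mul_le_mul_of_nonneg_right hgb this
          linarith
      _ = _ := by ring

/-- The decay rate of the oscillation. -/
lemma exists_decay_rate (hs : s ∈ Ioo (0 : ℝ) 1) {τ : ℝ} (hτ : 0 < τ) (hτ1 : τ ≤ 1) :
    ∃ γ ∈ Ioo (0 : ℝ) 1, 1 - τ / 4 ≤ γ ∧ (1 / 4 : ℝ) ^ s ≤ γ ∧
      ∀ i : ℕ, γ⁻¹ ^ i - 1 ≤ τ * (((4 : ℝ) ^ (s / 2)) ^ i - 1) := by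
  have hs0 := hs.1
  set b : ℝ := 4 ^ (s / 2) with hb
  have hb1 : 1 < b := Real.one_lt_rpow (by norm_num) (by linarith)
  have hd : 1 < 1 + τ * (b - 1) := by
    have := mul_pos hτ (sub_pos.2 hb1)
    linarith
  have hdb : 1 + τ * (b - 1) ≤ b := by nlinarith
  set γ := max (1 - τ / 4) (1 + τ * (b - 1))⁻¹ with hγ
  have hγ1 : γ < 1 := max_lt (by linarith) (inv_lt_one_of_one_lt₀ hd)
  have hγ0 : 0 < γ := lt_max_of_lt_right (by positivity)
  refine ⟨γ, ⟨hγ0, hγ1⟩, le_max_left _ _, ?_, fun i => ?_⟩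
  · calc (1 / 4 : ℝ) ^ s = (b * b)⁻¹ := by
          rw [hb, ← Real.rpow_add (by norm_num), add_halves, ← Real.inv_rpow (by norm_num)]
          norm_num
      _ ≤ (1 + τ * (b - 1))⁻¹ := by
          apply inv_anti₀ (by linarith)
          nlinarith
      _ ≤ γ := le_max_right _ _
  · refine pow_sub_one_le_mul_pow_sub_one hτ hτ1 hb1.le ((one_le_inv₀ hγ0).2 hγ1.le) ?_ i
    exact inv_le_of_inv_le₀ (by linarith) (le_max_right _ _)

/-- Condition (P1) yields uniform ellipticity of the rescaled kernels. -/
lemma CondP1.exists_exponent_bounds {L : ℝ} (hs : s ∈ Ioo (0 : ℝ) 1) (hP1 : CondP1 p Ω L) {z : Rn n}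
    {R q Q : ℝ} (hR : 0 < R) (hz : closedBall z R ⊆ Ω)
    (hq : ∀ x ∈ ball z R, ∀ y ∈ ball z R, q ≤ p x y ∧ p x y ≤ Q) :
    ∃ q' Q', q ≤ q' ∧ Q' ≤ Q ∧ (∀ x ∈ ball z R, ∀ y ∈ ball z R, q' ≤ p x y ∧ p x y ≤ Q') ∧
      ∀ h, 1 ≤ h / R ^ s → h * R ^ s ≤ 1 → max L 1 ^ (-(2 * s)) ≤ (h / R ^ s) ^ (q' - Q') := by
  have hs0 := hs.1
  have hzz : p z z ∈ image2 p (ball z R) (ball z R) :=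
    ⟨z, mem_ball_self hR, z, mem_ball_self hR, rfl⟩
  have hbb : BddBelow (image2 p (ball z R) (ball z R)) :=
    ⟨q, by rintro _ ⟨a, ha, b, hb, rfl⟩; exact (hq a ha b hb).1⟩
  have hba : BddAbove (image2 p (ball z R) (ball z R)) :=
    ⟨Q, by rintro _ ⟨a, ha, b, hb, rfl⟩; exact (hq a ha b hb).2⟩
  refine ⟨pInf p (ball z R) (ball z R), pSup p (ball z R) (ball z R),
    le_csInf ⟨_, hzz⟩ (by rintro _ ⟨a, ha, b, hb, rfl⟩; exact (hq a ha b hb).1),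
    csSup_le ⟨_, hzz⟩ (by rintro _ ⟨a, ha, b, hb, rfl⟩; exact (hq a ha b hb).2),
    fun x hx y hy => ⟨csInf_le hbb ⟨x, hx, y, hy, rfl⟩, le_csSup hba ⟨x, hx, y, hy, rfl⟩⟩, ?_⟩
  intro h h1 h2
  have hL := hP1 z R hR hz
  set q' := pInf p (ball z R) (ball z R)
  set Q' := pSup p (ball z R) (ball z R)
  have hqQ : q' ≤ Q' := (csInf_le hbb hzz).trans (le_csSup hba hzz)
  have hRs : 0 < R ^ s := Real.rpow_pos_of_pos hR s
  have hle : h / R ^ s ≤ R ^ (-(2 * s)) := by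
    rw [div_le_iff₀ hRs, ← Real.rpow_add hR, show -(2 * s) + s = -s by ring, Real.rpow_neg hR.le,
      ← one_div, le_div_iff₀ hRs]
    exact h2
  calc max L 1 ^ (-(2 * s)) ≤ (R ^ (q' - Q')) ^ (-(2 * s)) :=
        Real.rpow_le_rpow_of_nonpos (Real.rpow_pos_of_pos hR _) (hL.trans (le_max_left _ _))
          (by linarith)
    _ = (R ^ (-(2 * s))) ^ (q' - Q') := by
        rw [← Real.rpow_mul hR.le, ← Real.rpow_mul hR.le, mul_comm]
    _ ≤ _ := Real.rpow_le_rpow_of_nonpos (by linarith) hle (by linarith)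

lemma volume_le_two_mul_of_rescaledFun {z : Rn n} {R k₀ h H l r : ℝ} (hR : 0 < R) (hh : 0 < h)
    (hl : l ≤ k₀ - H * h) (hvol : volume (ball z (R * r)) ≤
      2 * volume (ball z (R * r) ∩ {y | u y ≤ l})) :
    volume (ball (0 : Rn n) r) ≤
      2 * volume (ball (0 : Rn n) r ∩ {x | rescaledFun z R k₀ h u x ≤ -H}) := by
  have e1 : (fun x : Rn n => z + R • x) ⁻¹' ball z (R * r) = ball 0 r :=
    Set.ext fun x => add_smul_mem_ball_iff (z := z) (r := r) (x := x) hR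
  have e2 : (fun x : Rn n => z + R • x) ⁻¹' (ball z (R * r) ∩ {y | u y ≤ l}) ⊆
      ball 0 r ∩ {x | rescaledFun z R k₀ h u x ≤ -H} := by
    rw [preimage_inter, e1]
    refine inter_subset_inter_right _ fun x hx => ?_
    change (u (z + R • x) - k₀) / h ≤ -H
    change u (z + R • x) ≤ l at hx
    rw [div_le_iff₀ hh]
    linarith
  calc volume (ball (0 : Rn n) r)
      = ENNReal.ofReal (R ^ (-(n : ℝ))) * volume (ball z (R * r)) := by
        rw [← volume_preimage_dilation z hR, e1]
    _ ≤ ENNReal.ofReal (R ^ (-(n : ℝ))) * (2 * volume (ball z (R * r) ∩ {y | u y ≤ l})) :=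
        mul_le_mul_right hvol _
    _ = 2 * volume ((fun x : Rn n => z + R • x) ⁻¹' (ball z (R * r) ∩ {y | u y ≤ l})) := by
        rw [volume_preimage_dilation z hR]
        ring
    _ ≤ _ := mul_le_mul_right (measure_mono e2) _

/-- One-sided bounds for `u` on dyadic balls about `z`, with oscillation decaying like `γ ^ j`, pass to
the next ball if `u` lies in the lower half of its range on at least half of the ball. -/
def ImprovesBounds (z : Rn n) (ϱ M₀ γ R₀ : ℝ) (u : Rn n → ℝ) : Prop :=
  ∀ (j : ℕ) (k : ℝ), -M₀ ≤ k → k + 2 * M₀ * γ ^ j ≤ M₀ →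
    (∀ᵐ y, y ∈ ball z (2 * ϱ) → u y ≤ k + 2 * M₀) →
    (∀ i ≤ j, ∀ᵐ y, y ∈ ball z (R₀ * (1 / 4) ^ i) → u y ≤ k + 2 * M₀ * γ ^ i) →
    volume (ball z (R₀ * (1 / 4) ^ j * (1 / 2))) ≤
      2 * volume (ball z (R₀ * (1 / 4) ^ j * (1 / 2)) ∩ {y | u y ≤ k + M₀ * γ ^ j}) →
    ∀ᵐ y, y ∈ ball z (R₀ * (1 / 4) ^ (j + 1)) → u y ≤ k + 2 * M₀ * γ ^ (j + 1)

set_option maxHeartbeats 1000000 in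
/-- One step of the oscillation iteration for subsolutions. -/
theorem exists_oscillation_step {pm gM L : ℝ} (hn : 1 ≤ n) (hs : s ∈ Ioo (0 : ℝ) 1)
    (hp : ExponentOK p) (hpm : 1 < pm) (hb : ∀ x y, pm ≤ p x y ∧ p x y ≤ gM)
    (hdiag : ∀ x ∈ Ω, ∀ y, p x y ≤ p x x) (hP1 : CondP1 p Ω L) {x₀ : Rn n} {ϱ q Q M₀ C₀ : ℝ}
    (hϱ : 0 < ϱ) (hϱ1 : ϱ ≤ 1) (hx₀ : closedBall x₀ (3 * ϱ) ⊆ Ω) (hq1 : 1 < q)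
    (hq : ∀ x ∈ ball x₀ (3 * ϱ), ∀ y ∈ ball x₀ (3 * ϱ), q ≤ p x y ∧ p x y ≤ Q) (hQ : Q ≤ gM)
    (hβ : Q ≤ q * (1 + s * q / n)) (hM₀ : 0 < M₀) (hC₀ : 0 < C₀) :
    ∃ γ ∈ Ioo (0 : ℝ) 1, ∃ R₀ > 0, R₀ ≤ ϱ ∧ ∀ u : Rn n → ℝ, IsWeakSubsol s p Ω u → MemW s p u →
      (∀ x ∈ Ω, ∀ ρ, 0 < ρ → ρ ≤ 1 → (∫⁻ y in (ball x ρ)ᶜ,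
        ENNReal.ofReal ((|u y| + M₀) ^ (p x y - 1) * rker s (p x y) (x - y))) ≤
          ENNReal.ofReal (C₀ * ρ ^ (-((n : ℝ) + gM)))) →
      ∀ z ∈ ball x₀ ϱ, ImprovesBounds z ϱ M₀ γ R₀ u := by
  have hs0 := hs.1
  have hpme : Measurable (fun w : Rn n × Rn n => p w.1 w.2) := hp.1.measurable
  have hgM : 1 < gM := by linarith [(hb 0 0).1, (hb 0 0).2]
  set N := (n : ℝ) + gM with hN
  have hx₀m : x₀ ∈ ball x₀ (3 * ϱ) := mem_ball_self (by positivity)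
  have hqQ : q ≤ Q := (hq x₀ hx₀m x₀ hx₀m).1.trans (hq x₀ hx₀m x₀ hx₀m).2
  obtain ⟨T₁, hT₁0, hT₁⟩ := lintegral_growth_tail (n := n) (A := 8) hs hgM.le (by norm_num)
  obtain ⟨m, hm⟩ := exists_nat_ge Q
  obtain ⟨H, hH1, hH⟩ := exists_growth (T := T₁ + 1) (N := N) (lam := max L 1 ^ (-(2 * s))) hn hs hq1
    hm (by positivity) (by rw [hN]; linarith [(Nat.cast_nonneg n : (0 : ℝ) ≤ n)]) hqQ hβ
    (by positivity) (Real.rpow_le_one_of_one_le_of_nonpos (le_max_right _ _) (by linarith))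
  set τ := (2 * (H + 1))⁻¹ with hτ
  have hτ0 : 0 < τ := by positivity
  have hτH : τ * (H + 1) = 1 / 2 := by rw [hτ]; field_simp
  have hτ1 : τ ≤ 1 := by nlinarith
  obtain ⟨γ, ⟨hγ0, hγ1⟩, hγτ, hγs, hγb⟩ := exists_decay_rate hs hτ0 hτ1
  have hP : 0 < C₀ * ϱ ^ (-N) := by positivity
  set δ := min (2 * M₀ * τ) (min (C₀ * ϱ ^ (-N))⁻¹ (2 * M₀ * τ)⁻¹) with hδ
  have hδ0 : 0 < δ := by positivity
  set R₀ := min ϱ (δ ^ (1 / s)) with hR₀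
  have hR₀0 : 0 < R₀ := by positivity
  have hR₀s : R₀ ^ s ≤ δ := by
    calc R₀ ^ s ≤ (δ ^ (1 / s)) ^ s := Real.rpow_le_rpow hR₀0.le (min_le_right _ _) hs0.le
      _ = δ := by rw [← Real.rpow_mul hδ0.le, one_div_mul_cancel hs0.ne', Real.rpow_one]
  have hR₀1 : R₀ ^ s ≤ 2 * M₀ * τ := hR₀s.trans (min_le_left _ _)
  have hR₀2 : R₀ ^ s * (C₀ * ϱ ^ (-N)) ≤ 1 := by
    rw [← le_div_iff₀ hP, one_div]
    exact hR₀s.trans ((min_le_right _ _).trans (min_le_left _ _))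
  have hR₀3 : R₀ ^ s * (2 * M₀ * τ) ≤ 1 := by
    rw [← le_div_iff₀ (by positivity), one_div]
    exact hR₀s.trans ((min_le_right _ _).trans (min_le_right _ _))
  refine ⟨γ, ⟨hγ0, hγ1⟩, R₀, hR₀0, min_le_left _ _, ?_⟩
  intro u hsub hu hfar z hz j k hk1 hk2 hout hin hvol
  set R := R₀ * (1 / 4) ^ j with hR
  have hR0 : 0 < R := by positivity
  have hRR₀ : R ≤ R₀ := mul_le_of_le_one_right hR₀0.le (pow_le_one₀ (by norm_num) (by norm_num))
  have hRϱ : R ≤ ϱ := hRR₀.trans (min_le_left _ _)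
  have hzd : dist z x₀ < ϱ := hz
  have hzΩ : closedBall z R ⊆ Ω := (closedBall_subset_closedBall' (by linarith)).trans hx₀
  have hz3 : ball z R ⊆ ball x₀ (3 * ϱ) := ball_subset_ball' (by linarith)
  have hγj : 0 < γ ^ j := by positivity
  have hγj1 : γ ^ j ≤ 1 := pow_le_one₀ hγ0.le hγ1.le
  have hRs : 0 < R ^ s := Real.rpow_pos_of_pos hR0 s
  have hRs₀ : R ^ s ≤ R₀ ^ s := Real.rpow_le_rpow hR0.le hRR₀ hs0.le
  set h := 2 * M₀ * τ * γ ^ j with hh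
  have hh0 : 0 < h := by positivity
  have ha : 1 ≤ h / R ^ s := by
    rw [le_div_iff₀ hRs, one_mul, hR, Real.mul_rpow hR₀0.le (by positivity),
      ← Real.rpow_natCast (1 / 4 : ℝ), ← Real.rpow_mul (by norm_num), mul_comm (j : ℝ),
      Real.rpow_mul (by norm_num), Real.rpow_natCast]
    exact mul_le_mul hR₀1 (pow_le_pow_left₀ (by positivity) hγs j) (by positivity) (by positivity)
  have hhR : h * R ^ s ≤ 1 := by
    have h1 : h ≤ 2 * M₀ * τ := mul_le_of_le_one_right (by positivity) hγj1
    calc h * R ^ s ≤ 2 * M₀ * τ * R₀ ^ s := by gcongr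
      _ ≤ 1 := by linarith
  obtain ⟨q', Q', hqq', hQQ', hq', hell⟩ := hP1.exists_exponent_bounds hs hR0 hzΩ
    (fun x hx y hy => hq x (hz3 hx) y (hz3 hy))
  set k₀ := k + 2 * M₀ * γ ^ j - h with hk₀
  have hhω : h ≤ 2 * M₀ * γ ^ j := by
    rw [hh, mul_right_comm]
    exact mul_le_of_le_one_right (by positivity) hτ1
  have hk₀M : |k₀| ≤ M₀ := abs_le.2 ⟨by rw [hk₀]; linarith, by rw [hk₀]; linarith⟩
  have hU := hsub.unitSub hn hs hp hu hdiag hm (k₀ := k₀) hR0 hzΩ hh0 hq' hqq' hQQ' ha (hell h ha hhR)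
  have hbound : ∀ i ≤ j, ∀ x, u (z + R • x) ≤ k + 2 * M₀ * γ ^ (j - i) →
      rescaledFun z R k₀ h u x ≤ ((4 : ℝ) ^ (s / 2)) ^ i := by
    intro i hi x hx
    unfold rescaledFun
    rw [div_le_iff₀ hh0]
    have h1 := hγb i
    have h2 : γ ^ (j - i) = γ ^ j * γ⁻¹ ^ i := by
      rw [pow_sub₀ γ hγ0.ne' hi, inv_pow]
    rw [h2] at hx
    have h3 : 2 * M₀ * γ ^ j * (γ⁻¹ ^ i - 1) ≤
        2 * M₀ * γ ^ j * (τ * (((4 : ℝ) ^ (s / 2)) ^ i - 1)) := by gcongr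
    have h4 : ((4 : ℝ) ^ (s / 2)) ^ i * h - h =
        2 * M₀ * γ ^ j * (τ * (((4 : ℝ) ^ (s / 2)) ^ i - 1)) := by rw [hh]; ring
    rw [hk₀]
    linarith
  have hgrow : ∀ᵐ y : Rn n, ‖y‖ < 2 * ϱ / R → rescaledFun z R k₀ h u y ≤ 4 * (1 + ‖y‖) ^ (s / 2) := by
    have hin' : ∀ᵐ y, ∀ i ≤ j, y ∈ ball z (R₀ * (1 / 4) ^ i) → u y ≤ k + 2 * M₀ * γ ^ i :=
      ae_all_iff.2 fun i => by
        by_cases hi : i ≤ j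
        · filter_upwards [hin i hi] with y hy _ using hy
        · exact Eventually.of_forall fun y h => absurd h hi
    filter_upwards [(ae_dilation_iff z hR0).2 hin', (ae_dilation_iff z hR0).2 hout] with y h1 h2 hy
    obtain ⟨i, hij, hor, hi⟩ := exists_dyadic_growth hs (norm_nonneg y) j
    refine (hbound i hij y ?_).trans hi
    rcases hor with hlt | rfl
    · refine h1 (j - i) (Nat.sub_le _ _) ?_
      have h3 : R₀ * (1 / 4) ^ (j - i) = R * 4 ^ i := by
        rw [hR, pow_sub₀ _ (by norm_num) hij, one_div, inv_pow, inv_pow, inv_inv]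
        ring
      rw [h3]
      exact (add_smul_mem_ball_iff hR0).2 (mem_ball_zero_iff.2 hlt)
    · rw [Nat.sub_self, pow_zero, mul_one]
      refine h2 ?_
      have h3 : 2 * ϱ = R * (2 * ϱ / R) := by field_simp
      rw [h3]
      exact (add_smul_mem_ball_iff hR0).2 (mem_ball_zero_iff.2 hy)
  have hTB := rescaled_tailBound hs hpm hb hpme hu.1 hdiag hfar hT₁0 hT₁ hR0 hzΩ hh0 hk₀M
    (fun x hx => (hq' x hx x hx).2) ha hRϱ hϱ1
    ((mul_le_mul_of_nonneg_right hRs₀ hP.le).trans hR₀2) hgrow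
  have h1 : ∀ᵐ x, x ∈ ball (0 : Rn n) 1 → rescaledFun z R k₀ h u x ≤ 1 := by
    filter_upwards [(ae_dilation_iff z hR0).2 (hin j le_rfl)] with x hx hx'
    have := hbound 0 (Nat.zero_le j) x (hx (by
      simpa only [mul_one] using (add_smul_mem_ball_iff (z := z) hR0).2 hx'))
    simpa using this
  have hHh : (H + 1) * h = M₀ * γ ^ j := by
    calc (H + 1) * h = 2 * M₀ * γ ^ j * (τ * (H + 1)) := by rw [hh]; ring
      _ = M₀ * γ ^ j := by rw [hτH]; ring
  have hkH : k + M₀ * γ ^ j ≤ k₀ - H * h := by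
    rw [hk₀]
    linarith
  have hvol' := volume_le_two_mul_of_rescaledFun hR0 hh0 hkH hvol
  have hfin := ae_le_of_rescaledFun_ae_le hR0 hh0 (hH _ _ _ hU hTB h1 hvol')
  have e3 : R₀ * (1 / 4) ^ (j + 1) = R * (1 / 4) := by rw [hR, pow_succ]; ring
  rw [e3]
  filter_upwards [hfin] with y hy hy'
  refine (hy hy').trans ?_
  have h5 : 2 * M₀ * γ ^ j * (1 - τ / 4) ≤ 2 * M₀ * γ ^ j * γ := by gcongr
  have h6 : 2 * M₀ * γ ^ j * (1 - τ / 4) = 2 * M₀ * γ ^ j - h / 4 := by rw [hh]; ring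
  rw [hk₀, pow_succ]
  linarith

end Oscillation

section OscillationDecay
variable {n : ℕ} {u : Rn n → ℝ} {z : Rn n} {ϱ M₀ γ R₀ : ℝ}

lemma measure_le_two_mul_inter_or (A : Set (Rn n)) (u : Rn n → ℝ) (c : ℝ) :
    volume A ≤ 2 * volume (A ∩ {y | u y ≤ c}) ∨ volume A ≤ 2 * volume (A ∩ {y | -u y ≤ -c}) := by
  have h : volume A ≤ volume (A ∩ {y | u y ≤ c}) + volume (A ∩ {y | -u y ≤ -c}) := by
    refine (measure_mono fun y hy => ?_).trans (measure_union_le _ _)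
    rcases le_total (u y) c with h | h
    · exact Or.inl ⟨hy, h⟩
    · exact Or.inr ⟨hy, neg_le_neg h⟩
  rcases le_total (volume (A ∩ {y | u y ≤ c})) (volume (A ∩ {y | -u y ≤ -c})) with h' | h'
  · exact Or.inr (h.trans ((add_le_add_left h' _).trans (two_mul _).ge))
  · exact Or.inl (h.trans ((add_le_add_right h' _).trans (two_mul _).ge))

/-- If both `u` and `-u` improve their bounds, the oscillation of `u` decays geometrically. -/
lemma ImprovesBounds.exists_oscillation_le (hM₀ : 0 < M₀) (hγ : γ ∈ Ioo (0 : ℝ) 1) (hR₀ : 0 < R₀)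
    (hR₀ϱ : R₀ ≤ ϱ) (h₁ : ImprovesBounds z ϱ M₀ γ R₀ u)
    (h₂ : ImprovesBounds z ϱ M₀ γ R₀ (fun x => -u x))
    (hu : ∀ᵐ y, y ∈ ball z (2 * ϱ) → |u y| ≤ M₀) (j : ℕ) :
    ∃ k, ∀ᵐ y, y ∈ ball z (R₀ * (1 / 4) ^ j) → k ≤ u y ∧ u y ≤ k + 2 * M₀ * γ ^ j := by
  obtain ⟨hγ0, hγ1⟩ := hγ
  suffices H : ∃ k, -M₀ ≤ k ∧ k + 2 * M₀ * γ ^ j ≤ M₀ ∧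
      (∀ᵐ y, y ∈ ball z (2 * ϱ) → k - (2 * M₀ - 2 * M₀ * γ ^ j) ≤ u y ∧ u y ≤ k + 2 * M₀) ∧
      ∀ i ≤ j, ∀ᵐ y, y ∈ ball z (R₀ * (1 / 4) ^ i) →
        k - (2 * M₀ * γ ^ i - 2 * M₀ * γ ^ j) ≤ u y ∧ u y ≤ k + 2 * M₀ * γ ^ i by
    obtain ⟨k, -, -, -, h⟩ := H
    refine ⟨k, ?_⟩
    filter_upwards [h j le_rfl] with y hy hy'
    simpa using hy hy'
  induction j with
  | zero =>
    refine ⟨-M₀, le_rfl, by linarith [pow_zero γ], ?_, fun i hi => ?_⟩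
    · filter_upwards [hu] with y hy hy'
      have := abs_le.1 (hy hy')
      constructor <;> linarith [pow_zero γ]
    · obtain rfl : i = 0 := Nat.le_zero.1 hi
      filter_upwards [hu] with y hy hy'
      have := abs_le.1 (hy (ball_subset_ball (by linarith [pow_zero (1 / 4 : ℝ)]) hy'))
      constructor <;> linarith [pow_zero γ]
  | succ j ih =>
    obtain ⟨k, hk1, hk2, hout, hin⟩ := ih
    have hω : 2 * M₀ * γ ^ (j + 1) ≤ 2 * M₀ * γ ^ j := by
      have := pow_le_pow_of_le_one hγ0.le hγ1.le (Nat.le_succ j)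
      gcongr
    have hsub : ball z (R₀ * (1 / 4) ^ (j + 1)) ⊆ ball z (R₀ * (1 / 4) ^ j) := by
      refine ball_subset_ball (mul_le_mul_of_nonneg_left ?_ hR₀.le)
      exact pow_le_pow_of_le_one (by norm_num) (by norm_num) (Nat.le_succ j)
    rcases measure_le_two_mul_inter_or (ball z (R₀ * (1 / 4) ^ j * (1 / 2))) u
      (k + M₀ * γ ^ j) with hvol | hvol
    · have hnew := h₁ j k hk1 hk2 (by filter_upwards [hout] with y hy hy' using (hy hy').2)
        (fun i hi => by filter_upwards [hin i hi] with y hy hy' using (hy hy').2) hvol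
      refine ⟨k, hk1, by linarith, ?_, fun i hi => ?_⟩
      · filter_upwards [hout] with y hy hy'
        have := hy hy'
        constructor <;> linarith
      · rcases Nat.le_add_one_iff.1 hi with hi | rfl
        · filter_upwards [hin i hi] with y hy hy'
          have := hy hy'
          constructor <;> linarith
        · filter_upwards [hin j le_rfl, hnew] with y hy hy2 hy'
          have := hy (hsub hy')
          have := hy2 hy'
          constructor <;> linarith
    · have hnew := h₂ j (-k - 2 * M₀ * γ ^ j) (by linarith) (by linarith)
        (by filter_upwards [hout] with y hy hy'
            linarith [(hy hy').1])
        (fun i hi => by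
          filter_upwards [hin i hi] with y hy hy'
          linarith [(hy hy').1])
        (by rwa [show -k - 2 * M₀ * γ ^ j + M₀ * γ ^ j = -(k + M₀ * γ ^ j) by ring])
      refine ⟨k + 2 * M₀ * γ ^ j - 2 * M₀ * γ ^ (j + 1), by linarith, by linarith, ?_, fun i hi => ?_⟩
      · filter_upwards [hout] with y hy hy'
        have := hy hy'
        constructor <;> linarith
      · rcases Nat.le_add_one_iff.1 hi with hi | rfl
        · filter_upwards [hin i hi] with y hy hy'
          have := hy hy'
          constructor <;> linarith
        · filter_upwards [hin j le_rfl, hnew] with y hy hy2 hy'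
          have := hy (hsub hy')
          have := hy2 hy'
          constructor <;> linarith

/-- A family of oscillation bounds on dyadic balls yields a Hölder continuous representative. -/
theorem exists_holder_representative {x₀ : Rn n} {c : ℝ} (hc : 0 < c) (hγ : γ ∈ Ioo (0 : ℝ) 1)
    (hR₀ : 0 < R₀) (hR₀ϱ : R₀ ≤ ϱ)
    (H : ∀ z ∈ ball x₀ ϱ, ∀ j : ℕ, ∃ k, ∀ᵐ y, y ∈ ball z (R₀ * (1 / 4) ^ j) →
      k ≤ u y ∧ u y ≤ k + c * γ ^ j) :
    ∃ α ∈ Ioo (0 : ℝ) 1, ∃ C > 0, ∃ v : Rn n → ℝ, (∀ᵐ y, y ∈ ball x₀ (R₀ / 2) → u y = v y) ∧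
      ∀ x ∈ ball x₀ (R₀ / 2), ∀ y ∈ ball x₀ (R₀ / 2), |v x - v y| ≤ C * ‖x - y‖ ^ α := by
  obtain ⟨hγ0, hγ1⟩ := hγ
  choose! m hm using H
  set R : ℕ → ℝ := fun j => R₀ * (1 / 4) ^ j with hR
  have hR0 : ∀ j, 0 < R j := fun j => by positivity
  have hRanti : ∀ i j, i ≤ j → R j ≤ R i := fun i j hij =>
    mul_le_mul_of_nonneg_left (pow_le_pow_of_le_one (by norm_num) (by norm_num) hij) hR₀.le
  have hωanti : ∀ i j, i ≤ j → c * γ ^ j ≤ c * γ ^ i := fun i j hij =>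
    mul_le_mul_of_nonneg_left (pow_le_pow_of_le_one hγ0.le hγ1.le hij) hc.le
  have hover : ∀ z ∈ ball x₀ ϱ, ∀ z' ∈ ball x₀ ϱ, ∀ i j, i ≤ j → dist z z' < R i →
      |m z i - m z' j| ≤ c * γ ^ i := by
    intro z hz z' hz' i j hij hd
    have hop : IsOpen (ball z (R i) ∩ ball z' (R j)) := isOpen_ball.inter isOpen_ball
    have hne : (ball z (R i) ∩ ball z' (R j)).Nonempty :=
      ⟨z', by rwa [mem_ball, dist_comm], mem_ball_self (hR0 j)⟩
    have hpos := hop.measure_pos volume hne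
    obtain ⟨y, hy, h1, h2⟩ := ((frequently_ae_mem_iff.2 hpos.ne').and_eventually
      ((hm z hz i).and (hm z' hz' j))).exists
    have h1 := h1 hy.1
    have h2 := h2 hy.2
    have := hωanti i j hij
    rw [abs_le]
    constructor <;> linarith
  have hlim : Tendsto (fun j : ℕ => c * γ ^ j) atTop (𝓝 0) := by
    simpa using (tendsto_pow_atTop_nhds_zero_of_lt_one hγ0.le hγ1).const_mul c
  have hex : ∀ z ∈ ball x₀ ϱ, ∃ v, Tendsto (m z) atTop (𝓝 v) := fun z hz => by
    refine cauchySeq_tendsto_of_complete (cauchySeq_of_le_tendsto_0' _ (fun i j hij => ?_) hlim)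
    rw [Real.dist_eq]
    exact hover z hz z hz i j hij (by rw [dist_self]; exact hR0 i)
  choose! v hv using hex
  have hvm : ∀ z ∈ ball x₀ ϱ, ∀ i, |m z i - v z| ≤ c * γ ^ i := fun z hz i => by
    refine le_of_tendsto ((tendsto_const_nhds.sub (hv z hz)).abs) ?_
    filter_upwards [eventually_ge_atTop i] with j hij
    exact hover z hz z hz i j hij (by rw [dist_self]; exact hR0 i)
  have hvv : ∀ z ∈ ball x₀ ϱ, ∀ z' ∈ ball x₀ ϱ, ∀ j, dist z z' < R j →
      |v z - v z'| ≤ 3 * (c * γ ^ j) := fun z hz z' hz' j hd => by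
    have h1 := abs_le.1 (hvm z hz j)
    have h2 := abs_le.1 (hvm z' hz' j)
    have h3 := abs_le.1 (hover z hz z' hz' j j le_rfl hd)
    rw [abs_le]
    constructor <;> linarith
  have hsub : ball x₀ (R₀ / 2) ⊆ ball x₀ ϱ := ball_subset_ball (by linarith)
  obtain ⟨α, hα, hγα⟩ : ∃ α ∈ Ioo (0 : ℝ) 1, γ ≤ (1 / 4 : ℝ) ^ α := by
    have hlg : 0 < -Real.log γ / Real.log 4 := div_pos
      (neg_pos.2 (Real.log_neg hγ0 hγ1)) (Real.log_pos (by norm_num))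
    refine ⟨min (-Real.log γ / Real.log 4) (1 / 2), ⟨by positivity,
      (min_le_right _ _).trans_lt (by norm_num)⟩, ?_⟩
    calc γ = (1 / 4 : ℝ) ^ (-Real.log γ / Real.log 4) := by
          rw [Real.rpow_def_of_pos (by norm_num), one_div, Real.log_inv]
          have : Real.log 4 ≠ 0 := (Real.log_pos (by norm_num)).ne'
          rw [show -Real.log 4 * (-Real.log γ / Real.log 4) = Real.log γ by field_simp,
            Real.exp_log hγ0]
      _ ≤ _ := Real.rpow_le_rpow_of_exponent_ge (by norm_num) (by norm_num) (min_le_left _ _)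
  refine ⟨α, hα, 3 * c * (4 / R₀) ^ α, by positivity, v, ?_, fun x hx y hy => ?_⟩
  · obtain ⟨D, hDc, hDd⟩ := TopologicalSpace.exists_countable_dense (Rn n)
    have hae : ∀ᵐ y, ∀ d ∈ D, ∀ j, d ∈ ball x₀ ϱ → y ∈ ball d (R j) →
        m d j ≤ u y ∧ u y ≤ m d j + c * γ ^ j := by
      rw [ae_ball_iff hDc]
      refine fun d _ => ae_all_iff.2 fun j => ?_
      by_cases hd : d ∈ ball x₀ ϱ
      · filter_upwards [hm d hd j] with y hy _ using hy
      · exact Eventually.of_forall fun y h => absurd h hd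
    filter_upwards [hae] with y hy hyr
    have hyϱ := hsub hyr
    have hb : ∀ j, |u y - v y| ≤ 5 * (c * γ ^ j) := fun j => by
      obtain ⟨d, ⟨hd1, hd2⟩, hdD⟩ := hDd.inter_open_nonempty (ball y (R j) ∩ ball x₀ ϱ)
        (isOpen_ball.inter isOpen_ball) ⟨y, mem_ball_self (hR0 j), hyϱ⟩
      have h1 := hy d hdD j hd2 (mem_ball_comm.1 hd1)
      have h2 := abs_le.1 (hvm d hd2 j)
      have h3 := abs_le.1 (hvv d hd2 y hyϱ j hd1)
      have : 0 < c * γ ^ j := by positivity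
      rw [abs_le]
      constructor <;> linarith
    have h0 : |u y - v y| ≤ 0 := ge_of_tendsto' (by simpa using hlim.const_mul 5) hb
    exact sub_eq_zero.1 (abs_nonpos_iff.1 h0)
  · rcases eq_or_ne x y with rfl | hxy
    · simp [Real.zero_rpow hα.1.ne']
    have hd0 : 0 < dist x y := dist_pos.2 hxy
    have hd1 : dist x y < R₀ := by
      have h1 : dist x x₀ < R₀ / 2 := hx
      have h2 : dist y x₀ < R₀ / 2 := hy
      linarith [dist_triangle_right x y x₀]
    obtain ⟨j, hj1, hj2⟩ : ∃ j, dist x y < R j ∧ R (j + 1) ≤ dist x y := by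
      have hex : ∃ j, R j ≤ dist x y := by
        obtain ⟨j, hj⟩ := exists_pow_lt_of_lt_one (x := dist x y / R₀) (y := (1 / 4 : ℝ))
          (by positivity) (by norm_num)
        refine ⟨j, ?_⟩
        rw [lt_div_iff₀ hR₀, mul_comm] at hj
        exact hj.le
      classical
      obtain ⟨j, hj⟩ := Nat.exists_eq_succ_of_ne_zero (n := Nat.find hex) fun h0 => by
        have := Nat.find_spec hex
        rw [h0] at this
        simp only [hR, pow_zero, mul_one] at this
        linarith
      refine ⟨j, not_le.1 (Nat.find_min hex (by omega)), ?_⟩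
      have := Nat.find_spec hex
      rwa [hj] at this
    have hj3 : (1 / 4 : ℝ) ^ j ≤ 4 / R₀ * dist x y := by
      simp only [hR] at hj2
      rw [div_mul_eq_mul_div, le_div_iff₀ hR₀]
      rw [pow_succ] at hj2
      linarith
    calc |v x - v y| ≤ 3 * (c * γ ^ j) := hvv x (hsub hx) y (hsub hy) j hj1
      _ ≤ 3 * (c * ((1 / 4 : ℝ) ^ α) ^ j) := by gcongr
      _ = 3 * c * ((1 / 4 : ℝ) ^ j) ^ α := by
          rw [← Real.rpow_natCast, ← Real.rpow_natCast, ← Real.rpow_mul (by norm_num),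
            ← Real.rpow_mul (by norm_num), mul_comm α]
          ring
      _ ≤ 3 * c * (4 / R₀ * dist x y) ^ α := by
          have := hα.1
          gcongr
      _ = 3 * c * (4 / R₀) ^ α * ‖x - y‖ ^ α := by
          rw [Real.mul_rpow (by positivity) (by positivity), dist_eq_norm]
          ring

end OscillationDecay

/-- Near the diagonal point `(x₀, x₀)` the oscillation of the exponent is small. -/
lemma exists_local_exponent_bounds {n : ℕ} {s gM : ℝ} {p : Rn n → Rn n → ℝ} {Ω : Set (Rn n)}
    {x₀ : Rn n} (hn : 1 ≤ n) (hs : s ∈ Ioo (0 : ℝ) 1)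
    (hc : Continuous fun w : Rn n × Rn n => p w.1 w.2) (hb : ∀ x y, p x y ≤ gM)
    (hp1 : 1 < p x₀ x₀) (hΩ : IsOpen Ω) (hx₀ : x₀ ∈ Ω) :
    ∃ R q Q, 0 < R ∧ R ≤ 1 ∧ closedBall x₀ R ⊆ Ω ∧ 1 < q ∧ Q ≤ gM ∧ Q < q * (1 + s * q / n) ∧
      ∀ x ∈ ball x₀ R, ∀ y ∈ ball x₀ R, q ≤ p x y ∧ p x y ≤ Q := by
  have hs0 := hs.1
  have hn0 : (0 : ℝ) < n := by exact_mod_cast hn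
  set P := p x₀ x₀
  obtain ⟨ε, hε, hε1, hεP⟩ : ∃ ε : ℝ, 0 < ε ∧ 1 < P - ε ∧
      P + ε < (P - ε) * (1 + s * (P - ε) / n) := by
    have h1 : ∀ᶠ ε : ℝ in 𝓝 0, 1 < P - ε :=
      ContinuousAt.eventually_lt (by fun_prop) (by fun_prop) (by simpa using hp1)
    have h2 : ∀ᶠ ε : ℝ in 𝓝 0, P + ε < (P - ε) * (1 + s * (P - ε) / n) := by
      refine ContinuousAt.eventually_lt (by fun_prop) (by fun_prop) ?_
      have : 0 < P * (s * P / n) := by positivity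
      simp only [add_zero, sub_zero]
      linarith
    obtain ⟨ε, ⟨h1, h2⟩, hε⟩ := (((h1.and h2).filter_mono nhdsWithin_le_nhds).and
      (self_mem_nhdsWithin (a := (0 : ℝ)) (s := Ioi 0))).exists
    exact ⟨ε, hε, h1, h2⟩
  have hnear : ∀ᶠ w : Rn n × Rn n in 𝓝 (x₀, x₀), p w.1 w.2 ∈ Icc (P - ε) (P + ε) :=
    hc.continuousAt.eventually (Icc_mem_nhds (by simp only; linarith) (by simp only; linarith))
  obtain ⟨R₁, hR₁, hR₁p⟩ := Metric.eventually_nhds_iff_ball.1 hnear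
  obtain ⟨R₂, hR₂, hR₂Ω⟩ := nhds_basis_closedBall.mem_iff.1 (hΩ.mem_nhds hx₀)
  refine ⟨min 1 (min R₁ R₂), P - ε, min (P + ε) gM, by positivity, min_le_left _ _,
    (closedBall_subset_closedBall ((min_le_right _ _).trans (min_le_right _ _))).trans hR₂Ω, hε1,
    min_le_right _ _, (min_le_left _ _).trans_lt hεP, fun x hx y hy => ?_⟩
  have hR : min 1 (min R₁ R₂) ≤ R₁ := (min_le_right _ _).trans (min_le_left _ _)
  have := hR₁p (x, y) (by
    rw [← ball_prod_same]
    exact ⟨ball_subset_ball hR hx, ball_subset_ball hR hy⟩)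
  exact ⟨this.1, le_min this.2 (hb x y)⟩

/-- local Hölder continuity of weak solutions under (P1) and (P2). -/
theorem statement3 {n : ℕ} (hn : 1 ≤ n) (s : ℝ) (hs : s ∈ Set.Ioo (0:ℝ) 1)
    (p : Rn n → Rn n → ℝ) (hp : ExponentOK p)
    (Ω : Set (Rn n)) (hΩo : IsOpen Ω) (hΩb : Bornology.IsBounded Ω) (hΩne : Ω.Nonempty)
    (hP1 : ∃ L > 0, CondP1 p Ω L) (hP2 : CondP2 p Ω)
    (u : Rn n → ℝ) (hu : MemW s p u) (hsol : IsWeakSol s p Ω u)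
    (htail : ∃ M : ℝ, ∀ x ∈ Ω,
      (∫⁻ y, ENNReal.ofReal (|u y| ^ (p x y - 1) / (1 + ‖y‖ ^ ((n : ℝ) + s * p x y))))
        ≤ ENNReal.ofReal M) :
    ∀ x₀ ∈ Ω, ∃ r > 0, ball x₀ r ⊆ Ω ∧
      ∃ α ∈ Set.Ioo (0:ℝ) 1, ∃ C > 0, ∃ v : Rn n → ℝ,
        (∀ᵐ x, x ∈ ball x₀ r → u x = v x) ∧
        ∀ x ∈ ball x₀ r, ∀ y ∈ ball x₀ r, |v x - v y| ≤ C * ‖x - y‖ ^ α := by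
  intro x₀ hx₀
  obtain ⟨L, -, hP1⟩ := hP1
  obtain ⟨hc, -, pm, gM, hpm, hb⟩ := id hp
  have hdiag : ∀ x ∈ Ω, ∀ y, p x y ≤ p x x := fun x hx y => exponent_le_diagonal hp hΩo hP2 hx y
  obtain ⟨R, q, Q, hR, hR1, hRΩ, hq1, hQ, hβ, hq⟩ := exists_local_exponent_bounds hn hs hc
    (fun x y => (hb x y).2) (hpm.trans_le (hb x₀ x₀).1) hΩo hx₀
  obtain ⟨M₁, hM₁⟩ := hsol.1.exists_ae_le hn hs hp hu hdiag hΩb htail hR hR1 hRΩ hq1 hq hβ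
  obtain ⟨M₂, hM₂⟩ := hsol.2.neg.exists_ae_le hn hs hp hu.neg hdiag hΩb
    (by simpa only [abs_neg] using htail) hR hR1 hRΩ hq1 hq hβ
  set M₀ := max 1 (max M₁ M₂)
  have hM₀ : 0 < M₀ := by positivity
  have huM : ∀ᵐ x, x ∈ ball x₀ (R * (1 / 4)) → |u x| ≤ M₀ := by
    filter_upwards [hM₁, hM₂] with x h1 h2 hx
    exact abs_le'.2 ⟨(h1 hx).trans ((le_max_left _ _).trans (le_max_right _ _)),
      (h2 hx).trans ((le_max_right _ _).trans (le_max_right _ _))⟩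
  obtain ⟨C₀, hC₀, hfar⟩ := exists_far_tail hn hs hpm hb hc.measurable hΩb htail hM₀.le
  set ϱ := R / 12 with hϱd
  have hϱ : 0 < ϱ := by positivity
  have h3ϱ : 3 * ϱ = R * (1 / 4) := by rw [hϱd]; ring
  have h3R : 3 * ϱ ≤ R := by linarith
  have h3Ω : closedBall x₀ (3 * ϱ) ⊆ Ω := (closedBall_subset_closedBall h3R).trans hRΩ
  obtain ⟨γ, hγ, R₀, hR₀, hR₀ϱ, hstep⟩ := exists_oscillation_step hn hs hp hpm hb hdiag hP1 hϱ
    (by linarith) h3Ω hq1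
    (fun x hx y hy => hq x (ball_subset_ball h3R hx) y (ball_subset_ball h3R hy)) hQ hβ.le hM₀ hC₀
  obtain ⟨α, hα, C, hC, v, hv⟩ := exists_holder_representative (u := u) (x₀ := x₀) (c := 2 * M₀)
    (by positivity) hγ hR₀ hR₀ϱ fun z hz j => by
      refine (hstep u hsol.1 hu hfar z hz).exists_oscillation_le hM₀ hγ hR₀ hR₀ϱ
        (hstep _ hsol.2.neg hu.neg (by simpa only [abs_neg] using hfar) z hz) ?_ j
      filter_upwards [huM] with y hy hy'
      refine hy (h3ϱ ▸ ball_subset_ball' ?_ hy')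
      linarith [mem_ball.1 hz]
  exact ⟨R₀ / 2, by positivity, (ball_subset_closedBall.trans
    (closedBall_subset_closedBall (by linarith))).trans h3Ω, α, hα, C, hC, v, hv⟩
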